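/- For every real x ≥ 10, the largest cardinality of a subset of {n ∈ ℕ : 1 ≤ n ≤ x} on which the sum-of-divisors function σ is nondecreasing is equal to (1 + O((log log x)^5 / log x)) · π(x); that is, there is an absolute constant C > 0 such that π(x) ≤ M_σ(x) ≤ (1 + C·(log log x)^5/log x)·π(x), where M_σ(x) denotes this largest cardinality. -/

import Mathlib

open scoped BigOperators

/-- The sum-of-divisors function `σ(n) = ∑_{d ∣ n} d`. -/
def sigma1 (n : ℕ) : ℕ := ∑ d ∈ n.divisors, d

/-- `Msigma A` is the largest cardinality of a subset of `A` on which the sum-of-divisors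
function is nondecreasing. -/
noncomputable def Msigma (A : Set ℕ) : ℕ :=
  sSup {k : ℕ | ∃ B : Finset ℕ, ↑B ⊆ A ∧
    (∀ m ∈ B, ∀ n ∈ B, m ≤ n → sigma1 m ≤ sigma1 n) ∧ B.card = k}

/-- `MsigmaX x = Msigma([x])` where `[x] = {n : ℕ | 1 ≤ n ≤ x}`. -/
noncomputable def MsigmaX (x : ℝ) : ℕ := Msigma {n : ℕ | 1 ≤ n ∧ (n : ℝ) ≤ x}

/-- The number of primes up to the real number `x`. -/
noncomputable def primePi (x : ℝ) : ℕ := {p : ℕ | p.Prime ∧ (p : ℝ) ≤ x}.ncard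

section

open Complex Filter Topology Set

/-- The error made when replacing `n ^ (-s)` by the integral of `u ^ (-s)` over `[n, n + 1]`. -/
noncomputable def zetaTerm (n : ℕ) (s : ℂ) : ℂ :=
  (n : ℂ) ^ (-s) - (((n : ℂ) + 1) ^ (1 - s) - (n : ℂ) ^ (1 - s)) / (1 - s)

lemma zetaTerm_eq_integral {n : ℕ} (hn : 1 ≤ n) {s : ℂ} (hs : s ≠ 1) :
    zetaTerm n s = ∫ u in (n : ℝ)..((n : ℝ) + 1), ((n : ℂ) ^ (-s) - (u : ℂ) ^ (-s)) := by
  have hn' : (1 : ℝ) ≤ n := by exact_mod_cast hn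
  have hmem : (0 : ℝ) ∉ Set.uIcc (n : ℝ) ((n : ℝ) + 1) := by
    rw [Set.uIcc_of_le (by linarith)]
    rintro ⟨h, -⟩
    linarith
  have hne : -s ≠ -1 := fun h => hs (neg_injective h)
  rw [intervalIntegral.integral_sub (by simp)
    (intervalIntegral.intervalIntegrable_cpow (Or.inr hmem)), integral_cpow (Or.inr ⟨hne, hmem⟩)]
  simp only [zetaTerm, intervalIntegral.integral_const, add_sub_cancel_left, one_smul]
  push_cast
  rw [show -s + 1 = 1 - s by ring]

lemma norm_natCast_cpow_sub_le {n : ℕ} (hn : 1 ≤ n) {s : ℂ} (hs : 0 < s.re) {u : ℝ}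
    (hu : u ∈ Set.Icc (n : ℝ) (n + 1)) :
    ‖(n : ℂ) ^ (-s) - (u : ℂ) ^ (-s)‖ ≤ ‖s‖ * (n : ℝ) ^ (-s.re - 1) := by
  have hn' : (1 : ℝ) ≤ n := by exact_mod_cast hn
  have hder : ∀ v ∈ Set.Icc (n : ℝ) (n + 1),
      HasDerivWithinAt (fun v : ℝ => (v : ℂ) ^ (-s)) (-s * (v : ℂ) ^ (-s - 1))
        (Set.Icc (n : ℝ) (n + 1)) v := by
    intro v hv
    have hv0 : (v : ℂ) ∈ slitPlane := Or.inl (by simpa using by linarith [hv.1])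
    have h1 := (hasDerivAt_id (v : ℂ)).cpow_const (c := -s) hv0
    simpa using h1.comp_ofReal.hasDerivWithinAt
  have hbound : ∀ v ∈ Set.Icc (n : ℝ) (n + 1),
      ‖-s * (v : ℂ) ^ (-s - 1)‖ ≤ ‖s‖ * (n : ℝ) ^ (-s.re - 1) := by
    intro v hv
    have hv0 : 0 < v := by linarith [hv.1]
    rw [norm_mul, norm_neg, norm_cpow_eq_rpow_re_of_pos hv0]
    refine mul_le_mul_of_nonneg_left ?_ (norm_nonneg _)
    simpa using Real.rpow_le_rpow_of_nonpos (by linarith) hv.1 (by linarith : -s.re - 1 ≤ 0)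
  have := (convex_Icc (n : ℝ) (n + 1)).norm_image_sub_le_of_norm_hasDerivWithin_le hder hbound
    hu (Set.left_mem_Icc.2 (by linarith))
  simp only [ofReal_natCast] at this
  refine this.trans ?_
  have h2 : ‖(n : ℝ) - u‖ ≤ 1 := by
    rw [Real.norm_eq_abs, abs_le]; constructor <;> linarith [hu.1, hu.2]
  exact mul_le_of_le_one_right (by positivity) h2

lemma norm_zetaTerm_le {n : ℕ} (hn : 1 ≤ n) {s : ℂ} (hs1 : s ≠ 1) (hs : 0 < s.re) :
    ‖zetaTerm n s‖ ≤ ‖s‖ * (n : ℝ) ^ (-s.re - 1) := by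
  rw [zetaTerm_eq_integral hn hs1]
  have := intervalIntegral.norm_integral_le_of_norm_le_const (a := (n : ℝ)) (b := (n : ℝ) + 1)
    (f := fun u : ℝ => (n : ℂ) ^ (-s) - (u : ℂ) ^ (-s)) (C := ‖s‖ * (n : ℝ) ^ (-s.re - 1)) (by
      intro u hu
      rw [Set.uIoc_of_le (by linarith)] at hu
      exact norm_natCast_cpow_sub_le hn hs ⟨hu.1.le, hu.2⟩)
  simpa using this

lemma tail_bound_step {n : ℝ} (hn : 1 ≤ n) :
    n ^ (-(3 / 2) : ℝ) ≤ 4 * (n ^ (-(1 / 2) : ℝ) - (n + 1) ^ (-(1 / 2) : ℝ)) := by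
  have h0 : 0 < n := by linarith
  have e1 : n ^ (-(3 / 2) : ℝ) = 1 / (n * √n) := by
    rw [Real.rpow_neg h0.le, show (3 / 2 : ℝ) = 1 + 1 / 2 by norm_num, Real.rpow_add h0,
      Real.rpow_one, ← Real.sqrt_eq_rpow, one_div]
  have e2 : ∀ m : ℝ, 0 < m → m ^ (-(1 / 2) : ℝ) = 1 / √m := by
    intro m hm
    rw [Real.rpow_neg hm.le, ← Real.sqrt_eq_rpow, one_div]
  rw [e1, e2 n h0, e2 (n + 1) (by linarith)]
  have ha : 0 < √n := Real.sqrt_pos.2 h0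
  have hb : 0 < √(n + 1) := Real.sqrt_pos.2 (by linarith)
  have ha2 : √n ^ 2 = n := Real.sq_sqrt h0.le
  have hb2 : √(n + 1) ^ 2 = n + 1 := Real.sq_sqrt (by linarith)
  set a := √n
  set b := √(n + 1)
  have hab : b ≤ 3 / 2 * a := by
    by_contra h
    push Not at h
    nlinarith
  have key : 1 / a - 1 / b = 1 / (a * b * (a + b)) := by
    field_simp
    nlinarith
  rw [key, ← ha2]
  rw [mul_one_div, div_le_div_iff₀ (by positivity) (by positivity)]
  nlinarith [mul_pos ha hb, mul_pos (mul_pos ha hb) ha, mul_pos ha (mul_pos ha ha), mul_le_mul_of_nonneg_left hab ha.le, mul_le_mul_of_nonneg_left hab (mul_pos ha ha).le, mul_le_mul_of_nonneg_left hab (mul_pos ha hb).le]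

lemma tail_summable_and_bound (N : ℕ) :
    Summable (fun k : ℕ => ((k + N + 1 : ℕ) : ℝ) ^ (-(3 / 2) : ℝ)) ∧
      ∑' k : ℕ, ((k + N + 1 : ℕ) : ℝ) ^ (-(3 / 2) : ℝ) ≤ 4 * ((N + 1 : ℕ) : ℝ) ^ (-(1 / 2) : ℝ) := by
  have hs : Summable (fun k : ℕ => ((k + N + 1 : ℕ) : ℝ) ^ (-(3 / 2) : ℝ)) := by
    have := (Real.summable_nat_rpow (p := -(3 / 2))).2 (by norm_num)
    simpa only [add_assoc] using (summable_nat_add_iff (N + 1)).2 this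
  refine ⟨hs, ?_⟩
  refine hs.tsum_le_of_sum_range_le fun M => ?_
  have : ∀ M : ℕ, ∑ k ∈ Finset.range M, ((k + N + 1 : ℕ) : ℝ) ^ (-(3 / 2) : ℝ) ≤
      4 * (((N + 1 : ℕ) : ℝ) ^ (-(1 / 2) : ℝ) - ((M + N + 1 : ℕ) : ℝ) ^ (-(1 / 2) : ℝ)) := by
    intro M
    induction M with
    | zero => simp
    | succ M ih =>
      rw [Finset.sum_range_succ]
      have := tail_bound_step (n := ((M + N + 1 : ℕ) : ℝ)) (by push_cast; linarith [Nat.cast_nonneg (α := ℝ) M, Nat.cast_nonneg (α := ℝ) N])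
      rw [show ((M + 1 + N + 1 : ℕ) : ℝ) = ((M + N + 1 : ℕ) : ℝ) + 1 by push_cast; ring]
      linarith
  refine (this M).trans ?_
  have : 0 ≤ ((M + N + 1 : ℕ) : ℝ) ^ (-(1 / 2) : ℝ) := by positivity
  linarith

end

section

open Complex Filter Topology Set

/-- The approximation to `ζ` obtained by replacing the tail of the series by an integral. -/
noncomputable def zetaApprox (N : ℕ) (s : ℂ) : ℂ :=
  ∑ k ∈ Finset.range N, ((k : ℂ) + 1) ^ (-s) + ((N : ℂ) + 1) ^ (1 - s) / (s - 1) +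
    ∑' k : ℕ, zetaTerm (k + N + 1) s

lemma tendsto_natCast_cpow_zero {s : ℂ} (hs : 1 < s.re) :
    Tendsto (fun M : ℕ => ((M : ℂ)) ^ (1 - s)) atTop (𝓝 0) := by
  rw [tendsto_zero_iff_norm_tendsto_zero]
  have h1 : Tendsto (fun M : ℕ => (M : ℝ) ^ (-(s.re - 1))) atTop (𝓝 0) :=
    (tendsto_rpow_neg_atTop (by linarith : 0 < s.re - 1)).comp tendsto_natCast_atTop_atTop
  refine h1.congr' ?_
  filter_upwards [eventually_gt_atTop 0] with M hM
  rw [norm_natCast_cpow_of_pos hM]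
  simp

lemma zeta_eq_zetaApprox (N : ℕ) {s : ℂ} (hs : 1 < s.re) : riemannZeta s = zetaApprox N s := by
  have hs1 : s ≠ 1 := by rintro rfl; simp at hs
  have hsum : Summable (fun k : ℕ => ((k : ℂ) + 1) ^ (-s)) := by
    have := (summable_nat_add_iff 1).2 ((Complex.summable_one_div_nat_cpow (p := s)).2 hs)
    refine this.congr fun k => ?_
    rw [cpow_neg]; push_cast; simp
  have hz : riemannZeta s = ∑' k : ℕ, ((k : ℂ) + 1) ^ (-s) := by
    rw [zeta_eq_tsum_one_div_nat_add_one_cpow hs]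
    congr 1; ext k; rw [cpow_neg]; simp
  have hsum' : Summable (fun k : ℕ => (((k + N + 1 : ℕ)) : ℂ) ^ (-s)) := by
    refine ((summable_nat_add_iff N).2 hsum).congr fun k => ?_
    push_cast; rfl
  rw [hz, ← hsum.sum_add_tsum_nat_add N, zetaApprox, add_assoc]
  congr 1
  -- telescoping
  have htel : HasSum (fun k : ℕ => (((k + N + 1 : ℕ) : ℂ) + 1) ^ (1 - s) / (1 - s)
      - ((k + N + 1 : ℕ) : ℂ) ^ (1 - s) / (1 - s)) (0 - ((N : ℂ) + 1) ^ (1 - s) / (1 - s)) := by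
    have hf : Tendsto (fun M : ℕ => ((M + N + 1 : ℕ) : ℂ) ^ (1 - s) / (1 - s)) atTop (𝓝 0) := by
      have := ((tendsto_natCast_cpow_zero hs).comp (tendsto_add_atTop_nat (N + 1))).div_const (1 - s)
      simpa [Function.comp_def, add_assoc] using this
    have hs2 : Summable (fun k : ℕ => (((k + N + 1 : ℕ) : ℂ) + 1) ^ (1 - s) / (1 - s)
      - ((k + N + 1 : ℕ) : ℂ) ^ (1 - s) / (1 - s)) := by
      have h3 : Summable (fun k : ℕ => zetaTerm (k + N + 1) s) := by
        refine Summable.of_norm_bounded (g := fun k : ℕ => ‖s‖ * ((k + N + 1 : ℕ) : ℝ) ^ (-s.re - 1)) ?_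
          (fun k => norm_zetaTerm_le (by omega) hs1 (by linarith))
        refine Summable.mul_left _ ?_
        have := (Real.summable_nat_rpow (p := -s.re - 1)).2 (by linarith)
        simpa only [add_assoc] using (summable_nat_add_iff (N + 1)).2 this
      refine (hsum'.sub h3).congr fun k => ?_
      simp only [zetaTerm]; ring
    have := (hs2.hasSum_iff_tendsto_nat (m := (0 - ((N : ℂ) + 1) ^ (1 - s) / (1 - s)))).2 ?_
    · exact this
    · have hsumeq : ∀ M : ℕ, ∑ k ∈ Finset.range M, ((((k + N + 1 : ℕ) : ℂ) + 1) ^ (1 - s) / (1 - s)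
        - ((k + N + 1 : ℕ) : ℂ) ^ (1 - s) / (1 - s)) = ((M + N + 1 : ℕ) : ℂ) ^ (1 - s) / (1 - s) -
          ((N : ℂ) + 1) ^ (1 - s) / (1 - s) := by
        intro M
        have := Finset.sum_range_sub (fun k : ℕ => ((k + N + 1 : ℕ) : ℂ) ^ (1 - s) / (1 - s)) M
        rw [← (by push_cast; simp : ((0 + N + 1 : ℕ) : ℂ) = (N : ℂ) + 1), ← this]
        refine Finset.sum_congr rfl fun k _ => ?_
        push_cast; ring_nf
      simp_rw [hsumeq]
      exact hf.sub_const _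
  have : ∀ k : ℕ, zetaTerm (k + N + 1) s = ((k + N + 1 : ℕ) : ℂ) ^ (-s) -
      ((((k + N + 1 : ℕ) : ℂ) + 1) ^ (1 - s) / (1 - s)
      - ((k + N + 1 : ℕ) : ℂ) ^ (1 - s) / (1 - s)) := by
    intro k; simp only [zetaTerm]; ring
  simp_rw [this]
  rw [hsum'.tsum_sub htel.summable, htel.tsum_eq]
  have h5 : ((N : ℂ) + 1) ^ (1 - s) / (s - 1) = - (((N : ℂ) + 1) ^ (1 - s) / (1 - s)) := by
    rw [← neg_sub 1 s, div_neg]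
  rw [h5]
  push_cast
  ring

lemma differentiableAt_cpow_neg (n : ℕ) (a b : ℂ) (s : ℂ) :
    DifferentiableAt ℂ (fun s : ℂ => ((n : ℂ) + 1) ^ (a * s + b)) s := by
  have : ((n : ℂ) + 1) ≠ 0 := by exact_mod_cast Nat.succ_ne_zero n
  exact DifferentiableAt.const_cpow (by fun_prop) (Or.inl this)

lemma differentiableOn_zetaApprox (N : ℕ) :
    DifferentiableOn ℂ (zetaApprox N) {s | 1 / 2 < s.re ∧ 0 < s.im} := by
  have hopen : IsOpen {s : ℂ | 1 / 2 < s.re ∧ 0 < s.im} :=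
    (isOpen_lt continuous_const continuous_re).inter (isOpen_lt continuous_const continuous_im)
  have hne : ∀ s ∈ {s : ℂ | 1 / 2 < s.re ∧ 0 < s.im}, s - 1 ≠ 0 := by
    intro s hs h
    have := congrArg Complex.im h
    simp at this
    linarith [hs.2]
  have hterm : ∀ n : ℕ, DifferentiableOn ℂ (zetaTerm (n + 1)) {s | 1 / 2 < s.re ∧ 0 < s.im} := by
    intro n s hs
    have h1 : (1 - s) ≠ 0 := by
      intro h; exact hne s hs (by rw [← neg_sub, h, neg_zero])
    refine DifferentiableAt.differentiableWithinAt ?_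
    have a1 := differentiableAt_cpow_neg n (-1) 0 s
    have a2 := differentiableAt_cpow_neg (n + 1) (-1) 1 s
    have a3 := differentiableAt_cpow_neg n (-1) 1 s
    have := a1.sub ((a2.sub a3).div (d := fun s : ℂ => 1 - s) (by fun_prop) h1)
    refine this.congr_of_eventuallyEq (Eventually.of_forall fun w => ?_)
    simp [zetaTerm, sub_eq_neg_add]
  refine (DifferentiableOn.add ?_ ?_).add ?_
  · intro s hs
    refine DifferentiableAt.differentiableWithinAt ?_
    refine DifferentiableAt.fun_sum fun k _ => ?_
    simpa using differentiableAt_cpow_neg k (-1) 0 s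
  · intro s hs
    refine DifferentiableAt.differentiableWithinAt ?_
    have := (differentiableAt_cpow_neg N (-1) 1 s).div (d := fun s : ℂ => s - 1) (by fun_prop) (hne s hs)
    refine this.congr_of_eventuallyEq (Eventually.of_forall fun w => ?_)
    simp [sub_eq_neg_add]
  · intro s0 hs0
    -- work on a bounded neighbourhood
    set U : Set ℂ := {s : ℂ | 1 / 2 < s.re ∧ 0 < s.im} ∩ Metric.ball 0 (‖s0‖ + 1) with hU
    have hUo : IsOpen U := hopen.inter Metric.isOpen_ball
    have hd : DifferentiableOn ℂ (fun s => ∑' k : ℕ, zetaTerm (k + N + 1) s) U := by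
      refine differentiableOn_tsum_of_summable_norm
        (u := fun k : ℕ => (‖s0‖ + 1) * ((k + N + 1 : ℕ) : ℝ) ^ (-(3 / 2) : ℝ))
        ((tail_summable_and_bound N).1.mul_left _) (fun k => (hterm (k + N)).mono inter_subset_left)
        hUo ?_
      rintro k s ⟨hs, hb⟩
      have hs1 : s ≠ 1 := fun h => hne s hs (by rw [h, sub_self])
      refine (norm_zetaTerm_le (by omega) hs1 (by linarith [hs.1])).trans ?_
      refine mul_le_mul (by simpa using (mem_ball_zero_iff.1 hb).le) ?_ (by positivity) (by positivity)
      exact Real.rpow_le_rpow_of_exponent_le (by exact_mod_cast (by omega : 1 ≤ k + N + 1)) (by linarith [hs.1])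
    have hmem : s0 ∈ U := ⟨hs0, by simp⟩
    exact ((hd s0 hmem).differentiableAt (hUo.mem_nhds hmem)).differentiableWithinAt

lemma zeta_eq_zetaApprox_of_im_pos (N : ℕ) {s : ℂ} (hs : 1 / 2 < s.re) (him : 0 < s.im) :
    riemannZeta s = zetaApprox N s := by
  set V : Set ℂ := {s : ℂ | 1 / 2 < s.re ∧ 0 < s.im}
  have hopen : IsOpen V :=
    (isOpen_lt continuous_const continuous_re).inter (isOpen_lt continuous_const continuous_im)
  have hconv : Convex ℝ V := (convex_halfSpace_re_gt _).inter (convex_halfSpace_im_gt _)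
  have h1 : AnalyticOnNhd ℂ riemannZeta V := by
    refine DifferentiableOn.analyticOnNhd (fun w hw => ?_) hopen
    refine (differentiableAt_riemannZeta ?_).differentiableWithinAt
    rintro rfl
    simpa using hw.2
  have h2 : AnalyticOnNhd ℂ (zetaApprox N) V := (differentiableOn_zetaApprox N).analyticOnNhd hopen
  have hz0 : (2 + I : ℂ) ∈ V := by constructor <;> norm_num
  refine h1.eqOn_of_preconnected_of_eventuallyEq h2 hconv.isPreconnected hz0 ?_ ⟨hs, him⟩
  have : {s : ℂ | 1 < s.re} ∈ 𝓝 (2 + I : ℂ) :=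
    (isOpen_lt continuous_const continuous_re).mem_nhds (by norm_num)
  filter_upwards [this] with w hw using zeta_eq_zetaApprox N hw

end

section

open Complex Filter Topology Set

lemma norm_zeta_le_of_one_le_im {δ : ℝ} (hδ : 0 < δ) (hδ' : δ ≤ 1 / 4) {s : ℂ}
    (h1 : 1 - δ ≤ s.re) (h2 : s.re ≤ 3) (h3 : 1 ≤ s.im) :
    ‖riemannZeta s‖ ≤ (19 + 1 / δ) * s.im ^ (2 * δ) := by
  set t := s.im with ht
  set N := ⌊t⌋₊ with hN
  have ht0 : 0 < t := by linarith
  have hN1 : 1 ≤ N := Nat.le_floor (by simpa using h3)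
  have hNt : (N : ℝ) ≤ t := Nat.floor_le ht0.le
  have hNt' : t < N + 1 := Nat.lt_floor_add_one t
  have hN0 : (0 : ℝ) < N := by exact_mod_cast hN1
  have htd : t ^ δ ≤ t ^ (2 * δ) := Real.rpow_le_rpow_of_exponent_le h3 (by linarith)
  rw [zeta_eq_zetaApprox_of_im_pos N (by linarith) (by linarith), zetaApprox]
  have b1 : ‖∑ k ∈ Finset.range N, ((k : ℂ) + 1) ^ (-s)‖ ≤ (1 + 1 / δ) * t ^ (2 * δ) := by
    have hterm : ∀ k ∈ Finset.range N, ‖((k : ℂ) + 1) ^ (-s)‖ ≤ t ^ δ * ((k : ℝ) + 1)⁻¹ := by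
      intro k hk
      have hk' : (k : ℝ) + 1 ≤ t := by
        refine le_trans ?_ hNt
        exact_mod_cast Finset.mem_range.1 hk
      have e : ((k : ℂ) + 1) = ((k + 1 : ℕ) : ℂ) := by push_cast; rfl
      rw [e, norm_natCast_cpow_of_pos (by omega)]
      have hk0 : (0 : ℝ) < (k : ℝ) + 1 := by positivity
      push_cast
      calc ((k : ℝ) + 1) ^ (-s).re ≤ ((k : ℝ) + 1) ^ (δ + (-1)) :=
            Real.rpow_le_rpow_of_exponent_le (by linarith [(Nat.cast_nonneg k : (0 : ℝ) ≤ k)])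
              (by simp only [neg_re]; linarith)
        _ = ((k : ℝ) + 1) ^ δ * ((k : ℝ) + 1)⁻¹ := by
            rw [Real.rpow_add hk0, Real.rpow_neg_one]
        _ ≤ _ := by gcongr
    refine (norm_sum_le_of_le _ hterm).trans ?_
    rw [← Finset.mul_sum]
    have hh : ∑ k ∈ Finset.range N, ((k : ℝ) + 1)⁻¹ ≤ 1 + Real.log N := by
      have := harmonic_le_one_add_log N
      simpa [harmonic] using this
    have hlog : Real.log N ≤ t ^ δ / δ :=
      (Real.log_le_log hN0 hNt).trans (Real.log_le_rpow_div ht0.le hδ)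
    have hone : 1 ≤ t ^ δ := Real.one_le_rpow h3 hδ.le
    have e2 : t ^ (2 * δ) = t ^ δ * t ^ δ := by rw [two_mul, Real.rpow_add ht0]
    calc t ^ δ * ∑ k ∈ Finset.range N, ((k : ℝ) + 1)⁻¹ ≤ t ^ δ * (t ^ δ + t ^ δ / δ) := by
          gcongr; linarith
      _ = _ := by rw [e2]; ring
  have hNC : ((N : ℂ) + 1) = ((N + 1 : ℕ) : ℂ) := by push_cast; rfl
  have b2 : ‖((N : ℂ) + 1) ^ (1 - s) / (s - 1)‖ ≤ 2 * t ^ (2 * δ) := by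
    rw [norm_div, hNC, norm_natCast_cpow_of_pos (by omega)]
    have hd : 1 ≤ ‖s - 1‖ := by
      have := abs_im_le_norm (s - 1)
      simp only [sub_im, one_im, sub_zero] at this
      rw [abs_of_pos (by linarith)] at this
      linarith
    refine (div_le_self (by positivity) hd).trans ?_
    push_cast
    calc ((N : ℝ) + 1) ^ (1 - s).re ≤ ((N : ℝ) + 1) ^ δ :=
          Real.rpow_le_rpow_of_exponent_le (by linarith) (by simp only [sub_re, one_re]; linarith)
      _ ≤ (2 * t) ^ δ := Real.rpow_le_rpow (by positivity) (by linarith) hδ.le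
      _ = 2 ^ δ * t ^ δ := Real.mul_rpow (by norm_num) ht0.le
      _ ≤ 2 ^ (1 : ℝ) * t ^ (2 * δ) := by
          gcongr
          · norm_num
          · linarith
      _ = _ := by norm_num
  have b3 : ‖∑' k : ℕ, zetaTerm (k + N + 1) s‖ ≤ 16 * t ^ (2 * δ) := by
    have hs1 : s ≠ 1 := by
      rintro rfl
      simp [ht] at h3
      linarith
    have hsn : ‖s‖ ≤ 4 * t := by
      have := norm_le_abs_re_add_abs_im s
      rw [abs_of_pos (by linarith : 0 < s.re), abs_of_pos (by linarith : 0 < s.im)] at this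
      linarith
    have hterm : ∀ k : ℕ, ‖zetaTerm (k + N + 1) s‖ ≤
        (4 * t * ((N : ℝ) + 1) ^ (-(1 / 2 - δ))) * ((k + N + 1 : ℕ) : ℝ) ^ (-(3 / 2) : ℝ) := by
      intro k
      refine (norm_zetaTerm_le (by omega) hs1 (by linarith)).trans ?_
      have hm : (N : ℝ) + 1 ≤ ((k + N + 1 : ℕ) : ℝ) := by push_cast; linarith [(Nat.cast_nonneg k : (0 : ℝ) ≤ k)]
      have hm0 : (0 : ℝ) < ((k + N + 1 : ℕ) : ℝ) := by linarith
      calc ‖s‖ * ((k + N + 1 : ℕ) : ℝ) ^ (-s.re - 1)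
          ≤ (4 * t) * ((k + N + 1 : ℕ) : ℝ) ^ (-(1 / 2 - δ) + -(3 / 2)) := by
            gcongr
            · linarith
            · linarith
        _ = 4 * t * (((k + N + 1 : ℕ) : ℝ) ^ (-(1 / 2 - δ)) * ((k + N + 1 : ℕ) : ℝ) ^ (-(3 / 2) : ℝ)) := by
            rw [Real.rpow_add hm0]
        _ ≤ 4 * t * (((N : ℝ) + 1) ^ (-(1 / 2 - δ)) * ((k + N + 1 : ℕ) : ℝ) ^ (-(3 / 2) : ℝ)) := by
            have := Real.rpow_le_rpow_of_nonpos (by positivity : 0 < (N : ℝ) + 1) hm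
              (by linarith : -(1 / 2 - δ) ≤ 0)
            gcongr
        _ = _ := by ring
    obtain ⟨hsum, hle⟩ := tail_summable_and_bound N
    refine (tsum_of_norm_bounded (hsum.mul_left _).hasSum hterm).trans ?_
    rw [tsum_mul_left]
    have hN1' : (0 : ℝ) < (N : ℝ) + 1 := by positivity
    calc 4 * t * ((N : ℝ) + 1) ^ (-(1 / 2 - δ)) * ∑' k : ℕ, ((k + N + 1 : ℕ) : ℝ) ^ (-(3 / 2) : ℝ)
        ≤ 4 * t * ((N : ℝ) + 1) ^ (-(1 / 2 - δ)) * (4 * ((N + 1 : ℕ) : ℝ) ^ (-(1 / 2) : ℝ)) := by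
          gcongr
      _ = 16 * (t * ((N : ℝ) + 1) ^ (δ - 1)) := by
          push_cast
          rw [show δ - 1 = -(1 / 2 - δ) + -(1 / 2) by ring, Real.rpow_add hN1']
          ring
      _ ≤ 16 * (t * t ^ (δ - 1)) := by
          have := Real.rpow_le_rpow_of_nonpos ht0 hNt'.le (by linarith : δ - 1 ≤ 0)
          gcongr
      _ = 16 * t ^ δ := by
          rw [Real.rpow_sub_one ht0.ne']; field_simp
      _ ≤ _ := by gcongr
  refine (norm_add₃_le).trans ?_
  calc _ ≤ (1 + 1 / δ) * t ^ (2 * δ) + 2 * t ^ (2 * δ) + 16 * t ^ (2 * δ) := by gcongr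
    _ = _ := by ring

lemma norm_zeta_le {δ : ℝ} (hδ : 0 < δ) (hδ' : δ ≤ 1 / 4) {s : ℂ}
    (h1 : 1 - δ ≤ s.re) (h2 : s.re ≤ 3) (h3 : 1 ≤ |s.im|) :
    ‖riemannZeta s‖ ≤ (19 + 1 / δ) * |s.im| ^ (2 * δ) := by
  rcases le_total 0 s.im with h | h
  · rw [abs_of_nonneg h] at h3 ⊢
    exact norm_zeta_le_of_one_le_im hδ hδ' h1 h2 h3
  · rw [abs_of_nonpos h] at h3 ⊢
    have := norm_zeta_le_of_one_le_im hδ hδ' (s := (starRingEnd ℂ) s) (by simpa using h1)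
      (by simpa using h2) (by simpa using h3)
    rw [riemannZeta_conj] at this
    simpa using this

end

section

open Complex Filter Topology Set

lemma abs_rpow_le_two_mul {δ t t' : ℝ} (hδ : 0 < δ) (hδ' : δ ≤ 1 / 4) (h : |t'| ≤ 2 * |t|) :
    |t'| ^ (2 * δ) ≤ 2 * |t| ^ (2 * δ) := by
  calc |t'| ^ (2 * δ) ≤ (2 * |t|) ^ (2 * δ) := Real.rpow_le_rpow (abs_nonneg _) h (by linarith)
    _ = 2 ^ (2 * δ) * |t| ^ (2 * δ) := Real.mul_rpow (by norm_num) (abs_nonneg _)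
    _ ≤ 2 ^ (1 : ℝ) * |t| ^ (2 * δ) := by
        gcongr
        · norm_num
        · linarith
    _ = _ := by norm_num

/-- Upper bounds for `ζ` and `ζ'` slightly to the left of the line `Re s = 1`. -/
lemma exists_zeta_upper_bound {δ : ℝ} (hδ : 0 < δ) (hδ' : δ ≤ 1 / 4) :
    ∃ C : ℝ, 1 ≤ C ∧ 2 / δ ≤ C ∧
      (∀ x : ℝ, 0 < x → x ≤ 1 → ‖riemannZeta (1 + x)‖ ≤ C / x) ∧
      ∀ s : ℂ, 1 - δ / 2 ≤ s.re → s.re ≤ 5 / 2 → 2 ≤ |s.im| →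
        ‖riemannZeta s‖ ≤ C * |s.im| ^ (2 * δ) ∧ ‖deriv riemannZeta s‖ ≤ C * |s.im| ^ (2 * δ) := by
  obtain ⟨B, hB⟩ := (isCompact_Icc (a := (0 : ℝ)) (b := 1)).exists_bound_of_continuousOn
    (f := fun x : ℝ => riemannZeta₁ (1 + x))
    (by have := differentiable_riemannZeta₁.continuous; fun_prop)
  set C₁ := 19 + 1 / δ with hC₁
  have hδ2 : 0 < 1 / δ := by positivity
  have hC₁0 : 0 < C₁ := by positivity
  refine ⟨max (max 1 B) (C₁ * (4 / δ)), le_max_of_le_left (le_max_left _ _), ?_, ?_, ?_⟩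
  · refine le_max_of_le_right ?_
    have : 2 / δ = 1 * (2 / δ) := by ring
    rw [this]
    gcongr <;> linarith
  · intro x hx hx1
    rw [riemannZeta_eq_inv_sub_mul (by simpa using hx.ne')]
    rw [norm_mul, norm_inv]
    have h1 : ‖(1 + (x : ℂ) - 1)‖ = x := by simp [abs_of_pos hx]
    rw [h1, inv_mul_eq_div]
    gcongr
    exact (hB x ⟨hx.le, hx1⟩).trans (le_max_of_le_left (le_max_right _ _))
  · intro s h1 h2 h3
    have hT : 0 ≤ |s.im| ^ (2 * δ) := by positivity
    have hle : C₁ ≤ C₁ * (4 / δ) := by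
      refine le_mul_of_one_le_right hC₁0.le ?_
      rw [le_div_iff₀ hδ]; linarith
    constructor
    · refine (norm_zeta_le hδ hδ' (by linarith) (by linarith) (by linarith)).trans ?_
      gcongr
      exact hle.trans (le_max_right _ _)
    · have hz : ∀ z ∈ Metric.closedBall s (δ / 2), z ≠ 1 ∧
          ‖riemannZeta z‖ ≤ C₁ * (2 * |s.im| ^ (2 * δ)) := by
        intro z hz
        rw [mem_closedBall_iff_norm] at hz
        have hre := (abs_re_le_norm (z - s)).trans hz
        have him := (abs_im_le_norm (z - s)).trans hz
        rw [sub_re] at hre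
        rw [sub_im] at him
        have hre' := abs_le.1 hre
        have hi1 : |s.im| ≤ |z.im| + |z.im - s.im| := by
          have := abs_sub_abs_le_abs_sub s.im z.im
          rw [abs_sub_comm] at this; linarith
        have hi2 := abs_sub_abs_le_abs_sub z.im s.im
        refine ⟨?_, ?_⟩
        · rintro rfl
          simp only [one_im, abs_zero] at hi1
          simp only [one_im] at him
          linarith
        · refine (norm_zeta_le hδ hδ' (by linarith) (by linarith) (by linarith)).trans ?_
          gcongr
          exact abs_rpow_le_two_mul hδ hδ' (by linarith)
      have hd : DiffContOnCl ℂ riemannZeta (Metric.ball s (δ / 2)) := by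
        refine DifferentiableOn.diffContOnCl_ball (U := Metric.closedBall s (δ / 2)) (fun z hzz => ?_) le_rfl
        exact (differentiableAt_riemannZeta (hz z hzz).1).differentiableWithinAt
      have := norm_deriv_le_of_forall_mem_sphere_norm_le (by positivity) hd
        (fun z hzz => (hz z (Metric.sphere_subset_closedBall hzz)).2)
      refine this.trans ?_
      calc C₁ * (2 * |s.im| ^ (2 * δ)) / (δ / 2) = C₁ * (4 / δ) * |s.im| ^ (2 * δ) := by
            field_simp; ring
        _ ≤ _ := by gcongr; exact le_max_right _ _

lemma zeta_three_four_one {x : ℝ} (hx : 0 < x) (y : ℝ) :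
    1 ≤ ‖riemannZeta (1 + x)‖ ^ 3 * ‖riemannZeta (1 + x + I * y)‖ ^ 4 *
      ‖riemannZeta (1 + x + 2 * I * y)‖ := by
  have := DirichletCharacter.norm_LFunction_product_ge_one (1 : DirichletCharacter ℂ 1) hx y
  simpa [DirichletCharacter.LFunctionTrivChar, DirichletCharacter.LFunction_modOne_eq] using this

/-- The lower bound for `ζ` to the right of the line `Re s = 1`. -/
lemma zeta_lower_bound {δ C : ℝ} (hδ : 0 < δ) (hδ' : δ ≤ 1 / 4) (hC : 1 ≤ C)
    (h1 : ∀ x : ℝ, 0 < x → x ≤ 1 → ‖riemannZeta (1 + x)‖ ≤ C / x)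
    (h2 : ∀ s : ℂ, 1 - δ / 2 ≤ s.re → s.re ≤ 5 / 2 → 2 ≤ |s.im| →
        ‖riemannZeta s‖ ≤ C * |s.im| ^ (2 * δ) ∧ ‖deriv riemannZeta s‖ ≤ C * |s.im| ^ (2 * δ))
    {s : ℂ} (hs1 : 1 < s.re) (hs2 : s.re ≤ 2) (hs3 : 2 ≤ |s.im|) :
    1 / (32 * C ^ 7 * (|s.im| ^ (2 * δ)) ^ 4) ≤ ‖riemannZeta s‖ := by
  set T := |s.im| ^ (2 * δ) with hT
  have hT1 : 1 ≤ T := Real.one_le_rpow (by linarith) (by linarith)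
  set t := s.im with ht
  set η := 1 / (32 * C ^ 8 * T ^ 5) with hη
  have hη0 : 0 < η := by positivity
  have hCT : 1 ≤ C ^ 8 * T ^ 5 := one_le_mul_of_one_le_of_one_le (one_le_pow₀ hC) (one_le_pow₀ hT1)
  have hη1 : η ≤ 1 := by
    rw [hη, div_le_one (by positivity)]
    linarith
  have hμ : 1 / (32 * C ^ 7 * T ^ 4) = η * (C * T) := by
    rw [hη]; field_simp
  have key : ∀ x : ℝ, η ≤ x → x ≤ 1 → 2 * (η * (C * T)) ≤ ‖riemannZeta (1 + x + I * t)‖ := by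
    intro x hx hx1
    have hx0 : 0 < x := by linarith
    have h341 := zeta_three_four_one hx0 t
    have e1 := h1 x hx0 hx1
    have e2 : ‖riemannZeta (1 + x + 2 * I * t)‖ ≤ C * (2 * T) := by
      have hre : (1 + x + 2 * I * t : ℂ).re = 1 + x := by simp
      have him : (1 + x + 2 * I * t : ℂ).im = 2 * t := by simp
      have habs : |2 * t| = 2 * |t| := by rw [abs_mul]; norm_num
      refine (h2 _ (by rw [hre]; linarith) (by rw [hre]; linarith)
        (by rw [him, habs]; linarith)).1.trans ?_
      rw [him]
      gcongr
      exact abs_rpow_le_two_mul hδ hδ' habs.le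
    set Z := ‖riemannZeta (1 + x + I * t)‖ with hZ
    have hZ0 : 0 ≤ Z := norm_nonneg _
    have h4 : 1 ≤ (C / x) ^ 3 * Z ^ 4 * (C * (2 * T)) := by
      refine h341.trans ?_
      gcongr
    have h5 : x ^ 3 ≤ 2 * C ^ 4 * T * Z ^ 4 := by
      have : (C / x) ^ 3 * Z ^ 4 * (C * (2 * T)) = (2 * C ^ 4 * T * Z ^ 4) / x ^ 3 := by
        field_simp
      rw [this, le_div_iff₀ (by positivity), one_mul] at h4
      exact h4
    have h6 : η ^ 3 ≤ 2 * C ^ 4 * T * Z ^ 4 := le_trans (by gcongr) h5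
    by_contra! hlt
    have h7 : Z ^ 4 < (2 * (η * (C * T))) ^ 4 := by gcongr
    have h8 : 2 * C ^ 4 * T * (2 * (η * (C * T))) ^ 4 = η ^ 3 := by
      have : η * (32 * C ^ 8 * T ^ 5) = 1 := by rw [hη]; field_simp
      calc 2 * C ^ 4 * T * (2 * (η * (C * T))) ^ 4 = η ^ 3 * (η * (32 * C ^ 8 * T ^ 5)) := by ring
        _ = η ^ 3 := by rw [this, mul_one]
    have h9 : 2 * C ^ 4 * T * Z ^ 4 < 2 * C ^ 4 * T * (2 * (η * (C * T))) ^ 4 := by gcongr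
    linarith
  rw [hμ]
  have hs_eq : ∀ x : ℝ, (1 + (x : ℂ) + I * t) = ⟨1 + x, t⟩ := by
    intro x; apply Complex.ext <;> simp
  have hpos : 0 < η * (C * T) := by positivity
  rcases le_total η (s.re - 1) with h | h
  · have := key (s.re - 1) h (by linarith)
    rw [hs_eq] at this
    have e : (⟨1 + (s.re - 1), t⟩ : ℂ) = s := by apply Complex.ext <;> simp [ht]
    rw [e] at this
    linarith
  · have hk := key η le_rfl hη1
    rw [hs_eq] at hk
    set w : ℂ := ⟨1 + η, t⟩ with hw
    have hseg : ∀ z ∈ segment ℝ s w, 1 < z.re ∧ z.re ≤ 2 ∧ z.im = t := by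
      rintro z ⟨a, b, ha, hb, hab, rfl⟩
      simp only [add_re, real_smul, mul_re, ofReal_re, ofReal_im, zero_mul, sub_zero, add_im, mul_im, hw, add_zero]
      refine ⟨?_, ?_, ?_⟩
      · nlinarith
      · nlinarith
      · rw [← ht, ← add_mul, hab, one_mul]
    have hmv := (convex_segment s w).norm_image_sub_le_of_norm_hasDerivWithin_le (𝕜 := ℂ)
      (f := riemannZeta) (f' := deriv riemannZeta) (C := C * T) (fun z hz => by
        have := hseg z hz
        refine (differentiableAt_riemannZeta ?_).hasDerivAt.hasDerivWithinAt
        rintro rfl; simpa using this.1) (fun z hz => by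
        have := hseg z hz
        have h' := (h2 z (by linarith) (by linarith) (by rw [this.2.2]; exact hs3)).2
        rwa [this.2.2] at h') (left_mem_segment ℝ s w) (right_mem_segment ℝ s w)
    have hws : ‖w - s‖ ≤ η := by
      have : w - s = ((1 + η - s.re : ℝ) : ℂ) := by
        apply Complex.ext <;> simp [hw, ht]
      rw [this, norm_real, Real.norm_eq_abs, abs_of_nonneg (by linarith)]
      linarith
    have h3 : ‖riemannZeta w - riemannZeta s‖ ≤ η * (C * T) := by
      refine hmv.trans ?_
      rw [mul_comm]; gcongr
    have := norm_sub_norm_le (riemannZeta w) (riemannZeta s)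
    linarith

end

section

open Complex Filter Topology Set

/-- The function `-ζ'/ζ - ζ`, whose Dirichlet coefficients are `Λ(n) - 1`. -/
noncomputable def zetaDiff (s : ℂ) : ℂ := -deriv riemannZeta s / riemannZeta s - riemannZeta s

lemma zetaDiff_deriv_bound_large (k : ℕ) : ∃ C : ℝ, ∀ s : ℂ, 1 < s.re → s.re ≤ 2 → 3 ≤ |s.im| →
    ‖iteratedDeriv k zetaDiff s‖ ≤ C * |s.im| ^ (1 / 2 : ℝ) := by
  set δ : ℝ := 1 / (20 * (k + 1)) with hδdef
  have hk1 : (0 : ℝ) < (k : ℝ) + 1 := by positivity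
  have hδ : 0 < δ := by positivity
  have hδ' : δ ≤ 1 / 4 := by
    rw [hδdef]
    apply one_div_le_one_div_of_le (by norm_num)
    have : (0 : ℝ) ≤ k := by positivity
    linarith
  obtain ⟨C, hC, hCδ, h1, h2⟩ := exists_zeta_upper_bound hδ hδ'
  refine ⟨k.factorial * 2 * (128 * C ^ 8) ^ (k + 1), fun s hs1 hs2 hs3 => ?_⟩
  set T := |s.im| ^ (2 * δ) with hT
  have hT1 : 1 ≤ T := Real.one_le_rpow (by linarith) (by linarith)
  set W := 128 * C ^ 8 * T ^ 5 with hW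
  have hC8 : C ≤ C ^ 8 := le_self_pow₀ hC (by norm_num)
  have hT5 : T ≤ T ^ 5 := le_self_pow₀ hT1 (by norm_num)
  have hCT5 : C * T ≤ C ^ 8 * T ^ 5 := by gcongr
  have hCC : C ≤ C ^ 8 * T ^ 5 := by
    calc C = C * 1 := by ring
      _ ≤ _ := by gcongr; linarith
  have hWC : C ≤ W := by rw [hW]; linarith
  have hWCT : 2 * (C * T) ≤ W := by
    have : 0 < C ^ 8 * T ^ 5 := by positivity
    rw [hW]; linarith
  have hW0 : 0 < W := by positivity
  have hr0 : 0 < 1 / W := by positivity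
  have hrδ : 1 / W ≤ δ / 2 := by
    rw [div_le_div_iff₀ hW0 (by norm_num)]
    rw [div_le_iff₀ hδ] at hCδ
    nlinarith
  set μ := 1 / (32 * C ^ 7 * T ^ 4) with hμ
  have hμ0 : 0 < μ := by positivity
  have hlow : μ ≤ ‖riemannZeta s‖ := zeta_lower_bound hδ hδ' hC h1 h2 hs1 hs2 (by linarith)
  have hμW : μ * W = 4 * (C * T) := by
    rw [hμ, hW]; field_simp; ring
  have hball : ∀ z ∈ Metric.closedBall s (1 / W), z ≠ 1 ∧
      ‖riemannZeta z‖ ≤ C * (2 * T) ∧ ‖deriv riemannZeta z‖ ≤ C * (2 * T) := by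
    intro z hz
    rw [mem_closedBall_iff_norm] at hz
    have hz' := hz.trans hrδ
    have hre := (abs_re_le_norm (z - s)).trans hz'
    have him := (abs_im_le_norm (z - s)).trans hz'
    rw [sub_re] at hre
    rw [sub_im] at him
    have hre' := abs_le.1 hre
    have hi1 : |s.im| ≤ |z.im| + |z.im - s.im| := by
      have := abs_sub_abs_le_abs_sub s.im z.im
      rw [abs_sub_comm] at this; linarith
    have hi2 := abs_sub_abs_le_abs_sub z.im s.im
    have hbd := h2 z (by linarith) (by linarith) (by linarith)
    have hTz : |z.im| ^ (2 * δ) ≤ 2 * T := abs_rpow_le_two_mul hδ hδ' (by linarith)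
    refine ⟨?_, hbd.1.trans (by gcongr), hbd.2.trans (by gcongr)⟩
    rintro rfl
    simp only [one_im, abs_zero] at hi1
    simp only [one_im] at him
    linarith
  have hlow2 : ∀ z ∈ Metric.closedBall s (1 / W), μ / 2 ≤ ‖riemannZeta z‖ := by
    intro z hz
    have hmv := (convex_closedBall s (1 / W)).norm_image_sub_le_of_norm_hasDerivWithin_le (𝕜 := ℂ)
      (f := riemannZeta) (f' := deriv riemannZeta) (C := C * (2 * T)) (fun z hz =>
        (differentiableAt_riemannZeta (hball z hz).1).hasDerivAt.hasDerivWithinAt)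
        (fun z hz => (hball z hz).2.2) (Metric.mem_closedBall_self hr0.le) hz
    have h3 : ‖riemannZeta z - riemannZeta s‖ ≤ μ / 2 := by
      refine hmv.trans ?_
      calc C * (2 * T) * ‖z - s‖ ≤ C * (2 * T) * (1 / W) := by
            gcongr; exact mem_closedBall_iff_norm.1 hz
        _ = μ / 2 := by
            have : C * T = μ * W / 4 := by rw [hμW]; ring
            rw [show C * (2 * T) * (1 / W) = 2 * (C * T) / W by ring, this]
            field_simp; ring
    have := norm_sub_norm_le (riemannZeta s) (riemannZeta z)
    rw [norm_sub_rev] at this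
    linarith
  have hne : ∀ z ∈ Metric.closedBall s (1 / W), riemannZeta z ≠ 0 := by
    intro z hz h0
    have := hlow2 z hz
    rw [h0, norm_zero] at this
    linarith
  have hd : DiffContOnCl ℂ zetaDiff (Metric.ball s (1 / W)) := by
    refine DifferentiableOn.diffContOnCl_ball (U := Metric.closedBall s (1 / W)) (fun z hzz => ?_) le_rfl
    have hd1 := differentiableAt_riemannZeta (hball z hzz).1
    have hd2 : DifferentiableAt ℂ (deriv riemannZeta) z := by
      have : AnalyticAt ℂ riemannZeta z := by
        refine DifferentiableOn.analyticAt (s := {1}ᶜ) (fun w hw =>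
          (differentiableAt_riemannZeta hw).differentiableWithinAt) ?_
        exact isOpen_compl_singleton.mem_nhds (hball z hzz).1
      exact this.deriv.differentiableAt
    exact ((hd2.neg.div hd1 (hne z hzz)).sub hd1).differentiableWithinAt
  have hbound : ∀ z ∈ Metric.sphere s (1 / W), ‖zetaDiff z‖ ≤ 2 * W := by
    intro z hz
    have hz := Metric.sphere_subset_closedBall hz
    have hb := hball z hz
    have hl := hlow2 z hz
    refine (norm_sub_le _ _).trans ?_
    rw [norm_div, norm_neg]
    have : ‖deriv riemannZeta z‖ / ‖riemannZeta z‖ ≤ W := by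
      rw [div_le_iff₀ (by linarith)]
      calc _ ≤ _ := hb.2.2
        _ = W * (μ / 2) := by linarith
        _ ≤ _ := by gcongr
    linarith [hb.2.1]
  refine (norm_iteratedDeriv_le_of_forall_mem_sphere_norm_le k hr0 hd hbound).trans (le_of_eq ?_)
  have hTk : (T ^ 5) ^ (k + 1) = |s.im| ^ (1 / 2 : ℝ) := by
    rw [← pow_mul, hT, ← Real.rpow_natCast, ← Real.rpow_mul (abs_nonneg _)]
    congr 1
    rw [hδdef]; push_cast; field_simp; ring
  rw [← hTk]
  calc (k.factorial : ℝ) * (2 * W) / (1 / W) ^ k = k.factorial * 2 * W ^ (k + 1) := by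
        rw [one_div, inv_pow, div_inv_eq_mul]; ring
    _ = _ := by rw [hW, mul_pow]; ring

lemma zetaDiff_deriv_bound_small (k : ℕ) : ∃ C : ℝ, ∀ s : ℂ, 1 < s.re → s.re ≤ 2 → |s.im| ≤ 3 →
    ‖iteratedDeriv k zetaDiff s‖ ≤ C := by
  set g : ℂ → ℂ := fun s => -deriv riemannZeta₁ s / riemannZeta₁ s - riemannZeta₀ s with hg
  have hz1 : ∀ s : ℂ, 1 ≤ s.re → riemannZeta₁ s ≠ 0 := by
    intro s hs h0
    rcases eq_or_ne s 1 with rfl | hs1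
    · simp at h0
    · refine riemannZeta_ne_zero_of_one_le_re hs ?_
      rw [riemannZeta_eq_inv_sub_mul hs1, h0, mul_zero]
  have hga : ∀ s : ℂ, 1 ≤ s.re → AnalyticAt ℂ g s := by
    intro s hs
    have a1 : AnalyticAt ℂ riemannZeta₁ s := differentiable_riemannZeta₁.analyticAt s
    exact (a1.deriv.neg.div a1 (hz1 s hs)).sub (differentiable_riemannZeta₀.analyticAt s)
  have hev : ∀ s : ℂ, 1 < s.re → zetaDiff =ᶠ[𝓝 s] g := by
    intro s hs
    filter_upwards [(isOpen_lt continuous_const continuous_re).mem_nhds hs] with w hw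
    have hw1 : w ≠ 1 := by rintro rfl; simp at hw
    have hw1' : w - 1 ≠ 0 := sub_ne_zero.2 hw1
    have hne := hz1 w (le_of_lt hw)
    have e0 : riemannZeta w = (w - 1)⁻¹ + riemannZeta₀ w := riemannZeta_eq_inv_sub_add hw1
    rw [hg, zetaDiff, deriv_riemannZeta_eq_neg_inv_sub_sq_mul_add hw1]
    have : -(-(w - 1)⁻¹ ^ 2 * riemannZeta₁ w + (w - 1)⁻¹ * deriv riemannZeta₁ w) / riemannZeta w
        = (w - 1)⁻¹ - deriv riemannZeta₁ w / riemannZeta₁ w := by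
      rw [riemannZeta_eq_inv_sub_mul hw1]
      field_simp
      ring
    rw [this, e0]
    ring
  have hK : IsCompact (Icc (1 : ℝ) 2 ×ℂ Icc (-3 : ℝ) 3) := isCompact_Icc.reProdIm isCompact_Icc
  have hcont : ContinuousOn (iteratedDeriv k g) (Icc (1 : ℝ) 2 ×ℂ Icc (-3 : ℝ) 3) := by
    intro s hs
    have : 1 ≤ s.re := hs.1.1
    exact ((hga s this).iterated_deriv k |>.continuousAt.continuousWithinAt).congr
      (fun y _ => by rw [iteratedDeriv_eq_iterate]) (by rw [iteratedDeriv_eq_iterate])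
  obtain ⟨C, hC⟩ := hK.exists_bound_of_continuousOn hcont
  refine ⟨C, fun s h1 h2 h3 => ?_⟩
  rw [(hev s h1).iteratedDeriv_eq k]
  exact hC s ⟨⟨h1.le, h2⟩, abs_le.1 h3⟩

lemma zetaDiff_deriv_bound (k : ℕ) : ∃ C : ℝ, 0 ≤ C ∧ ∀ s : ℂ, 1 < s.re → s.re ≤ 2 →
    ‖iteratedDeriv k zetaDiff s‖ ≤ C * (1 + |s.im|) ^ (1 / 2 : ℝ) := by
  obtain ⟨C₁, h₁⟩ := zetaDiff_deriv_bound_large k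
  obtain ⟨C₂, h₂⟩ := zetaDiff_deriv_bound_small k
  refine ⟨max 0 (max C₁ C₂), le_max_left _ _, fun s hs1 hs2 => ?_⟩
  have hm1 : C₁ ≤ max 0 (max C₁ C₂) := (le_max_left _ _).trans (le_max_right _ _)
  have hm2 : C₂ ≤ max 0 (max C₁ C₂) := (le_max_right _ _).trans (le_max_right _ _)
  have hm0 : 0 ≤ max 0 (max C₁ C₂) := le_max_left _ _
  rcases le_total 3 |s.im| with h | h
  · refine (h₁ s hs1 hs2 h).trans ?_
    gcongr
    linarith
  · refine (h₂ s hs1 hs2 h).trans (hm2.trans ?_)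
    refine le_mul_of_one_le_right hm0 (Real.one_le_rpow ?_ (by norm_num))
    linarith [abs_nonneg s.im]

end

section

open Complex Filter Topology Set

/-- The coefficients `Λ(n) - 1`. -/
noncomputable def lambdaSubOne (n : ℕ) : ℂ := (ArithmeticFunction.vonMangoldt n : ℂ) - 1

lemma lseriesSummable_lambdaSubOne {s : ℂ} (hs : 1 < s.re) : LSeriesSummable lambdaSubOne s :=
  (ArithmeticFunction.LSeriesSummable_vonMangoldt hs).sub (LSeriesSummable_one_iff.2 hs)

lemma lseries_lambdaSubOne {s : ℂ} (hs : 1 < s.re) : LSeries lambdaSubOne s = zetaDiff s := by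
  have := LSeries_sub (ArithmeticFunction.LSeriesSummable_vonMangoldt hs) (LSeriesSummable_one_iff.2 hs)
  rw [ArithmeticFunction.LSeries_vonMangoldt_eq_deriv_riemannZeta_div hs,
    LSeries_one_eq_riemannZeta hs] at this
  exact this

lemma abscissa_lambdaSubOne {s : ℂ} (hs : 1 < s.re) :
    LSeries.abscissaOfAbsConv lambdaSubOne < s.re := by
  refine lt_of_le_of_lt (LSeries.abscissaOfAbsConv_le_of_forall_lt_LSeriesSummable (x := 1)
    fun y hy => lseriesSummable_lambdaSubOne (by simpa using hy)) ?_
  exact_mod_cast hs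

/-- The coefficients `(Λ(n) - 1) (log n)^k`. -/
noncomputable def lambdaLog (k n : ℕ) : ℝ := (ArithmeticFunction.vonMangoldt n - 1) * Real.log n ^ k

lemma logMul_iterate_lambdaSubOne (k n : ℕ) :
    (LSeries.logMul^[k] lambdaSubOne) n = (lambdaLog k n : ℂ) := by
  induction k with
  | zero => simp [lambdaSubOne, lambdaLog]
  | succ k ih =>
    rw [Function.iterate_succ_apply', LSeries.logMul, ih]
    simp only [lambdaLog]
    push_cast [Complex.natCast_log]
    ring

lemma lseriesSummable_lambdaLog (k : ℕ) {s : ℂ} (hs : 1 < s.re) :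
    LSeriesSummable (fun n => (lambdaLog k n : ℂ)) s := by
  have h : LSeriesSummable (LSeries.logMul^[k] lambdaSubOne) s := by
    apply LSeriesSummable_of_abscissaOfAbsConv_lt_re
    rw [LSeries.absicssaOfAbsConv_logPowMul]
    exact abscissa_lambdaSubOne hs
  have e : LSeries.logMul^[k] lambdaSubOne = fun n => (lambdaLog k n : ℂ) :=
    funext (logMul_iterate_lambdaSubOne k)
  rwa [e] at h

lemma norm_lseries_lambdaLog (k : ℕ) {s : ℂ} (hs : 1 < s.re) :
    ‖LSeries (fun n => (lambdaLog k n : ℂ)) s‖ = ‖iteratedDeriv k zetaDiff s‖ := by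
  have hev : LSeries lambdaSubOne =ᶠ[𝓝 s] zetaDiff := by
    filter_upwards [(isOpen_lt continuous_const continuous_re).mem_nhds hs] with w hw
    exact lseries_lambdaSubOne hw
  have := LSeries_iteratedDeriv k (abscissa_lambdaSubOne hs)
  rw [hev.iteratedDeriv_eq k] at this
  have e : LSeries.logMul^[k] lambdaSubOne = fun n => (lambdaLog k n : ℂ) :=
    funext (logMul_iterate_lambdaSubOne k)
  rw [this, norm_mul, e]
  simp

/-- The kernel `max (1 - u) 0`, presented as a difference of indicator functions. -/
noncomputable def tentKernel (u : ℝ) : ℂ :=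
  (Ioc (0 : ℝ) 1).indicator (fun _ => (1 : ℂ)) u - (Ioc (0 : ℝ) 1).indicator (fun t : ℝ => (t : ℂ) ^ (1 : ℂ)) u

lemma tentKernel_eq {u : ℝ} (hu : 0 < u) : tentKernel u = ((max (1 - u) 0 : ℝ) : ℂ) := by
  rw [tentKernel]
  rcases le_or_gt u 1 with h | h
  · rw [indicator_of_mem (show u ∈ Ioc (0 : ℝ) 1 from ⟨hu, h⟩),
      indicator_of_mem (show u ∈ Ioc (0 : ℝ) 1 from ⟨hu, h⟩), max_eq_left (by linarith)]
    simp
  · rw [indicator_of_notMem (fun h' => absurd h'.2 (not_le.2 h)),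
      indicator_of_notMem (fun h' => absurd h'.2 (not_le.2 h)), max_eq_right (by linarith)]
    simp

lemma continuousAt_tentKernel {u : ℝ} (hu : 0 < u) : ContinuousAt tentKernel u := by
  have h : tentKernel =ᶠ[𝓝 u] fun u => ((max (1 - u) 0 : ℝ) : ℂ) := by
    filter_upwards [lt_mem_nhds hu] with w hw using tentKernel_eq hw
  refine ContinuousAt.congr ?_ h.symm
  exact Continuous.continuousAt (by fun_prop)

lemma hasMellin_tentKernel {s : ℂ} (hs : 0 < s.re) :
    HasMellin tentKernel s (1 / s - 1 / (s + 1)) := by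
  have h1 := hasMellin_one_Ioc hs
  have h2 := hasMellin_cpow_Ioc 1 (s := s) (by simp; linarith)
  have := hasMellin_sub h1.1 h2.1
  rwa [h1.2, h2.2] at this

lemma norm_tentMellin_le {s : ℂ} (hs : 1 < s.re) :
    ‖1 / s - 1 / (s + 1)‖ ≤ (1 + ‖s.im‖ ^ 2) ^ (-1 : ℝ) := by
  have hs0 : s ≠ 0 := by rintro rfl; simp at hs; linarith
  have hs1 : s + 1 ≠ 0 := by
    intro h
    have := congrArg Complex.re h
    simp at this; linarith
  have e : 1 / s - 1 / (s + 1) = 1 / (s * (s + 1)) := by field_simp; ring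
  rw [e, norm_div, norm_one, norm_mul, Real.rpow_neg_one, one_div]
  apply inv_anti₀ (by positivity)
  have h1 : 1 + ‖s.im‖ ^ 2 ≤ ‖s‖ ^ 2 := by
    rw [← Complex.normSq_eq_norm_sq, Complex.normSq_apply, Real.norm_eq_abs, sq_abs]
    nlinarith
  have h2 : ‖s‖ ≤ ‖s + 1‖ := by
    rw [← sq_le_sq₀ (norm_nonneg _) (norm_nonneg _), ← Complex.normSq_eq_norm_sq,
      ← Complex.normSq_eq_norm_sq, Complex.normSq_apply, Complex.normSq_apply]
    simp only [add_re, one_re, add_im, one_im]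
    nlinarith
  calc 1 + ‖s.im‖ ^ 2 ≤ ‖s‖ * ‖s‖ := by rw [← sq]; exact h1
    _ ≤ _ := by gcongr

lemma integrable_tentMellin {σ : ℝ} (hσ : 1 < σ) :
    MeasureTheory.Integrable (fun t : ℝ => 1 / ((σ : ℂ) + t * I) - 1 / ((σ : ℂ) + t * I + 1)) := by
  have h_int := integrable_rpow_neg_one_add_norm_sq (E := ℝ) (μ := MeasureTheory.volume) (r := 2) (by simp)
  refine h_int.mono' ?_ (Eventually.of_forall fun t => ?_)
  · refine Continuous.aestronglyMeasurable ?_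
    have h1 : ∀ t : ℝ, (σ : ℂ) + t * I ≠ 0 := fun t h => by
      have := congrArg Complex.re h; simp at this; linarith
    have h2 : ∀ t : ℝ, (σ : ℂ) + t * I + 1 ≠ 0 := fun t h => by
      have := congrArg Complex.re h; simp at this; linarith
    refine Continuous.sub ?_ ?_
    · exact continuous_const.div (by fun_prop) h1
    · exact continuous_const.div (by fun_prop) h2
  · have := norm_tentMellin_le (s := (σ : ℂ) + t * I) (by simpa using hσ)
    simpa using this

lemma tentKernel_inversion {σ u : ℝ} (hσ : 1 < σ) (hu : 0 < u) :
    ∫ t : ℝ, (u : ℂ) ^ (-((σ : ℂ) + t * I)) * (1 / ((σ : ℂ) + t * I) - 1 / ((σ : ℂ) + t * I + 1)) =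
      2 * Real.pi * ((max (1 - u) 0 : ℝ) : ℂ) := by
  have hm : ∀ t : ℝ, mellin tentKernel ((σ : ℂ) + t * I) =
      1 / ((σ : ℂ) + t * I) - 1 / ((σ : ℂ) + t * I + 1) := fun t =>
    (hasMellin_tentKernel (s := (σ : ℂ) + t * I) (by simp; linarith)).2
  have hv : VerticalIntegrable (mellin tentKernel) σ := by
    unfold VerticalIntegrable
    simp_rw [hm]
    exact integrable_tentMellin hσ
  have := mellinInv_mellin_eq σ tentKernel hu
    (hasMellin_tentKernel (s := (σ : ℂ)) (by simp; linarith)).1 hv (continuousAt_tentKernel hu)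
  rw [mellinInv, tentKernel_eq hu] at this
  simp_rw [hm, smul_eq_mul] at this
  rw [← this]
  have hpi : (Real.pi : ℂ) ≠ 0 := by exact_mod_cast Real.pi_ne_zero
  rw [Complex.real_smul, ← mul_assoc]
  have h1 : 2 * (Real.pi : ℂ) * ((1 / (2 * Real.pi) : ℝ) : ℂ) = 1 := by
    push_cast
    field_simp
  rw [h1, one_mul]

lemma smoothed_lambdaLog_bound (k : ℕ) : ∃ C : ℝ, 0 ≤ C ∧ ∀ x : ℝ, 1 ≤ x →
    |∑ n ∈ Finset.Ioc 0 ⌊x⌋₊, lambdaLog k n * (1 - n / x)| ≤ C * x := by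
  obtain ⟨C, hC0, hC⟩ := zetaDiff_deriv_bound k
  have hintJ := integrable_rpow_neg_one_add_norm_sq (E := ℝ) (μ := MeasureTheory.volume) (r := 3 / 2)
    (by simp; norm_num)
  set J := ∫ t : ℝ, (1 + ‖t‖ ^ 2) ^ (-(3 / 2) / 2 : ℝ) with hJ
  have hJ0 : 0 ≤ J := MeasureTheory.integral_nonneg fun t => by positivity
  refine ⟨2 * C * J, by positivity, fun x hx => ?_⟩
  have hx0 : 0 < x := by linarith
  have main : ∀ σ : ℝ, 1 < σ → σ ≤ 2 →
      |∑ n ∈ Finset.Ioc 0 ⌊x⌋₊, lambdaLog k n * (1 - n / x)| ≤ 2 * C * J * x ^ σ := by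
    intro σ hσ hσ2
    set w : ℝ → ℂ := fun t => 1 / ((σ : ℂ) + t * I) - 1 / ((σ : ℂ) + t * I + 1) with hw
    have hwint : MeasureTheory.Integrable w := integrable_tentMellin hσ
    set F : ℕ → ℝ → ℂ := fun n t => LSeries.term (fun n => (lambdaLog k n : ℂ)) ((σ : ℂ) + t * I) n *
      ((x : ℂ) ^ ((σ : ℂ) + t * I) * w t) with hF
    have hre : ∀ t : ℝ, ((σ : ℂ) + t * I).re = σ := by intro t; simp
    have hFeq : ∀ n : ℕ, n ≠ 0 → ∀ t : ℝ, F n t = (lambdaLog k n : ℂ) *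
        ((((n : ℝ) / x : ℝ) : ℂ) ^ (-((σ : ℂ) + t * I)) * w t) := by
      intro n hn t
      have hn0 : (0 : ℝ) < n := by positivity
      rw [hF]
      simp only [LSeries.term, if_neg hn]
      rw [div_eq_mul_inv (n : ℝ) x, ofReal_mul, mul_cpow_ofReal_nonneg hn0.le (by positivity),
        ofReal_inv, inv_cpow _ _ (by rw [arg_ofReal_of_nonneg hx0.le]; exact Real.pi_pos.ne),
        cpow_neg, cpow_neg, inv_inv]
      push_cast
      ring
    have hnormF : ∀ n : ℕ, ∀ t : ℝ, ‖F n t‖ =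
        ‖LSeries.term (fun n => (lambdaLog k n : ℂ)) (σ : ℂ) n‖ * x ^ σ * ‖w t‖ := by
      intro n t
      rw [hF]
      simp only [norm_mul]
      rw [LSeries.norm_term_eq, LSeries.norm_term_eq, norm_cpow_eq_rpow_re_of_pos hx0, hre, ofReal_re]
      ring
    have hmeas : ∀ n, MeasureTheory.Integrable (F n) := by
      intro n
      refine (hwint.norm.const_mul (‖LSeries.term (fun n => (lambdaLog k n : ℂ)) (σ : ℂ) n‖ * x ^ σ)).mono' ?_
        (Eventually.of_forall fun t => (hnormF n t).le)
      refine MeasureTheory.AEStronglyMeasurable.mul ?_ (MeasureTheory.AEStronglyMeasurable.mul ?_ hwint.1)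
      · refine Continuous.aestronglyMeasurable ?_
        by_cases hn : n = 0
        · simp [LSeries.term, hn, continuous_const]
        · simp only [LSeries.term, if_neg hn]
          have hn' : (n : ℂ) ≠ 0 := by exact_mod_cast hn
          refine continuous_const.div ?_ (fun t => ?_)
          · exact Continuous.const_cpow (by fun_prop) (Or.inl hn')
          · rw [Ne, cpow_eq_zero_iff]; tauto
      · refine Continuous.aestronglyMeasurable ?_
        exact Continuous.const_cpow (by fun_prop) (Or.inl (by exact_mod_cast hx0.ne'))
    have hsumm : Summable fun n => ∫ t : ℝ, ‖F n t‖ := by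
      simp_rw [hnormF, MeasureTheory.integral_const_mul]
      exact ((lseriesSummable_lambdaLog k (s := (σ : ℂ)) (by simpa using hσ)).norm.mul_right _).mul_right _
    have hs := MeasureTheory.hasSum_integral_of_summable_integral_norm hmeas hsumm
    have hts : ∀ t : ℝ, ∑' n, F n t = LSeries (fun n => (lambdaLog k n : ℂ)) ((σ : ℂ) + t * I) *
        ((x : ℂ) ^ ((σ : ℂ) + t * I) * w t) := by
      intro t
      rw [hF, LSeries]
      exact tsum_mul_right
    have hI : ∀ n : ℕ, ∫ t : ℝ, F n t = if n ∈ Finset.Ioc 0 ⌊x⌋₊ then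
        2 * Real.pi * ((lambdaLog k n * (1 - n / x) : ℝ) : ℂ) else 0 := by
      intro n
      by_cases hn : n = 0
      · subst hn
        simp [hF, LSeries.term]
      · have hn0 : (0 : ℝ) < n := by positivity
        simp_rw [hFeq n hn, MeasureTheory.integral_const_mul]
        rw [tentKernel_inversion hσ (by positivity)]
        by_cases hnx : n ≤ ⌊x⌋₊
        · rw [if_pos (Finset.mem_Ioc.2 ⟨by omega, hnx⟩)]
          have : (n : ℝ) / x ≤ 1 := by
            rw [div_le_one hx0]; exact (Nat.le_floor_iff hx0.le).1 hnx
          rw [max_eq_left (by linarith)]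
          push_cast; ring
        · rw [if_neg (fun h => hnx (Finset.mem_Ioc.1 h).2)]
          have : 1 < (n : ℝ) / x := by
            rw [one_lt_div hx0]; exact (Nat.floor_lt hx0.le).1 (by omega)
          rw [max_eq_right (by linarith)]
          simp
    have htot := hs.tsum_eq
    simp_rw [hI, hts] at htot
    rw [tsum_eq_sum (s := Finset.Ioc 0 ⌊x⌋₊) (fun n hn => if_neg hn),
      Finset.sum_congr rfl (fun n hn => if_pos hn), ← Finset.mul_sum] at htot
    have hbound : ‖∫ t : ℝ, LSeries (fun n => (lambdaLog k n : ℂ)) ((σ : ℂ) + t * I) *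
        ((x : ℂ) ^ ((σ : ℂ) + t * I) * w t)‖ ≤ 2 * C * x ^ σ * J := by
      rw [hJ, ← MeasureTheory.integral_const_mul]
      refine MeasureTheory.norm_integral_le_of_norm_le (hintJ.const_mul _) (Eventually.of_forall fun t => ?_)
      rw [norm_mul, norm_mul, norm_lseries_lambdaLog k (by rw [hre]; exact hσ),
        norm_cpow_eq_rpow_re_of_pos hx0, hre]
      have h1 := hC ((σ : ℂ) + t * I) (by rw [hre]; exact hσ) (by rw [hre]; exact hσ2)
      have h2 := norm_tentMellin_le (s := (σ : ℂ) + t * I) (by rw [hre]; exact hσ)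
      have him : ((σ : ℂ) + t * I).im = t := by simp
      rw [him] at h1 h2
      have h3 : (1 + |t|) ^ (1 / 2 : ℝ) ≤ 2 * (1 + ‖t‖ ^ 2) ^ (1 / 4 : ℝ) := by
        rw [Real.norm_eq_abs]
        calc (1 + |t|) ^ (1 / 2 : ℝ) = ((1 + |t|) ^ (2 : ℝ)) ^ (1 / 4 : ℝ) := by
              rw [← Real.rpow_mul (by positivity)]; norm_num
          _ ≤ (2 * (1 + |t| ^ 2)) ^ (1 / 4 : ℝ) := by
              gcongr
              rw [Real.rpow_two]
              nlinarith [sq_nonneg (|t| - 1)]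
          _ = 2 ^ (1 / 4 : ℝ) * (1 + |t| ^ 2) ^ (1 / 4 : ℝ) := Real.mul_rpow (by norm_num) (by positivity)
          _ ≤ 2 ^ (1 : ℝ) * (1 + |t| ^ 2) ^ (1 / 4 : ℝ) := by
              gcongr
              · norm_num
              · norm_num
          _ = _ := by norm_num
      have h4 : (1 + ‖t‖ ^ 2) ^ (-(3 / 2) / 2 : ℝ) =
          (1 + ‖t‖ ^ 2) ^ (1 / 4 : ℝ) * (1 + ‖t‖ ^ 2) ^ (-1 : ℝ) := by
        rw [← Real.rpow_add (by positivity)]; norm_num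
      rw [h4]
      calc _ ≤ (C * (1 + |t|) ^ (1 / 2 : ℝ)) * (x ^ σ * (1 + ‖t‖ ^ 2) ^ (-1 : ℝ)) := by gcongr
        _ ≤ (C * (2 * (1 + ‖t‖ ^ 2) ^ (1 / 4 : ℝ))) * (x ^ σ * (1 + ‖t‖ ^ 2) ^ (-1 : ℝ)) := by gcongr
        _ = _ := by ring
    rw [← htot, ← ofReal_sum, norm_mul, norm_real, norm_mul, norm_real, Real.norm_eq_abs,
      Real.norm_eq_abs, abs_of_pos Real.pi_pos] at hbound
    have h2pi : 1 ≤ ‖(2 : ℂ)‖ * Real.pi := by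
      rw [Complex.norm_two]; linarith [Real.pi_gt_three]
    calc _ ≤ ‖(2 : ℂ)‖ * Real.pi * |∑ n ∈ Finset.Ioc 0 ⌊x⌋₊, lambdaLog k n * (1 - n / x)| :=
          le_mul_of_one_le_left (abs_nonneg _) h2pi
      _ ≤ _ := hbound
      _ = _ := by ring
  have hlim : Tendsto (fun σ : ℝ => 2 * C * J * x ^ σ) (𝓝[>] 1) (𝓝 (2 * C * J * x ^ (1 : ℝ))) := by
    refine Tendsto.const_mul _ ?_
    exact ((Real.continuous_const_rpow hx0.ne').tendsto 1).mono_left nhdsWithin_le_nhds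
  rw [Real.rpow_one] at hlim
  refine ge_of_tendsto hlim ?_
  filter_upwards [Ioc_mem_nhdsGT (show (1 : ℝ) < 2 by norm_num)] with σ hσ using main σ hσ.1 hσ.2

end

section

lemma lambdaLog_ge (k n : ℕ) : -Real.log n ^ k ≤ lambdaLog k n := by
  have h1 : 0 ≤ ArithmeticFunction.vonMangoldt n := ArithmeticFunction.vonMangoldt_nonneg
  have h2 : 0 ≤ Real.log n ^ k := pow_nonneg (Real.log_natCast_nonneg n) k
  rw [lambdaLog]
  nlinarith

/-- The summatory function of `(Λ(n) - 1) (log n)^k`. -/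
noncomputable def lambdaLogSum (k : ℕ) (x : ℝ) : ℝ := ∑ n ∈ Finset.Ioc 0 ⌊x⌋₊, lambdaLog k n

lemma sum_short_interval_ge (k : ℕ) {x y h : ℝ} (hx : 0 ≤ x) (hxy : x ≤ y) (hh : 0 ≤ h)
    (hy : 1 ≤ y) (hyx : y - x ≤ h) (c : ℕ → ℝ)
    (hc : ∀ n ∈ Finset.Ioc ⌊x⌋₊ ⌊y⌋₊, 0 ≤ c n ∧ c n ≤ h) :
    -(h * ((h + 1) * Real.log y ^ k)) ≤ ∑ n ∈ Finset.Ioc ⌊x⌋₊ ⌊y⌋₊, lambdaLog k n * c n := by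
  have hlogy : 0 ≤ Real.log y := Real.log_nonneg hy
  have hterm : ∀ n ∈ Finset.Ioc ⌊x⌋₊ ⌊y⌋₊, -(h * Real.log y ^ k) ≤ lambdaLog k n * c n := by
    intro n hn
    obtain ⟨h0, h1⟩ := hc n hn
    rw [Finset.mem_Ioc] at hn
    have hn1 : 1 ≤ n := by omega
    have hny : (n : ℝ) ≤ y := (Nat.le_floor_iff (by linarith)).1 hn.2
    have hlog : Real.log n ^ k ≤ Real.log y ^ k := by
      gcongr
    have := lambdaLog_ge k n
    have hp : 0 ≤ Real.log y ^ k := by positivity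
    nlinarith
  have hcard : ((Finset.Ioc ⌊x⌋₊ ⌊y⌋₊).card : ℝ) ≤ h + 1 := by
    rw [Nat.card_Ioc, Nat.cast_sub (Nat.floor_mono hxy)]
    have := Nat.floor_le (hx.trans hxy)
    have := Nat.lt_floor_add_one x
    linarith
  calc -(h * ((h + 1) * Real.log y ^ k)) ≤ -((Finset.Ioc ⌊x⌋₊ ⌊y⌋₊).card * (h * Real.log y ^ k)) := by
        rw [neg_le_neg_iff]
        calc _ ≤ (h + 1) * (h * Real.log y ^ k) := by gcongr
          _ = _ := by ring
    _ = ∑ n ∈ Finset.Ioc ⌊x⌋₊ ⌊y⌋₊, -(h * Real.log y ^ k) := by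
        rw [Finset.sum_const, nsmul_eq_mul]; ring
    _ ≤ _ := Finset.sum_le_sum hterm

/-- Unsmoothing: a bound for the smoothed sums yields a bound for the plain sums. -/
lemma abs_lambdaLogSum_le_of_smoothed {k : ℕ} {C : ℝ} (hC0 : 0 ≤ C)
    (hC : ∀ x : ℝ, 1 ≤ x → |∑ n ∈ Finset.Ioc 0 ⌊x⌋₊, lambdaLog k n * (1 - n / x)| ≤ C * x)
    {x h : ℝ} (hh : 0 < h) (hxh : 1 ≤ x - h) :
    |lambdaLogSum k x| ≤ 2 * C * (x + h) ^ 2 / h + (h + 1) * Real.log (x + h) ^ k := by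
  set U : ℝ → ℝ := fun y => ∑ n ∈ Finset.Ioc 0 ⌊y⌋₊, lambdaLog k n * (y - n) with hU
  have hUb : ∀ y, 1 ≤ y → |U y| ≤ C * y ^ 2 := by
    intro y hy
    have hy0 : 0 < y := by linarith
    have : U y = y * ∑ n ∈ Finset.Ioc 0 ⌊y⌋₊, lambdaLog k n * (1 - n / y) := by
      rw [hU, Finset.mul_sum]
      refine Finset.sum_congr rfl fun n _ => ?_
      field_simp
    rw [this, abs_mul, abs_of_pos hy0]
    calc _ ≤ y * (C * y) := by gcongr; exact hC y hy
      _ = _ := by ring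
  have hsplit : ∀ y z : ℝ, y ≤ z → ∀ f : ℕ → ℝ, ∑ n ∈ Finset.Ioc 0 ⌊z⌋₊, f n =
      ∑ n ∈ Finset.Ioc 0 ⌊y⌋₊, f n + ∑ n ∈ Finset.Ioc ⌊y⌋₊ ⌊z⌋₊, f n := by
    intro y z hyz f
    exact (Finset.sum_Ioc_consecutive f (Nat.zero_le _) (Nat.floor_mono hyz)).symm
  have hlogm : Real.log x ^ k ≤ Real.log (x + h) ^ k := by
    have : 0 ≤ Real.log x := Real.log_nonneg (by linarith)
    gcongr <;> linarith
  have hsq : C * x ^ 2 ≤ C * (x + h) ^ 2 := by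
    gcongr <;> linarith
  have hsq' : C * (x - h) ^ 2 ≤ C * (x + h) ^ 2 := by
    gcongr <;> linarith
  have hb1 := abs_le.1 (hUb x (by linarith))
  have hb2 := abs_le.1 (hUb (x + h) (by linarith))
  have hb3 := abs_le.1 (hUb (x - h) hxh)
  have e1 : h * lambdaLogSum k x = U (x + h) - U x -
      ∑ n ∈ Finset.Ioc ⌊x⌋₊ ⌊x + h⌋₊, lambdaLog k n * (x + h - n) := by
    have := hsplit x (x + h) (by linarith) (fun n => lambdaLog k n * (x + h - n))
    rw [hU]
    simp only [this, lambdaLogSum, Finset.mul_sum]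
    rw [add_sub_right_comm, add_sub_cancel_right, ← Finset.sum_sub_distrib]
    refine Finset.sum_congr rfl fun n _ => ?_
    ring
  have e2 : h * lambdaLogSum k x = U x - U (x - h) +
      ∑ n ∈ Finset.Ioc ⌊x - h⌋₊ ⌊x⌋₊, lambdaLog k n * (h - (x - n)) := by
    have e3 := hsplit (x - h) x (by linarith) (fun n => lambdaLog k n * (x - n))
    have e4 := hsplit (x - h) x (by linarith) (fun n => lambdaLog k n)
    rw [hU]
    simp only [e3, lambdaLogSum, e4]
    simp only [mul_add, Finset.mul_sum]
    have a1 : ∀ a b c d e : ℝ, a = b - c → d + e = 0 + d + e → a + (d + e) = (b + d) - c + e := by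
      intros; linarith
    have e5 : ∑ n ∈ Finset.Ioc ⌊x - h⌋₊ ⌊x⌋₊, h * lambdaLog k n =
        ∑ n ∈ Finset.Ioc ⌊x - h⌋₊ ⌊x⌋₊, lambdaLog k n * (x - n) +
        ∑ n ∈ Finset.Ioc ⌊x - h⌋₊ ⌊x⌋₊, lambdaLog k n * (h - (x - n)) := by
      rw [← Finset.sum_add_distrib]
      exact Finset.sum_congr rfl fun n _ => by ring
    rw [e5]
    refine a1 _ _ _ _ _ ?_ (by ring)
    rw [← Finset.sum_sub_distrib]
    exact Finset.sum_congr rfl fun n _ => by ring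
  have g1 := sum_short_interval_ge k (x := x) (y := x + h) (h := h) (by linarith) (by linarith) hh.le
    (by linarith) (by linarith) (fun n => x + h - n) (by
      intro n hn
      rw [Finset.mem_Ioc] at hn
      have a1 : (n : ℝ) ≤ x + h := (Nat.le_floor_iff (by linarith)).1 hn.2
      have a2 : x < n := (Nat.floor_lt (by linarith)).1 hn.1
      constructor <;> linarith)
  have g2 := sum_short_interval_ge k (x := x - h) (y := x) (h := h) (by linarith) (by linarith) hh.le
    (by linarith) (by linarith) (fun n => h - (x - n)) (by
      intro n hn
      rw [Finset.mem_Ioc] at hn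
      have a1 : (n : ℝ) ≤ x := (Nat.le_floor_iff (by linarith)).1 hn.2
      have a2 : x - h < n := (Nat.floor_lt (by linarith)).1 hn.1
      constructor <;> linarith)
  have g3 : h * ((h + 1) * Real.log x ^ k) ≤ h * ((h + 1) * Real.log (x + h) ^ k) := by
    gcongr
  have hfin : h * |lambdaLogSum k x| ≤ 2 * C * (x + h) ^ 2 + h * ((h + 1) * Real.log (x + h) ^ k) := by
    rw [← abs_of_pos hh, ← abs_mul, abs_of_pos hh, abs_le]
    constructor
    · rw [e2]; linarith
    · rw [e1]; linarith
  have : |lambdaLogSum k x| ≤ (2 * C * (x + h) ^ 2 + h * ((h + 1) * Real.log (x + h) ^ k)) / h := by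
    rw [le_div_iff₀ hh]; linarith
  refine this.trans (le_of_eq ?_)
  field_simp

lemma log_pow_le_factorial_mul {x : ℝ} (hx : 1 ≤ x) (A : ℕ) : Real.log x ^ A ≤ A.factorial * x := by
  have := Real.pow_div_factorial_le_exp (Real.log x) (Real.log_nonneg hx) A
  rw [Real.exp_log (by linarith), div_le_iff₀ (by positivity)] at this
  linarith

lemma one_le_log_of_three_le {x : ℝ} (hx : 3 ≤ x) : 1 ≤ Real.log x := by
  rw [Real.le_log_iff_exp_le (by linarith)]
  linarith [Real.exp_one_lt_d9]

/-- The prime number theorem with an arbitrary logarithmic saving. -/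
lemma abs_lambdaLogSum_le (A : ℕ) : ∃ C : ℝ, 0 ≤ C ∧ ∀ x : ℝ, 3 ≤ x →
    |lambdaLogSum (2 * A) x| ≤ C * (x * Real.log x ^ A) := by
  obtain ⟨C, hC0, hC⟩ := smoothed_lambdaLog_bound (2 * A)
  refine ⟨16 * C + (1 + A.factorial) * 2 ^ (2 * A), by positivity, fun x hx => ?_⟩
  have hlog : 1 ≤ Real.log x := one_le_log_of_three_le hx
  set ℓ := Real.log x with hℓ
  have hpow : 1 ≤ ℓ ^ A := one_le_pow₀ hlog
  set h := x / (2 * ℓ ^ A) with hh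
  have hh0 : 0 < h := by positivity
  have hhx : h ≤ x / 2 := by
    rw [hh]
    gcongr
    linarith
  refine (abs_lambdaLogSum_le_of_smoothed hC0 hC hh0 (by linarith)).trans ?_
  have p1 : 2 * C * (x + h) ^ 2 / h ≤ 16 * C * (x * ℓ ^ A) := by
    calc 2 * C * (x + h) ^ 2 / h ≤ 2 * C * (2 * x) ^ 2 / h := by gcongr; linarith
      _ = 16 * C * (x * ℓ ^ A) := by rw [hh]; field_simp; ring
  have p2 : (h + 1) * Real.log (x + h) ^ (2 * A) ≤ (1 + A.factorial) * 2 ^ (2 * A) * (x * ℓ ^ A) := by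
    have q1 : Real.log (x + h) ≤ 2 * ℓ := by
      rw [hℓ, two_mul, ← Real.log_mul (by linarith) (by linarith)]
      apply Real.log_le_log (by linarith)
      nlinarith
    have q0 : 0 ≤ Real.log (x + h) := Real.log_nonneg (by linarith)
    have q2 : h + 1 ≤ (1 + A.factorial) * (x / ℓ ^ A) := by
      have := log_pow_le_factorial_mul (by linarith : 1 ≤ x) A
      have q3 : 1 ≤ A.factorial * (x / ℓ ^ A) := by
        rw [← mul_div_assoc, le_div_iff₀ (by positivity)]; linarith
      have q4 : h ≤ x / ℓ ^ A := by
        rw [hh]; gcongr; linarith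
      linarith
    calc (h + 1) * Real.log (x + h) ^ (2 * A) ≤ ((1 + A.factorial) * (x / ℓ ^ A)) * (2 * ℓ) ^ (2 * A) := by
          gcongr
      _ = _ := by
          have : ℓ ^ A ≠ 0 := by positivity
          rw [mul_pow, two_mul A, pow_add ℓ]
          field_simp
  linarith

end

section

open Filter Topology

lemma eventually_log_pow_le (a : ℕ) {ε : ℝ} (hε : 0 < ε) :
    ∀ᶠ y : ℝ in atTop, Real.log y ^ a ≤ ε * y := by
  have := (Real.isLittleO_pow_log_id_atTop (n := a)).def hε
  filter_upwards [this, eventually_ge_atTop 1] with y hy hy1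
  rw [id, Real.norm_eq_abs, Real.norm_eq_abs, abs_of_nonneg (by linarith : 0 ≤ y)] at hy
  exact (le_abs_self _).trans hy

lemma eventually_loglog_pow_le (a : ℕ) {ε : ℝ} (hε : 0 < ε) :
    ∀ᶠ x : ℝ in atTop, Real.log (Real.log x) ^ a ≤ ε * Real.log x :=
  Real.tendsto_log_atTop.eventually (eventually_log_pow_le a hε)

lemma eventually_le_log (c : ℝ) : ∀ᶠ x : ℝ in atTop, c ≤ Real.log x :=
  Real.tendsto_log_atTop.eventually_ge_atTop c

lemma eventually_le_loglog (c : ℝ) : ∀ᶠ x : ℝ in atTop, c ≤ Real.log (Real.log x) :=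
  Real.tendsto_log_atTop.eventually (eventually_le_log c)

lemma one_add_pow_le_three_pow {v : ℝ} (hv : 0 ≤ v) (hv1 : v ≤ 1) (m : ℕ) :
    (1 + v) ^ m ≤ 1 + 3 ^ m * v := by
  induction m with
  | zero => simp; exact hv
  | succ m ih =>
    have h3 : (1 : ℝ) ≤ 3 ^ m := one_le_pow₀ (by norm_num)
    calc (1 + v) ^ (m + 1) = (1 + v) ^ m * (1 + v) := pow_succ _ _
      _ ≤ (1 + 3 ^ m * v) * (1 + v) := by gcongr
      _ ≤ 1 + 3 ^ (m + 1) * v := by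
        rw [pow_succ]
        nlinarith [mul_nonneg hv (sub_nonneg.2 hv1), mul_nonneg (sub_nonneg.2 h3) hv,
          mul_nonneg (mul_nonneg (by linarith : (0 : ℝ) ≤ 3 ^ m) hv) (sub_nonneg.2 hv1)]

/-- Primes in intervals: an upper bound that is sharp on intervals that are only a power of `log x`
shorter than `x`. -/
lemma prime_interval_upper (A B : ℕ) : ∃ C : ℝ, 0 ≤ C ∧ ∀ᶠ x : ℝ in atTop, ∀ s t : ℝ,
    x / Real.log x ^ B ≤ s → s ≤ t → t ≤ x →
    (((Finset.Icc ⌈s⌉₊ ⌊t⌋₊).filter Nat.Prime).card : ℝ) ≤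
      (t - s) / Real.log x * (1 + C * Real.log (Real.log x) / Real.log x) +
        C * x / Real.log x ^ A := by
  obtain ⟨C₁, hC₁, hD⟩ := abs_lambdaLogSum_le A
  set k := 2 * A with hk
  refine ⟨max (3 ^ (k + 1) * (2 * B)) (1 + 2 ^ (k + 1) * (1 + 2 * C₁)), by positivity, ?_⟩
  set C := max ((3 : ℝ) ^ (k + 1) * (2 * B)) (1 + 2 ^ (k + 1) * (1 + 2 * C₁)) with hC
  filter_upwards [eventually_le_log 1, eventually_le_loglog 1, eventually_log_pow_le A one_pos,
    eventually_log_pow_le B (show (0 : ℝ) < 1 / 3 by norm_num), eventually_ge_atTop 3,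
    eventually_loglog_pow_le 1 (show (0 : ℝ) < 1 / (2 * (B + 1)) by positivity)]
    with x hL hl hLA hLB hx3 hlL s t hs hst ht
  set L := Real.log x with hLdef
  set l := Real.log L with hldef
  have hL0 : 0 < L := by linarith
  have hx0 : 0 < x := by linarith
  have hLB0 : 0 < L ^ B := by positivity
  have hs3 : 3 ≤ s := by
    refine le_trans ?_ hs
    rw [le_div_iff₀ hLB0]; linarith
  have hs0 : 0 < s := by linarith
  have hBl : B * l ≤ L / 2 := by
    rw [pow_one] at hlL
    have : (B + 1 : ℝ) * l ≤ (B + 1) * (1 / (2 * (B + 1)) * L) := by gcongr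
    have e : (B + 1 : ℝ) * (1 / (2 * (B + 1)) * L) = L / 2 := by field_simp
    rw [e] at this
    nlinarith
  set lam := L - B * l with hlam
  have hlam2 : L / 2 ≤ lam := by rw [hlam]; linarith
  have hlam0 : 0 < lam := by linarith
  have hlogs : lam ≤ Real.log s := by
    have : Real.log (x / L ^ B) ≤ Real.log s := Real.log_le_log (by positivity) hs
    rw [Real.log_div hx0.ne' hLB0.ne', Real.log_pow] at this
    exact this
  have hlogt : Real.log t ≤ L := Real.log_le_log (by linarith) ht
  have hst' : ⌊s⌋₊ ≤ ⌊t⌋₊ := Nat.floor_mono hst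
  set P := (Finset.Ioc ⌊s⌋₊ ⌊t⌋₊).filter Nat.Prime with hP
  have hsub : (Finset.Icc ⌈s⌉₊ ⌊t⌋₊).filter Nat.Prime ⊆ insert ⌊s⌋₊ P := by
    intro n hn
    rw [Finset.mem_filter, Finset.mem_Icc] at hn
    rw [Finset.mem_insert, hP, Finset.mem_filter, Finset.mem_Ioc]
    by_cases h : ⌊s⌋₊ < n
    · exact Or.inr ⟨⟨h, hn.1.2⟩, hn.2⟩
    · left
      have h1 : ⌊s⌋₊ ≤ ⌈s⌉₊ := Nat.floor_le_ceil s
      omega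
  have hcard : (((Finset.Icc ⌈s⌉₊ ⌊t⌋₊).filter Nat.Prime).card : ℝ) ≤ P.card + 1 := by
    have := (Finset.card_le_card hsub).trans (Finset.card_insert_le _ _)
    exact_mod_cast this
  have hlow : P.card * lam ^ (k + 1) ≤ ∑ n ∈ Finset.Ioc ⌊s⌋₊ ⌊t⌋₊,
      ArithmeticFunction.vonMangoldt n * Real.log n ^ k := by
    calc P.card * lam ^ (k + 1) = ∑ n ∈ P, lam ^ (k + 1) := by rw [Finset.sum_const, nsmul_eq_mul]
      _ ≤ ∑ n ∈ P, ArithmeticFunction.vonMangoldt n * Real.log n ^ k := by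
          refine Finset.sum_le_sum fun n hn => ?_
          rw [hP, Finset.mem_filter, Finset.mem_Ioc] at hn
          rw [ArithmeticFunction.vonMangoldt_apply_prime hn.2, ← pow_succ']
          have : s ≤ n := (Nat.lt_of_floor_lt hn.1.1).le
          have : Real.log s ≤ Real.log n := Real.log_le_log hs0 this
          gcongr
          linarith
      _ ≤ _ := by
          refine Finset.sum_le_sum_of_subset_of_nonneg (Finset.filter_subset _ _) fun n _ _ => ?_
          have := Real.log_natCast_nonneg n
          have : 0 ≤ ArithmeticFunction.vonMangoldt n := ArithmeticFunction.vonMangoldt_nonneg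
          positivity
  have hsplit : ∑ n ∈ Finset.Ioc ⌊s⌋₊ ⌊t⌋₊, ArithmeticFunction.vonMangoldt n * Real.log n ^ k =
      ∑ n ∈ Finset.Ioc ⌊s⌋₊ ⌊t⌋₊, Real.log n ^ k + (lambdaLogSum k t - lambdaLogSum k s) := by
    have e : lambdaLogSum k t = lambdaLogSum k s + ∑ n ∈ Finset.Ioc ⌊s⌋₊ ⌊t⌋₊, lambdaLog k n :=
      (Finset.sum_Ioc_consecutive _ (Nat.zero_le _) hst').symm
    rw [e, add_sub_cancel_left, ← Finset.sum_add_distrib]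
    refine Finset.sum_congr rfl fun n _ => ?_
    rw [lambdaLog]; ring
  have hT : ∑ n ∈ Finset.Ioc ⌊s⌋₊ ⌊t⌋₊, Real.log n ^ k ≤ (t - s + 1) * L ^ k := by
    have hc : ((Finset.Ioc ⌊s⌋₊ ⌊t⌋₊).card : ℝ) ≤ t - s + 1 := by
      rw [Nat.card_Ioc, Nat.cast_sub hst']
      have := Nat.floor_le (hs0.le.trans hst)
      have := Nat.lt_floor_add_one s
      linarith
    calc _ ≤ ∑ n ∈ Finset.Ioc ⌊s⌋₊ ⌊t⌋₊, L ^ k := by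
          refine Finset.sum_le_sum fun n hn => ?_
          rw [Finset.mem_Ioc] at hn
          have h1 : (n : ℝ) ≤ t := (Nat.le_floor_iff (by linarith)).1 hn.2
          have h0 := Real.log_natCast_nonneg n
          gcongr
          refine le_trans (Real.log_le_log ?_ h1) hlogt
          have : 1 ≤ n := by omega
          exact_mod_cast this
      _ = (Finset.Ioc ⌊s⌋₊ ⌊t⌋₊).card * L ^ k := by rw [Finset.sum_const, nsmul_eq_mul]
      _ ≤ _ := by gcongr
  have hDt : ∀ y, 3 ≤ y → y ≤ x → |lambdaLogSum k y| ≤ C₁ * (x * L ^ A) := by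
    intro y hy hyx
    refine (hD y hy).trans ?_
    have : 0 ≤ Real.log y := Real.log_nonneg (by linarith)
    have : Real.log y ≤ L := Real.log_le_log (by linarith) hyx
    gcongr
  have d1 := (abs_le.1 (hDt t (by linarith) ht)).2
  have d2 := (abs_le.1 (hDt s hs3 (by linarith))).1
  have hmain : P.card * lam ^ (k + 1) ≤ (t - s) * L ^ k + (L ^ k + 2 * C₁ * (x * L ^ A)) := by
    linarith
  have hP2 : (P.card : ℝ) ≤ (t - s) * (L ^ k / lam ^ (k + 1)) +
      (L ^ k + 2 * C₁ * (x * L ^ A)) / lam ^ (k + 1) := by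
    rw [← mul_div_assoc, ← add_div, le_div_iff₀ (by positivity)]
    exact hmain
  have hr1 : L ^ k / lam ^ (k + 1) ≤ 1 / L * (1 + C * l / L) := by
    set u := 2 * (B * l / L) with hu
    have hu0 : 0 ≤ u := by positivity
    have hu1 : u ≤ 1 := by
      rw [hu, ← mul_div_assoc, div_le_one hL0]; linarith
    have : L / lam ≤ 1 + u := by
      rw [div_le_iff₀ hlam0]
      have : lam = L * (1 - u / 2) := by rw [hlam, hu]; field_simp
      rw [this]
      nlinarith [mul_nonneg hL0.le (mul_nonneg hu0 (sub_nonneg.2 hu1))]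
    calc L ^ k / lam ^ (k + 1) = 1 / L * (L / lam) ^ (k + 1) := by
          rw [div_pow, pow_succ L]; field_simp
      _ ≤ 1 / L * (1 + u) ^ (k + 1) := by gcongr
      _ ≤ 1 / L * (1 + 3 ^ (k + 1) * u) := by
          gcongr; exact one_add_pow_le_three_pow hu0 hu1 _
      _ = 1 / L * (1 + 3 ^ (k + 1) * (2 * B) * l / L) := by rw [hu]; ring
      _ ≤ _ := by
          gcongr
          exact le_max_left _ _
  have hr2 : (L ^ k + 2 * C₁ * (x * L ^ A)) / lam ^ (k + 1) ≤ 2 ^ (k + 1) * (1 + 2 * C₁) * (x / L ^ A) := by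
    have hLk : L ^ k ≤ x * L ^ A := by
      rw [hk, two_mul, pow_add]
      gcongr
      linarith
    calc (L ^ k + 2 * C₁ * (x * L ^ A)) / lam ^ (k + 1)
        ≤ (x * L ^ A + 2 * C₁ * (x * L ^ A)) / (L / 2) ^ (k + 1) := by gcongr
      _ = 2 ^ (k + 1) * (1 + 2 * C₁) * (x / L ^ A) / L := by
          rw [div_pow, pow_succ L, show L ^ k = L ^ A * L ^ A by rw [hk, two_mul, pow_add]]
          field_simp
      _ ≤ _ := div_le_self (by positivity) hL
  have hone : 1 ≤ x / L ^ A := by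
    rw [le_div_iff₀ (by positivity)]; linarith
  calc _ ≤ (P.card : ℝ) + 1 := hcard
    _ ≤ (t - s) * (1 / L * (1 + C * l / L)) + 2 ^ (k + 1) * (1 + 2 * C₁) * (x / L ^ A) + x / L ^ A := by
        have : 0 ≤ t - s := by linarith
        have h5 : (t - s) * (L ^ k / lam ^ (k + 1)) ≤ (t - s) * (1 / L * (1 + C * l / L)) := by gcongr
        linarith
    _ = (t - s) / L * (1 + C * l / L) + (1 + 2 ^ (k + 1) * (1 + 2 * C₁)) * x / L ^ A := by ring
    _ ≤ _ := by
        gcongr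
        exact le_max_right _ _

/-- The lower bound `π(x) ≥ (x / log x)(1 - O(log log x / log x))`. -/
lemma primeCounting_lower : ∃ C : ℝ, 0 ≤ C ∧ ∀ᶠ x : ℝ in atTop,
    x / Real.log x * (1 - C * Real.log (Real.log x) / Real.log x) ≤ Nat.primeCounting ⌊x⌋₊ := by
  obtain ⟨C₁, hC₁, hD⟩ := abs_lambdaLogSum_le 1
  refine ⟨4 + C₁, by positivity, ?_⟩
  filter_upwards [eventually_ge_atTop 3, eventually_le_log 2, eventually_le_loglog 1,
    eventually_loglog_pow_le 1 one_pos, eventually_log_pow_le 1 one_pos] with x hx hL hl hlL hLx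
  set L := Real.log x with hLdef
  set l := Real.log L with hldef
  rw [pow_one, one_mul] at hlL hLx
  have hx0 : 0 < x := by linarith
  have hL0 : 0 < L := by linarith
  have hxL : x / L ≤ x := div_le_self hx0.le (by linarith)
  have hxL1 : 1 ≤ x / L := by rw [le_div_iff₀ hL0]; linarith
  have h1 := (abs_le.1 (hD x hx)).1
  rw [pow_one, ← hLdef, lambdaLogSum] at h1
  have hlog : ∀ n ∈ Finset.Ioc 0 ⌊x⌋₊, 0 ≤ Real.log n ∧ Real.log n ≤ L := by
    intro n hn
    rw [Finset.mem_Ioc] at hn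
    have h1 : (n : ℝ) ≤ x := (Nat.le_floor_iff (by linarith)).1 hn.2
    exact ⟨Real.log_natCast_nonneg n, Real.log_le_log (by exact_mod_cast hn.1) h1⟩
  have hpsi : ∑ n ∈ Finset.Ioc 0 ⌊x⌋₊, ArithmeticFunction.vonMangoldt n * Real.log n ^ 2 ≤
      L ^ 2 * (Nat.primeCounting ⌊x⌋₊ * L) := by
    calc _ ≤ ∑ n ∈ Finset.Ioc 0 ⌊x⌋₊, L ^ 2 * ArithmeticFunction.vonMangoldt n := by
          refine Finset.sum_le_sum fun n hn => ?_
          obtain ⟨a, b⟩ := hlog n hn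
          have : 0 ≤ ArithmeticFunction.vonMangoldt n := ArithmeticFunction.vonMangoldt_nonneg
          rw [mul_comm]
          gcongr
      _ = L ^ 2 * Chebyshev.psi x := by rw [← Finset.mul_sum]; rfl
      _ ≤ _ := by
          gcongr
          exact Chebyshev.psi_le_primeCounting_mul_log' x
  have hT : (x - x / L - 1) * (L - l) ^ 2 ≤ ∑ n ∈ Finset.Ioc 0 ⌊x⌋₊, Real.log n ^ 2 := by
    have hmono : ⌊x / L⌋₊ ≤ ⌊x⌋₊ := Nat.floor_mono hxL
    calc (x - x / L - 1) * (L - l) ^ 2 ≤ (Finset.Ioc ⌊x / L⌋₊ ⌊x⌋₊).card * (L - l) ^ 2 := by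
          gcongr
          rw [Nat.card_Ioc, Nat.cast_sub hmono]
          have := Nat.floor_le (by positivity : 0 ≤ x / L)
          have := Nat.lt_floor_add_one x
          linarith
      _ = ∑ n ∈ Finset.Ioc ⌊x / L⌋₊ ⌊x⌋₊, (L - l) ^ 2 := by rw [Finset.sum_const, nsmul_eq_mul]
      _ ≤ ∑ n ∈ Finset.Ioc ⌊x / L⌋₊ ⌊x⌋₊, Real.log n ^ 2 := by
          refine Finset.sum_le_sum fun n hn => ?_
          rw [Finset.mem_Ioc] at hn
          have : x / L ≤ n := (Nat.lt_of_floor_lt hn.1).le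
          have h5 := Real.log_le_log (by positivity) this
          rw [Real.log_div hx0.ne' hL0.ne'] at h5
          have : 0 ≤ L - l := by linarith
          gcongr
      _ ≤ _ := Finset.sum_le_sum_of_subset_of_nonneg
          (Finset.Ioc_subset_Ioc_left (Nat.zero_le _)) (fun n _ _ => by positivity)
  have hsplit : ∑ n ∈ Finset.Ioc 0 ⌊x⌋₊, lambdaLog 2 n =
      ∑ n ∈ Finset.Ioc 0 ⌊x⌋₊, ArithmeticFunction.vonMangoldt n * Real.log n ^ 2 -
      ∑ n ∈ Finset.Ioc 0 ⌊x⌋₊, Real.log n ^ 2 := by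
    rw [← Finset.sum_sub_distrib]
    exact Finset.sum_congr rfl fun n _ => by rw [lambdaLog]; ring
  rw [show 2 * 1 = 2 by norm_num, hsplit] at h1
  have hT2 : x * L ^ 2 - 2 * x * L * l - 2 * x * L ≤ (x - x / L - 1) * (L - l) ^ 2 := by
    have e1 : x - 2 * (x / L) ≤ x - x / L - 1 := by linarith
    have e2 : x * L ^ 2 - 2 * x * L * l - 2 * x * L ≤ (x - 2 * (x / L)) * (L - l) ^ 2 := by
      have : (x - 2 * (x / L)) * (L - l) ^ 2 = x * (L - l) ^ 2 - 2 * x * (L - l) * ((L - l) / L) := by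
        field_simp
      rw [this]
      have h6 : (L - l) / L ≤ 1 := by rw [div_le_one hL0]; linarith
      have h7 : 2 * x * (L - l) * ((L - l) / L) ≤ 2 * x * (L - l) * 1 := by
        have : 0 ≤ L - l := by linarith
        gcongr
      nlinarith [mul_nonneg hx0.le (sq_nonneg l), mul_nonneg hx0.le (by linarith : 0 ≤ l)]
    exact e2.trans (by gcongr)
  have hfin : x * L ^ 2 - (4 + C₁) * (x * L * l) ≤ Nat.primeCounting ⌊x⌋₊ * L ^ 3 := by
    have a1 : x * L ≤ x * L * l := le_mul_of_one_le_right (by positivity) hl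
    have a2 : C₁ * (x * L) ≤ C₁ * (x * L * l) := by gcongr
    nlinarith
  have e : x / L * (1 - (4 + C₁) * l / L) = (x * L ^ 2 - (4 + C₁) * (x * L * l)) / L ^ 3 := by
    field_simp
  rw [e, div_le_iff₀ (by positivity)]
  exact hfin

end

section

open Finset

lemma sum_biUnion_le_sum {ι : Type*} (s : Finset ι) (t : ι → Finset ℕ) (w : ℕ → ℝ)
    (hw : ∀ n, 0 ≤ w n) : ∑ d ∈ s.biUnion t, w d ≤ ∑ i ∈ s, ∑ d ∈ t i, w d := by
  classical
  induction s using Finset.induction_on with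
  | empty => simp
  | insert a s ha ih =>
    rw [biUnion_insert, sum_insert ha]
    have := sum_union_inter (s₁ := t a) (s₂ := s.biUnion t) (f := w)
    have := sum_nonneg fun i (_ : i ∈ t a ∩ s.biUnion t) => hw i
    linarith

/-- The abundancy index `σ(n) / n`. -/
def abund (n : ℕ) : ℚ := (ArithmeticFunction.sigma 1 n : ℚ) / n

lemma abund_mul {m n : ℕ} (h : m.Coprime n) : abund (m * n) = abund m * abund n := by
  rw [abund, abund, abund, ArithmeticFunction.isMultiplicative_sigma.map_mul_of_coprime h]
  push_cast
  rw [mul_div_mul_comm]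

lemma abund_pos {n : ℕ} (hn : n ≠ 0) : 0 < abund n := by
  have h1 : 0 < ArithmeticFunction.sigma 1 n := ArithmeticFunction.sigma_pos 1 n hn
  have h2 : 0 < n := Nat.pos_of_ne_zero hn
  rw [abund]
  positivity

/-- Odd numbers up to `N` with prescribed abundancy index. -/
def fiberOdd (N : ℕ) (q : ℚ) : Finset ℕ := (Icc 1 N).filter fun d => Odd d ∧ abund d = q

/-- Removing the full power of a prime from all the elements of a fiber. -/
lemma sum_le_of_factorization_eq (w : ℕ →* ℝ) (hw : ∀ n, 0 ≤ w n) {p : ℕ} (hp : p.Prime) {a N : ℕ}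
    {q : ℚ} {B : ℝ} {T : Finset ℕ} (hT : ∀ d ∈ T, 1 ≤ d ∧ d ≤ N ∧ abund d = q ∧
      d.factorization p = a ∧ Odd (d / p ^ a))
    (hB : ∑ e ∈ fiberOdd (N / p ^ a) (q / abund (p ^ a)), w e ≤ B) : ∑ d ∈ T, w d ≤ w p ^ a * B := by
  have hdec : ∀ d ∈ T, p ^ a * (d / p ^ a) = d := by
    intro d hd
    have := Nat.ordProj_mul_ordCompl_eq_self d p
    rwa [(hT d hd).2.2.2.1] at this
  have hinj : Set.InjOn (fun d => d / p ^ a) T := by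
    intro d hd e he h
    rw [← hdec d hd, ← hdec e he]
    exact congrArg _ h
  have hsub : T.image (fun d => d / p ^ a) ⊆ fiberOdd (N / p ^ a) (q / abund (p ^ a)) := by
    intro e he
    rw [mem_image] at he
    obtain ⟨d, hd, rfl⟩ := he
    obtain ⟨h1, h2, h3, h4, h5⟩ := hT d hd
    have hcop : (p ^ a).Coprime (d / p ^ a) := by
      have := Nat.coprime_ordCompl hp (by omega : d ≠ 0)
      rw [h4] at this
      exact Nat.Coprime.pow_left a this
    rw [fiberOdd, mem_filter, mem_Icc]
    refine ⟨⟨?_, Nat.div_le_div_right h2⟩, h5, ?_⟩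
    · exact h5.pos
    · rw [eq_div_iff (abund_pos (pow_ne_zero _ hp.ne_zero)).ne', mul_comm, ← abund_mul hcop, hdec d hd, h3]
  calc ∑ d ∈ T, w d = ∑ d ∈ T, w p ^ a * w (d / p ^ a) := by
        refine sum_congr rfl fun d hd => ?_
        rw [← map_pow, ← map_mul, hdec d hd]
    _ = w p ^ a * ∑ e ∈ T.image (fun d => d / p ^ a), w e := by
        rw [sum_image hinj, mul_sum]
    _ ≤ w p ^ a * ∑ e ∈ fiberOdd (N / p ^ a) (q / abund (p ^ a)), w e := by
        have := pow_nonneg (hw p) a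
        gcongr
        exact fun _ _ _ => hw _
    _ ≤ w p ^ a * B := by
        have := pow_nonneg (hw p) a
        gcongr

lemma sum_pow_le_of_lt_one {r : ℝ} (h0 : 0 ≤ r) (h1 : r < 1) (N : ℕ) :
    ∑ a ∈ Icc 1 N, r ^ a ≤ r / (1 - r) := by
  have := geom_sum_Ico_le_of_lt_one (m := 1) (n := N + 1) h0 h1
  rw [pow_one] at this
  exact this

lemma abund_eq_one_iff {d : ℕ} (hd : d ≠ 0) : abund d = 1 ↔ d = 1 := by
  constructor
  · intro h
    by_contra h1
    have hd' : (d : ℚ) ≠ 0 := by exact_mod_cast hd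
    rw [abund, div_eq_one_iff_eq hd'] at h
    have h2 : ArithmeticFunction.sigma 1 d = d := by exact_mod_cast h
    rw [ArithmeticFunction.sigma_one_apply] at h2
    have h3 : ∑ i ∈ ({1, d} : Finset ℕ), i ≤ ∑ i ∈ d.divisors, i := by
      refine sum_le_sum_of_subset fun i hi => ?_
      simp only [mem_insert, mem_singleton] at hi
      rcases hi with rfl | rfl <;> simp [hd]
    rw [sum_pair (Ne.symm h1)] at h3
    omega
  · rintro rfl
    simp [abund]

lemma den_abund_dvd (d : ℕ) : (abund d).den ∣ d := by
  have := Rat.den_dvd (ArithmeticFunction.sigma 1 d : ℤ) (d : ℤ)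
  rw [Rat.divInt_eq_div] at this
  exact Int.natCast_dvd_natCast.mp this

lemma two_mul_sigma_pow_lt {p : ℕ} (hp : p.Prime) (h3 : 3 ≤ p) (a : ℕ) :
    2 * ArithmeticFunction.sigma 1 (p ^ a) < 3 * p ^ a := by
  rw [ArithmeticFunction.sigma_one_apply_prime_pow hp]
  induction a with
  | zero => simp
  | succ n ih =>
    rw [sum_range_succ]
    have : 3 * p ^ n ≤ p ^ (n + 1) := by rw [pow_succ, mul_comm]; gcongr
    omega

lemma two_dvd_sigma_pow {p : ℕ} (hp : p.Prime) (h2 : Odd p) {a : ℕ} (ha : Odd a) :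
    2 ∣ ArithmeticFunction.sigma 1 (p ^ a) := by
  rw [ArithmeticFunction.sigma_one_apply_prime_pow hp, ← even_iff_two_dvd,
    even_sum_iff_even_card_odd]
  rw [filter_true_of_mem fun i _ => h2.pow, card_range]
  exact ha.add_one

/-- An odd multiply perfect number greater than one is divisible by some prime to an even power. -/
lemma exists_even_factorization {d k : ℕ} (hd : Odd d) (h1 : d ≠ 1)
    (hk : ArithmeticFunction.sigma 1 d = k * d) :
    ∃ p, p.Prime ∧ p ∣ d ∧ Even (d.factorization p) := by
  by_contra! hcon
  have hd0 : d ≠ 0 := hd.pos.ne'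
  have hprod := ArithmeticFunction.IsMultiplicative.multiplicative_factorization
    (ArithmeticFunction.sigma 1) (ArithmeticFunction.isMultiplicative_sigma (k := 1)) hd0
  rw [Finsupp.prod, Nat.support_factorization] at hprod
  have hodd : ∀ p ∈ d.primeFactors, p.Prime ∧ Odd p ∧ Odd (d.factorization p) := by
    intro p hp
    rw [Nat.mem_primeFactors] at hp
    exact ⟨hp.1, hd.of_dvd_nat hp.2.1, Nat.not_even_iff_odd.mp (hcon p hp.1 hp.2.1)⟩
  set ω := d.primeFactors.card with hω
  have hdiv : 2 ^ ω ∣ ArithmeticFunction.sigma 1 d := by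
    rw [hprod, hω, ← prod_const]
    exact prod_dvd_prod_of_dvd _ _ fun p hp =>
      two_dvd_sigma_pow (hodd p hp).1 (hodd p hp).2.1 (hodd p hp).2.2
  rw [hk] at hdiv
  have hdk : 2 ^ ω ∣ k :=
    Nat.Coprime.dvd_of_dvd_mul_right (Nat.Coprime.pow_left _ (Nat.coprime_two_left.mpr hd)) hdiv
  have hk0 : k ≠ 0 := by
    rintro rfl
    have := ArithmeticFunction.sigma_pos 1 d hd0
    omega
  have hle := Nat.le_of_dvd (Nat.pos_of_ne_zero hk0) hdk
  have hup : 2 ^ ω * ArithmeticFunction.sigma 1 d ≤ 3 ^ ω * d := by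
    have hd' := Nat.prod_factorization_pow_eq_self hd0
    rw [Finsupp.prod, Nat.support_factorization] at hd'
    rw [hprod, hω, ← prod_const, ← prod_const]
    conv_rhs => rhs; rw [← hd']
    rw [← prod_mul_distrib, ← prod_mul_distrib]
    refine prod_le_prod' fun p hp => ?_
    obtain ⟨hpp, hpo, -⟩ := hodd p hp
    have : p ≠ 2 := by rintro rfl; exact absurd hpo (by decide)
    have := hpp.two_le
    exact (two_mul_sigma_pow_lt hpp (by omega) _).le
  rw [hk] at hup
  have h4 : 2 ^ ω * 2 ^ ω ≤ 3 ^ ω := by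
    have : 2 ^ ω * k * d ≤ 3 ^ ω * d := by rw [mul_assoc]; exact hup
    exact (Nat.mul_le_mul_left _ hle).trans (Nat.le_of_mul_le_mul_right this (Nat.pos_of_ne_zero hd0))
  rw [← mul_pow] at h4
  have hω0 : ω = 0 := by
    by_contra h
    exact absurd h4 (not_le.mpr (Nat.pow_lt_pow_left (by norm_num) h))
  rw [hω, card_eq_zero, Nat.primeFactors_eq_empty] at hω0
  omega

lemma sum_fiberOdd_le_aux (w : ℕ →* ℝ) (hw : ∀ n, 0 ≤ w n) {c : ℝ}
    (h1 : ∀ p : ℕ, p.Prime → Odd p → w p < 1 ∧ w p / (1 - w p) ≤ c)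
    (h2 : ∀ N : ℕ, ∑ p ∈ (Icc 1 N).filter fun p => p.Prime ∧ Odd p, w p ^ 2 / (1 - w p ^ 2) ≤ c)
    (hc : c ≤ 1) (N : ℕ) :
    ∀ q, ∑ d ∈ fiberOdd N q, w d ≤ 1 ∧ (q ≠ 1 → ∑ d ∈ fiberOdd N q, w d ≤ c) := by
  induction N using Nat.strong_induction_on with
  | _ N ih =>
  intro q
  have hc0 : 0 ≤ c := (sum_nonneg (by simp)).trans (h2 0)
  suffices h : (q ≠ 1 → ∑ d ∈ fiberOdd N q, w d ≤ c) by
    refine ⟨?_, h⟩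
    rcases eq_or_ne q 1 with rfl | hq
    · have : fiberOdd N 1 ⊆ {1} := by
        intro d hd
        rw [fiberOdd, mem_filter, mem_Icc] at hd
        rw [mem_singleton]
        exact (abund_eq_one_iff (by omega)).mp hd.2.2
      calc _ ≤ ∑ d ∈ ({1} : Finset ℕ), w d := sum_le_sum_of_subset_of_nonneg this fun _ _ _ => hw _
        _ = 1 := by simp
    · exact (h hq).trans hc
  intro hq
  have hpeel : ∀ p, p.Prime → Odd p → ∀ a, 1 ≤ a → 
      ∑ d ∈ (fiberOdd N q).filter (fun d => d.factorization p = a), w d ≤ w p ^ a := by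
    intro p hp hpo a ha
    rcases Nat.eq_zero_or_pos N with rfl | hN
    · simpa [fiberOdd] using pow_nonneg (hw p) a
    have hlt : N / p ^ a < N := Nat.div_lt_self hN (Nat.one_lt_pow (by omega) hp.one_lt)
    have := sum_le_of_factorization_eq w hw hp (a := a) (N := N) (q := q) (B := 1)
      (T := (fiberOdd N q).filter (fun d => d.factorization p = a)) ?_ (ih _ hlt _).1
    · rwa [mul_one] at this
    · intro d hd
      rw [mem_filter, fiberOdd, mem_filter, mem_Icc] at hd
      refine ⟨hd.1.1.1, hd.1.1.2, hd.1.2.2, hd.2, ?_⟩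
      rw [← hd.2]
      exact hd.1.2.1.of_dvd_nat (Nat.div_dvd_of_dvd (Nat.ordProj_dvd d p))
  have hfacle : ∀ d ∈ fiberOdd N q, ∀ p, d.factorization p ≤ N := by
    intro d hd p
    rw [fiberOdd, mem_filter, mem_Icc] at hd
    exact (Nat.factorization_lt p (by omega)).le.trans hd.1.2
  by_cases hden : ∃ p, p.Prime ∧ Odd p ∧ p ∣ q.den
  · obtain ⟨p, hp, hpo, hpd⟩ := hden
    have hsub : fiberOdd N q ⊆ (Icc 1 N).biUnion
        fun a => (fiberOdd N q).filter (fun d => d.factorization p = a) := by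
      intro d hd
      have hd' := hd
      rw [fiberOdd, mem_filter, mem_Icc] at hd'
      have : p ∣ d := hpd.trans (hd'.2.2 ▸ den_abund_dvd d)
      simp only [mem_biUnion, mem_filter, mem_Icc]
      exact ⟨_, ⟨hp.factorization_pos_of_dvd (by omega) this, hfacle d hd p⟩, hd, rfl⟩
    calc ∑ d ∈ fiberOdd N q, w d ≤ _ := sum_le_sum_of_subset_of_nonneg hsub fun _ _ _ => hw _
      _ ≤ ∑ a ∈ Icc 1 N, ∑ d ∈ (fiberOdd N q).filter (fun d => d.factorization p = a), w d :=
        sum_biUnion_le_sum _ _ _ hw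
      _ ≤ ∑ a ∈ Icc 1 N, w p ^ a := sum_le_sum fun a ha => hpeel p hp hpo a (mem_Icc.mp ha).1
      _ ≤ w p / (1 - w p) := sum_pow_le_of_lt_one (hw p) (h1 p hp hpo).1 N
      _ ≤ c := (h1 p hp hpo).2
  · push Not at hden
    have hsub : fiberOdd N q ⊆ ((Icc 1 N).filter fun p => p.Prime ∧ Odd p).biUnion fun p =>
        (Icc 1 N).biUnion
        fun b => (fiberOdd N q).filter (fun d => d.factorization p = 2 * b) := by
      intro d hd
      have hd' := hd
      rw [fiberOdd, mem_filter, mem_Icc] at hd'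
      obtain ⟨⟨hd1, hdN⟩, hdo, hdq⟩ := hd'
      have hq1 : q.den = 1 := by
        by_contra h
        obtain ⟨p, hp, hpd⟩ := Nat.exists_prime_and_dvd h
        exact hden p hp (hdo.of_dvd_nat (hpd.trans (hdq ▸ den_abund_dvd d))) hpd
      have hqpos : 0 < q := hdq ▸ abund_pos (by omega)
      have hqn : q = (q.num.toNat : ℚ) := by
        have h3 : (q.num.toNat : ℤ) = q.num := Int.toNat_of_nonneg (Rat.num_nonneg.mpr hqpos.le)
        have h4 : ((q.num.toNat : ℤ) : ℚ) = q.num := by rw [h3]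
        rw [Int.cast_natCast] at h4
        rw [h4, Rat.coe_int_num_of_den_eq_one hq1]
      have hsig : ArithmeticFunction.sigma 1 d = q.num.toNat * d := by
        have h0 : (d : ℚ) ≠ 0 := by exact_mod_cast (by omega : d ≠ 0)
        have h3 := hdq
        rw [abund, div_eq_iff h0, hqn] at h3
        exact_mod_cast h3
      have hdne : d ≠ 1 := by
        rintro rfl
        exact hq (hdq ▸ (abund_eq_one_iff one_ne_zero).mpr rfl)
      obtain ⟨p, hp, hpd, b, hb⟩ := exists_even_factorization hdo hdne hsig
      have hpos := hp.factorization_pos_of_dvd (by omega) hpd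
      have hle := hfacle d hd p
      have hpN := Nat.le_of_dvd (by omega) hpd
      simp only [mem_biUnion, mem_filter, mem_Icc]
      exact ⟨p, ⟨⟨hp.pos, by omega⟩, hp, hdo.of_dvd_nat hpd⟩, b, ⟨by omega, by omega⟩, hd, by omega⟩
    calc ∑ d ∈ fiberOdd N q, w d ≤ _ := sum_le_sum_of_subset_of_nonneg hsub fun _ _ _ => hw _
      _ ≤ _ := sum_biUnion_le_sum _ _ _ hw
      _ ≤ ∑ p ∈ (Icc 1 N).filter fun p => p.Prime ∧ Odd p, ∑ b ∈ Icc 1 N, 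
          ∑ d ∈ (fiberOdd N q).filter (fun d => d.factorization p = 2 * b), w d := 
        sum_le_sum fun p _ => sum_biUnion_le_sum _ _ _ hw
      _ ≤ ∑ p ∈ (Icc 1 N).filter fun p => p.Prime ∧ Odd p, ∑ b ∈ Icc 1 N, (w p ^ 2) ^ b := by
        refine sum_le_sum fun p hp => sum_le_sum fun b hb => ?_
        rw [mem_filter] at hp
        rw [mem_Icc] at hb
        rw [← pow_mul]
        exact hpeel p hp.2.1 hp.2.2 _ (by omega)
      _ ≤ ∑ p ∈ (Icc 1 N).filter fun p => p.Prime ∧ Odd p, w p ^ 2 / (1 - w p ^ 2) := by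
        refine sum_le_sum fun p hp => ?_
        rw [mem_filter] at hp
        exact sum_pow_le_of_lt_one (by positivity)
          (pow_lt_one₀ (hw p) (h1 p hp.2.1 hp.2.2).1 two_ne_zero) N
      _ ≤ c := h2 N

end

section

open Finset

/-- Numbers up to `N` with prescribed abundancy index. -/
def fiber (N : ℕ) (q : ℚ) : Finset ℕ := (Icc 1 N).filter fun d => abund d = q

lemma sum_odd_prime_le (g G : ℕ → ℝ) (hg : ∀ n, 0 ≤ g n) (hG : ∀ n, 0 ≤ G n)
    (h : ∀ j, 1 ≤ j → g (2 * j + 1) ≤ G j - G (j + 1)) (N : ℕ) :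
    ∑ p ∈ (Icc 1 N).filter fun p => p.Prime ∧ Odd p, g p ≤ G 1 := by
  have h1 : ∑ p ∈ (Icc 1 N).filter fun p => p.Prime ∧ Odd p, g p ≤
      ∑ p ∈ (Icc 1 N).image fun j => 2 * j + 1, g p := by
    refine sum_le_sum_of_subset_of_nonneg (fun p hp => ?_) fun _ _ _ => hg _
    rw [mem_filter, mem_Icc] at hp
    obtain ⟨⟨-, hpN⟩, hpp, j, rfl⟩ := hp
    have := hpp.two_le
    exact mem_image.mpr ⟨j, mem_Icc.mpr ⟨by omega, by omega⟩, rfl⟩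
  have h2 : ∀ M, ∑ j ∈ Icc 1 M, g (2 * j + 1) ≤ G 1 - G (M + 1) := by
    intro M
    induction M with
    | zero => simp
    | succ M ih =>
      rw [sum_Icc_succ_top (by omega)]
      have := h (M + 1) (by omega)
      linarith
  rw [sum_image fun a _ b _ hab => by simpa using hab] at h1
  linarith [h2 N, hG (N + 1)]

/-- The weight `d ↦ 1 / d`. -/
noncomputable def invWeight : ℕ →* ℝ where
  toFun d := (d : ℝ)⁻¹
  map_one' := by simp
  map_mul' a b := by push_cast; rw [mul_inv]

/-- The weight `d ↦ d ^ (-3/4)`. -/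
noncomputable def rpowWeight : ℕ →* ℝ where
  toFun d := (d : ℝ) ^ (-(3 / 4) : ℝ)
  map_one' := by simp
  map_mul' a b := by push_cast; rw [Real.mul_rpow (by positivity) (by positivity)]

lemma invWeight_apply (d : ℕ) : invWeight d = (d : ℝ)⁻¹ := rfl

lemma rpowWeight_apply (d : ℕ) : rpowWeight d = (d : ℝ) ^ (-(3 / 4) : ℝ) := rfl

lemma three_le_of_odd_prime {p : ℕ} (hp : p.Prime) (ho : Odd p) : 3 ≤ p := by
  have := hp.two_le
  obtain ⟨j, rfl⟩ := ho
  omega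

lemma div_one_sub_le {r c : ℝ} (h1 : r ≤ c) (h2 : c < 1) : r / (1 - r) ≤ c / (1 - c) := by
  rw [div_le_div_iff₀ (by linarith) (by linarith)]
  nlinarith

lemma div_one_sub_le_mul {r c : ℝ} (h0 : 0 ≤ r) (h1 : r ≤ c) (h2 : c < 1) :
    r / (1 - r) ≤ r * (1 / (1 - c)) := by
  rw [div_eq_mul_one_div]
  gcongr

lemma sum_fiberOdd_inv_le (N : ℕ) (q : ℚ) : ∑ d ∈ fiberOdd N q, invWeight d ≤ 1 ∧
    (q ≠ 1 → ∑ d ∈ fiberOdd N q, invWeight d ≤ 1 / 2) := by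
  have hle : ∀ p : ℕ, p.Prime → Odd p → invWeight p ≤ 1 / 3 := by
    intro p hp ho
    have : (3 : ℝ) ≤ p := by exact_mod_cast three_le_of_odd_prime hp ho
    rw [invWeight_apply, ← one_div]
    gcongr
  have hnn : ∀ n, 0 ≤ invWeight n := fun n => by rw [invWeight_apply]; positivity
  refine sum_fiberOdd_le_aux invWeight hnn ?_ ?_ (by norm_num) N q
  · intro p hp ho
    have := hle p hp ho
    refine ⟨by linarith, (div_one_sub_le this (by norm_num)).trans (by norm_num)⟩
  · intro N
    calc _ ≤ ∑ p ∈ (Icc 1 N).filter fun p => p.Prime ∧ Odd p, invWeight p ^ 2 * (9 / 8) := by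
          refine sum_le_sum fun p hp => ?_
          rw [mem_filter] at hp
          have h1 := hle p hp.2.1 hp.2.2
          have h2 := hnn p
          have := div_one_sub_le_mul (r := invWeight p ^ 2) (c := 1 / 9) (by positivity)
            (by nlinarith) (by norm_num)
          norm_num at this ⊢
          exact this
      _ = (∑ p ∈ (Icc 1 N).filter fun p => p.Prime ∧ Odd p, invWeight p ^ 2) * (9 / 8) := by
          rw [sum_mul]
      _ ≤ (1 / 4) * (9 / 8) := by
          gcongr
          have := sum_odd_prime_le (fun n => invWeight n ^ 2) (fun j => 1 / (4 * (j : ℝ)))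
            (fun n => by positivity) (fun n => by positivity) ?_ N
          · norm_num at this ⊢
            exact this
          · intro j hj
            have : (1 : ℝ) ≤ j := by exact_mod_cast hj
            simp only [invWeight_apply]
            push_cast
            rw [div_sub_div _ _ (by positivity) (by positivity), inv_pow, ← one_div,
              div_le_div_iff₀ (by positivity) (by positivity)]
            nlinarith
      _ ≤ 1 / 2 := by norm_num

lemma rpow_neg_le_of_pow_le {a b : ℝ} (ha : 0 < a) (hb : 0 < b) (h : b⁻¹ ^ 4 ≤ a ^ 3) :
    a ^ (-(3 / 4) : ℝ) ≤ b := by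
  have h1 : (a ^ (-(3 / 4) : ℝ)) ^ 4 ≤ b ^ 4 := by
    rw [← Real.rpow_natCast, ← Real.rpow_mul ha.le]
    have : (-(3 / 4) * ((4 : ℕ) : ℝ) : ℝ) = -((3 : ℕ) : ℝ) := by norm_num
    rw [this, Real.rpow_neg ha.le, Real.rpow_natCast]
    rw [inv_pow] at h
    exact inv_le_of_inv_le₀ (by positivity) h
  exact le_of_pow_le_pow_left₀ (by norm_num) hb.le h1

lemma rpowWeight_sq {p : ℕ} : rpowWeight p ^ 2 = (p : ℝ) ^ (-(3 / 2) : ℝ) := by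
  rw [rpowWeight_apply, ← Real.rpow_natCast, ← Real.rpow_mul (by positivity)]
  norm_num

lemma rpow_neg_three_halves_le {m : ℝ} (hm : 1 < m) :
    m ^ (-(3 / 2) : ℝ) ≤ 1 / √(m - 1) - 1 / √(m + 1) := by
  have hm0 : 0 < m := by linarith
  have h1 : m ^ (-(3 / 2) : ℝ) = 1 / (m * √m) := by
    rw [Real.rpow_neg hm0.le, one_div, Real.sqrt_eq_rpow]
    congr 1
    rw [show (3 / 2 : ℝ) = 1 + 1 / 2 by norm_num, Real.rpow_add hm0, Real.rpow_one]
  rw [h1]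
  have ha : 0 < √(m - 1) := Real.sqrt_pos.mpr (by linarith)
  have hb : 0 < √(m + 1) := Real.sqrt_pos.mpr (by linarith)
  have hs : 0 < √m := Real.sqrt_pos.mpr hm0
  have ha2 : √(m - 1) ^ 2 = m - 1 := Real.sq_sqrt (by linarith)
  have hb2 : √(m + 1) ^ 2 = m + 1 := Real.sq_sqrt (by linarith)
  have hs2 : √m ^ 2 = m := Real.sq_sqrt hm0.le
  set a := √(m - 1)
  set b := √(m + 1)
  set s := √m
  have hab : a * b ≤ m := by nlinarith [sq_nonneg (a - b)]
  have hab2 : a + b ≤ 2 * s := by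
    refine le_of_pow_le_pow_left₀ two_ne_zero (by positivity) ?_
    nlinarith [sq_nonneg (a - b)]
  have hba : (b - a) * (a + b) = 2 := by nlinarith
  rw [div_sub_div _ _ ha.ne' hb.ne', div_le_div_iff₀ (by positivity) (by positivity)]
  have hba0 : 0 < b - a := by
    by_contra h
    nlinarith [mul_nonneg (by linarith : 0 ≤ a - b) (by positivity : 0 ≤ a + b)]
  have h5 : 1 ≤ (b - a) * s := by nlinarith
  nlinarith [mul_le_mul hab h5 (by norm_num) hm0.le]

lemma sum_fiberOdd_rpow_le (N : ℕ) (q : ℚ) : ∑ d ∈ fiberOdd N q, rpowWeight d ≤ 1 := by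
  have hle : ∀ p : ℕ, p.Prime → Odd p → rpowWeight p ≤ 1 / 2 := by
    intro p hp ho
    have : (3 : ℝ) ≤ p := by exact_mod_cast three_le_of_odd_prime hp ho
    rw [rpowWeight_apply]
    refine rpow_neg_le_of_pow_le (by positivity) (by norm_num) ?_
    calc ((1 / 2 : ℝ)⁻¹) ^ 4 ≤ 3 ^ 3 := by norm_num
      _ ≤ (p : ℝ) ^ 3 := by gcongr
  have hnn : ∀ n, 0 ≤ rpowWeight n := fun n => by rw [rpowWeight_apply]; positivity
  refine (sum_fiberOdd_le_aux rpowWeight hnn (c := 1) ?_ ?_ le_rfl N q).1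
  · intro p hp ho
    have := hle p hp ho
    refine ⟨by linarith, (div_one_sub_le this (by norm_num)).trans (by norm_num)⟩
  · intro N
    calc _ ≤ ∑ p ∈ (Icc 1 N).filter fun p => p.Prime ∧ Odd p, rpowWeight p ^ 2 * (4 / 3) := by
          refine sum_le_sum fun p hp => ?_
          rw [mem_filter] at hp
          have h1 := hle p hp.2.1 hp.2.2
          have h2 := hnn p
          have := div_one_sub_le_mul (r := rpowWeight p ^ 2) (c := 1 / 4) (by positivity)
            (by nlinarith) (by norm_num)
          norm_num at this ⊢
          exact this
      _ = (∑ p ∈ (Icc 1 N).filter fun p => p.Prime ∧ Odd p, rpowWeight p ^ 2) * (4 / 3) := by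
          rw [sum_mul]
      _ ≤ (1 / √2) * (4 / 3) := by
          gcongr
          have := sum_odd_prime_le (fun n => rpowWeight n ^ 2) (fun j => 1 / √(2 * (j : ℝ)))
            (fun n => by positivity) (fun n => by positivity) ?_ N
          · simpa using this
          · intro j hj
            have : (1 : ℝ) ≤ j := by exact_mod_cast hj
            simp only [rpowWeight_sq]
            push_cast
            refine (rpow_neg_three_halves_le (by linarith)).trans_eq ?_
            ring_nf
      _ ≤ 1 := by
          rw [div_mul_eq_mul_div, div_le_one (by positivity)]
          refine Real.le_sqrt_of_sq_le (by norm_num)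

lemma sum_fiber_le_sum_odd (w : ℕ →* ℝ) (hw : ∀ n, 0 ≤ w n) (N : ℕ) (q : ℚ) :
    ∑ d ∈ fiber N q, w d ≤
      ∑ a ∈ range (N + 1), w 2 ^ a * ∑ d ∈ fiberOdd (N / 2 ^ a) (q / abund (2 ^ a)), w d := by
  have hsub : fiber N q ⊆ (range (N + 1)).biUnion
      fun a => (fiber N q).filter fun d => d.factorization 2 = a := by
    intro d hd
    have hd' := hd
    rw [fiber, mem_filter, mem_Icc] at hd'
    have := Nat.factorization_lt 2 (by omega : d ≠ 0)
    simp only [mem_biUnion, mem_filter, mem_range]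
    exact ⟨_, by omega, hd, rfl⟩
  refine (sum_le_sum_of_subset_of_nonneg hsub fun _ _ _ => hw _).trans
    ((sum_biUnion_le_sum _ _ _ hw).trans (sum_le_sum fun a _ => ?_))
  refine sum_le_of_factorization_eq w hw Nat.prime_two (a := a) (N := N) (q := q) ?_ le_rfl
  intro d hd
  rw [mem_filter, fiber, mem_filter, mem_Icc] at hd
  refine ⟨hd.1.1.1, hd.1.1.2, hd.1.2, hd.2, ?_⟩
  have := Nat.not_dvd_ordCompl Nat.prime_two (by omega : d ≠ 0)
  rw [hd.2] at this
  rw [← Nat.not_even_iff_odd, even_iff_two_dvd]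
  exact this

/-- The reciprocals of the numbers with a given abundancy index sum to at most one. -/
lemma sum_fiber_inv_le (N : ℕ) (q : ℚ) : ∑ d ∈ fiber N q, (d : ℝ)⁻¹ ≤ 1 := by
  have hnn : ∀ n, 0 ≤ invWeight n := fun n => by rw [invWeight_apply]; positivity
  rcases eq_or_ne q 1 with rfl | hq
  · have : fiber N 1 ⊆ {1} := by
      intro d hd
      rw [fiber, mem_filter, mem_Icc] at hd
      exact mem_singleton.mpr ((abund_eq_one_iff (by omega)).mp hd.2)
    calc _ ≤ ∑ d ∈ ({1} : Finset ℕ), (d : ℝ)⁻¹ :=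
          sum_le_sum_of_subset_of_nonneg this fun _ _ _ => by positivity
      _ = 1 := by simp
  refine (sum_fiber_le_sum_odd invWeight hnn N q).trans ?_
  have h2 : invWeight 2 = 1 / 2 := by rw [invWeight_apply]; norm_num
  rw [range_eq_Ico, sum_eq_sum_Ico_succ_bot (by omega)]
  simp only [h2, zero_add]
  have hgeo : ∑ a ∈ Ico 1 (N + 1), (1 / 2 : ℝ) ^ a ≤ 1 := by
    refine (sum_pow_le_of_lt_one (by norm_num) (by norm_num) N).trans (by norm_num)
  have hab1 : abund 1 = 1 := (abund_eq_one_iff one_ne_zero).mpr rfl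
  simp only [pow_zero, one_mul, Nat.div_one, hab1, div_one]
  rcases (fiberOdd N q).eq_empty_or_nonempty with he | ⟨d, hd⟩
  · rw [he, sum_empty, zero_add]
    refine (sum_le_sum fun a _ => mul_le_of_le_one_right (by positivity)
      (sum_fiberOdd_inv_le _ _).1).trans hgeo
  · have h5 : ∀ a ∈ Ico 1 (N + 1), (1 / 2 : ℝ) ^ a *
        ∑ d ∈ fiberOdd (N / 2 ^ a) (q / abund (2 ^ a)), invWeight d ≤ (1 / 2) ^ a * (1 / 2) := by
      intro a ha
      rw [mem_Ico] at ha
      gcongr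
      refine (sum_fiberOdd_inv_le _ _).2 fun h => ?_
      have hpos := abund_pos (pow_ne_zero a two_ne_zero)
      rw [div_eq_one_iff_eq hpos.ne'] at h
      rw [fiberOdd, mem_filter, mem_Icc] at hd
      obtain ⟨⟨hd1, -⟩, hdo, hdq⟩ := hd
      have h3 : (abund d) = abund (2 ^ a) := hdq.trans h
      have hd0 : (d : ℚ) ≠ 0 := by exact_mod_cast (by omega : d ≠ 0)
      rw [abund, abund, div_eq_div_iff hd0 (by positivity)] at h3
      have h4 : ArithmeticFunction.sigma 1 d * 2 ^ a = ArithmeticFunction.sigma 1 (2 ^ a) * d := by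
        exact_mod_cast h3
      have h6 : Odd (ArithmeticFunction.sigma 1 (2 ^ a)) := by
        rw [ArithmeticFunction.sigma_one_apply_prime_pow Nat.prime_two, Nat.geomSum_eq le_rfl]
        norm_num
        exact Nat.Even.sub_odd Nat.one_le_two_pow (by simp [Nat.even_pow]) odd_one
      have h7 : Even (ArithmeticFunction.sigma 1 d * 2 ^ a) :=
        Even.mul_left (by simp [Nat.even_pow]; omega) _
      rw [h4] at h7
      exact Nat.not_even_iff_odd.mpr (h6.mul hdo) h7
    have h8 := sum_le_sum h5
    rw [← sum_mul] at h8
    have h9 := (sum_fiberOdd_inv_le N q).2 hq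
    linarith

lemma sum_fiber_rpow_le (N : ℕ) (q : ℚ) : ∑ d ∈ fiber N q, rpowWeight d ≤ 5 / 2 := by
  have hnn : ∀ n, 0 ≤ rpowWeight n := fun n => by rw [rpowWeight_apply]; positivity
  refine (sum_fiber_le_sum_odd rpowWeight hnn N q).trans ?_
  have h2 : rpowWeight 2 ≤ 3 / 5 := by
    rw [rpowWeight_apply]
    exact rpow_neg_le_of_pow_le (by norm_num) (by norm_num) (by norm_num)
  calc _ ≤ ∑ a ∈ range (N + 1), (3 / 5 : ℝ) ^ a := by
        refine sum_le_sum fun a _ => ?_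
        have h3 := sum_fiberOdd_rpow_le (N / 2 ^ a) (q / abund (2 ^ a))
        have := hnn 2
        calc _ ≤ rpowWeight 2 ^ a * 1 := by gcongr
          _ ≤ _ := by rw [mul_one]; gcongr
    _ ≤ 5 / 2 := by
        have := geom_sum_Ico_le_of_lt_one (m := 0) (n := N + 1) (x := (3 / 5 : ℝ)) (by norm_num)
          (by norm_num)
        rw [← range_eq_Ico] at this
        norm_num at this ⊢
        exact this

/-- Large numbers with a given abundancy index have a small sum of reciprocals. -/
lemma sum_fiber_inv_tail_le {E : ℝ} (hE : 0 < E) (N : ℕ) (q : ℚ) :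
    ∑ d ∈ (fiber N q).filter (fun d : ℕ => E ^ 4 ≤ d), (d : ℝ)⁻¹ ≤ 5 / 2 / E := by
  calc _ ≤ ∑ d ∈ (fiber N q).filter (fun d : ℕ => E ^ 4 ≤ d), rpowWeight d / E := by
        refine sum_le_sum fun d hd => ?_
        rw [mem_filter] at hd
        have hd0 : (0 : ℝ) < d := lt_of_lt_of_le (by positivity) hd.2
        have h1 : E ≤ (d : ℝ) ^ (1 / 4 : ℝ) := by
          calc E = (E ^ 4) ^ (1 / 4 : ℝ) := by
                rw [← Real.rpow_natCast, ← Real.rpow_mul hE.le]; norm_num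
            _ ≤ _ := by
                gcongr
                exact hd.2
        have h2 : (d : ℝ)⁻¹ = rpowWeight d * (d : ℝ) ^ (-(1 / 4) : ℝ) := by
          rw [rpowWeight_apply, ← Real.rpow_add hd0, ← Real.rpow_neg_one]
          norm_num
        rw [h2, Real.rpow_neg hd0.le, div_eq_mul_inv (rpowWeight d)]
        have : 0 ≤ rpowWeight d := by rw [rpowWeight_apply]; positivity
        gcongr
    _ ≤ ∑ d ∈ fiber N q, rpowWeight d / E :=
        sum_le_sum_of_subset_of_nonneg (filter_subset _ _) fun d _ _ => by
          rw [rpowWeight_apply]; positivity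
    _ ≤ 5 / 2 / E := by
        rw [← sum_div]
        exact div_le_div_of_nonneg_right (sum_fiber_rpow_le N q) hE.le

end

section

open Finset

/-- Splitting a number according to a property of its prime factors. -/
lemma exists_mul_of_primes (P : ℕ → Prop) {n : ℕ} (hn : n ≠ 0) : ∃ a b, n = a * b ∧
    (∀ q, q.Prime → q ∣ a → P q) ∧ (∀ q, q.Prime → q ∣ b → ¬ P q) := by
  induction n using induction_on_primes with
  | zero => exact absurd rfl hn
  | one => 
    exact ⟨1, 1, rfl, fun q hq h => absurd (Nat.dvd_one.mp h) hq.ne_one,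
      fun q hq h => absurd (Nat.dvd_one.mp h) hq.ne_one⟩
  | prime_mul p n hp ih =>
    obtain ⟨a, b, rfl, ha, hb⟩ := ih (right_ne_zero_of_mul hn)
    by_cases h : P p
    · refine ⟨p * a, b, by ring, fun q hq hd => ?_, hb⟩
      rcases hq.dvd_mul.mp hd with h1 | h1
      · rwa [(Nat.prime_dvd_prime_iff_eq hq hp).mp h1]
      · exact ha q hq h1
    · refine ⟨a, p * b, by ring, ha, fun q hq hd => ?_⟩
      rcases hq.dvd_mul.mp hd with h1 | h1
      · rwa [(Nat.prime_dvd_prime_iff_eq hq hp).mp h1]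
      · exact hb q hq h1

lemma le_pow_card_primeFactors {n W : ℕ} (hn : n ≠ 0)
    (h : ∀ p, p.Prime → p ∣ n → p ^ n.factorization p ≤ W) : n ≤ W ^ n.primeFactors.card := by
  have hd := Nat.prod_factorization_pow_eq_self hn
  rw [Finsupp.prod, Nat.support_factorization] at hd
  conv_lhs => rw [← hd]
  refine prod_le_pow_card _ _ _ fun p hp => ?_
  rw [Nat.mem_primeFactors] at hp
  exact h p hp.1 hp.2.1

/-- A number all of whose prime powers are small has unitary divisors in short ranges. -/
lemma exists_unitary_divisor {D W : ℕ} (hD : 0 < D) (d : ℕ) (hd : D < d)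
    (h : ∀ p, p.Prime → p ∣ d → p ^ d.factorization p ≤ W) :
    ∃ e g, d = e * g ∧ e.Coprime g ∧ D < e ∧ e ≤ D * W := by
  induction d using Nat.strong_induction_on with
  | _ d ih =>
  rcases le_or_gt d (D * W) with hle | hgt
  · exact ⟨d, 1, (mul_one d).symm, Nat.coprime_one_right d, hd, hle⟩
  obtain ⟨p, hp, hpd⟩ := Nat.exists_prime_and_dvd (show d ≠ 1 by omega)
  have hd0 : d ≠ 0 := by omega
  have hdec := Nat.ordProj_mul_ordCompl_eq_self d p
  have hcop := Nat.coprime_ordCompl hp hd0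
  have hw := h p hp hpd
  set a := p ^ d.factorization p
  set d' := d / a
  have hpos := hp.factorization_pos_of_dvd hd0 hpd
  have ha : 1 < a := Nat.one_lt_pow (by omega) hp.one_lt
  have hDd : D < d' := by
    by_contra hcon
    push Not at hcon
    have := Nat.mul_le_mul hw hcon
    rw [hdec, mul_comm] at this
    omega
  have hcop' : a.Coprime d' := Nat.Coprime.pow_left _ hcop
  obtain ⟨e, g, he, hc, h1, h2⟩ := ih d' (by nlinarith) hDd fun q hq hqd => by
    refine le_trans ?_ (h q hq (hdec ▸ hqd.mul_left a))
    refine Nat.pow_le_pow_right hq.pos ?_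
    exact (Nat.factorization_le_iff_dvd (by omega) hd0).mpr (Dvd.intro_left a hdec) q
  refine ⟨e, a * g, by rw [← hdec, he]; ring, ?_, h1, h2⟩
  refine Nat.Coprime.mul_right (Nat.Coprime.symm ?_) hc
  exact hcop'.coprime_dvd_right (he ▸ dvd_mul_right e g)

/-- If a monotone function on `S` has short fibers on each interval, then `S` is small. -/
lemma card_le_of_monotone_fibers {α β : ℝ} (hα : 0 ≤ α) (q : ℕ → ℚ) (k : ℕ) :
    ∀ (S : Finset ℕ) (u v : ℕ), u ≤ v → (∀ n ∈ S, u ≤ n ∧ n ≤ v) → 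
    (∀ m ∈ S, ∀ n ∈ S, m ≤ n → q m ≤ q n) →
    (∀ c, ∀ s ∈ S, ∀ t ∈ S, s ≤ t →
      ((S.filter fun n => s ≤ n ∧ n ≤ t ∧ q n = c).card : ℝ) ≤ α * ((t : ℝ) - s) + β) →
    (S.image q).card = k → (S.card : ℝ) ≤ α * ((v : ℝ) - u) + β * k := by
  induction k with
  | zero =>
    intro S u v huv _ _ _ hk
    rw [card_eq_zero, image_eq_empty] at hk
    have : (u : ℝ) ≤ v := by exact_mod_cast huv
    have := mul_nonneg hα (sub_nonneg.mpr this)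
    simpa [hk] using this
  | succ k ih =>
    intro S u v huv hS hmono hfib hk
    have hne : (S.image q).Nonempty := card_pos.mp (by omega)
    set c := (S.image q).max' hne with hc
    set F := S.filter fun n => q n = c with hF
    have hFne : F.Nonempty := by
      obtain ⟨n, hn, hnc⟩ := mem_image.mp (max'_mem _ hne)
      exact ⟨n, mem_filter.mpr ⟨hn, hnc⟩⟩
    set S' := S.filter fun n => ¬ q n = c with hS'
    set a := F.min' hFne
    set b := F.max' hFne
    have haF := mem_filter.mp (min'_mem F hFne)
    have hbF := mem_filter.mp (max'_mem F hFne)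
    have hab : a ≤ b := min'_le _ _ (max'_mem F hFne)
    have hlt : ∀ n ∈ S', n < a := by
      intro n hn
      rw [mem_filter] at hn
      by_contra hcon
      push Not at hcon
      have h1 := hmono a haF.1 n hn.1 hcon
      rw [haF.2] at h1
      exact hn.2 (le_antisymm (le_max' _ _ (mem_image_of_mem q hn.1)) h1)
    have hcF : (F.card : ℝ) ≤ α * ((b : ℝ) - a) + β := by
      refine le_trans ?_ (hfib c a haF.1 b hbF.1 hab)
      gcongr
      intro n hn
      have hn' := mem_filter.mp hn
      exact mem_filter.mpr ⟨hn'.1, min'_le _ _ hn, le_max' _ _ hn, hn'.2⟩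
    have hcS : (S'.card : ℝ) ≤ α * ((a : ℝ) - u) + β * k := by
      refine ih S' u a (hS a haF.1).1 (fun n hn => ⟨(hS n (mem_filter.mp hn).1).1, (hlt n hn).le⟩)
        (fun m hm n hn => hmono m (mem_filter.mp hm).1 n (mem_filter.mp hn).1) ?_ ?_
      · intro c' s hs t ht hst
        refine le_trans ?_ (hfib c' s (mem_filter.mp hs).1 t (mem_filter.mp ht).1 hst)
        gcongr
        exact filter_subset _ _
      · have : S'.image q = (S.image q).erase c := by
          ext y
          simp only [hS', mem_image, mem_filter, mem_erase]
          constructor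
          · rintro ⟨n, ⟨h1, h2⟩, rfl⟩
            exact ⟨h2, n, h1, rfl⟩
          · rintro ⟨h1, n, h2, rfl⟩
            exact ⟨n, ⟨h2, h1⟩, rfl⟩
        rw [this, card_erase_of_mem (max'_mem _ hne), hk]
        rfl
    have hsum : (S.card : ℝ) = F.card + S'.card := by
      rw [← card_filter_add_card_filter_not (s := S) fun n => q n = c]
      push_cast
      rfl
    have hbv : (b : ℝ) ≤ v := by exact_mod_cast (hS b hbF.1).2
    have : α * (b : ℝ) ≤ α * v := by gcongr
    rw [hsum]
    push_cast
    linarith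

/-- Numbers in a short interval divisible by `e * p`, where `p` is nearly decreasing. -/
lemma card_le_of_nearly_antitone {e P Δ u h : ℕ} (he : 0 < e) (hP : 0 < P) (p : ℕ → ℕ)
    (S : Finset ℕ) (hS : ∀ n ∈ S, u ≤ n ∧ n ≤ u + h) (hp : ∀ n ∈ S, P ≤ p n ∧ p n < 2 * P)
    (hdvd : ∀ n ∈ S, e * p n ∣ n) (hΔ : ∀ m ∈ S, ∀ n ∈ S, m < n → p n ≤ p m + Δ) :
    S.card ≤ (Δ + 1) * (h / (e * P) + 1) + P := by
  have heP : 0 < e * P := by positivity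
  set φ : ℕ → ℤ := fun n => ((Δ + 1) * (n / (e * P)) : ℕ) - (p n : ℤ) with hφ
  have hlt : ∀ m ∈ S, ∀ n ∈ S, m < n → φ m ≠ φ n := by
    intro m hm n hn hmn heq
    have h1 := hΔ m hm n hn hmn
    have h2 : m / (e * P) ≤ n / (e * P) := Nat.div_le_div_right hmn.le
    rcases h2.eq_or_lt with h3 | h3
    · simp only [hφ, h3] at heq
      have h4 : p m = p n := by omega
      have h5 : e * p m ∣ n - m := Nat.dvd_sub (h4 ▸ hdvd n hn) (hdvd m hm)
      have h6 := Nat.le_of_dvd (by omega) h5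
      have h7 : e * P ≤ e * p m := Nat.mul_le_mul_left _ (hp m hm).1
      have h8 := Nat.div_add_mod m (e * P)
      have h9 := Nat.div_add_mod n (e * P)
      have h10 := Nat.mod_lt n heP
      rw [h3] at h8
      omega
    · have h4 : (Δ + 1) * (m / (e * P) + 1) ≤ (Δ + 1) * (n / (e * P)) := Nat.mul_le_mul_left _ h3
      rw [mul_add, mul_one] at h4
      simp only [hφ] at heq
      omega
  have hinj : Set.InjOn φ S := by
    intro m hm n hn heq
    rcases lt_trichotomy m n with h1 | h1 | h1
    · exact absurd heq (hlt m hm n hn h1)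
    · exact h1
    · exact absurd heq.symm (hlt n hn m hm h1)
  have hmaps : S.image φ ⊆ Ioc (((Δ + 1) * (u / (e * P)) : ℕ) - 2 * P : ℤ)
      (((Δ + 1) * (u / (e * P) + (h / (e * P) + 1)) : ℕ) - P : ℤ) := by
    intro y hy
    obtain ⟨n, hn, rfl⟩ := mem_image.mp hy
    have h1 := hp n hn
    have h2 : u / (e * P) ≤ n / (e * P) := Nat.div_le_div_right (hS n hn).1
    have h3 : n / (e * P) ≤ u / (e * P) + (h / (e * P) + 1) := by
      have h4 : n / (e * P) ≤ (u + h) / (e * P) := Nat.div_le_div_right (hS n hn).2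
      have h6 : (u + h) / (e * P) < u / (e * P) + h / (e * P) + 2 := by
        rw [Nat.div_lt_iff_lt_mul heP]
        have h8 := Nat.div_add_mod u (e * P)
        have h9 := Nat.div_add_mod h (e * P)
        have h10 := Nat.mod_lt u heP
        have h11 := Nat.mod_lt h heP
        nlinarith
      omega
    have h4 := Nat.mul_le_mul_left (Δ + 1) h2
    have h5 := Nat.mul_le_mul_left (Δ + 1) h3
    rw [mem_Ioc]
    simp only [hφ]
    omega
  rw [← card_image_of_injOn hinj]
  refine (card_le_card hmaps).trans ?_
  rw [Int.card_Ioc, mul_add]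
  omega

end

section

open Finset

lemma sum_inv_Icc_le (N : ℕ) : ∑ m ∈ Icc 1 N, (m : ℝ)⁻¹ ≤ 1 + Real.log N := by
  have := harmonic_le_one_add_log N
  rw [harmonic_eq_sum_Icc] at this
  push_cast at this
  exact this

lemma card_primes_le {y : ℝ} (hy : 1 < y) (S : Finset ℕ) (hS : ∀ p ∈ S, p.Prime ∧ (p : ℝ) ≤ y) :
    (S.card : ℝ) ≤ 5 * y / Real.log y := by
  have hcount : S.card ≤ Nat.primeCounting ⌊y⌋₊ := by
    rw [Nat.primeCounting, Nat.primeCounting', Nat.count_eq_card_filter_range]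
    refine card_le_card fun p hp => ?_
    have := Nat.le_floor (hS p hp).2
    rw [mem_filter, mem_range]
    exact ⟨by omega, (hS p hp).1⟩
  have h0 : 0 < Real.log y := Real.log_pos hy
  have h1 := Chebyshev.pi_le_log4_mul_div hy
  have hlog : Real.log √y = Real.log y / 2 := by rw [Real.log_sqrt (by linarith)]
  have h4 : Real.log 4 ≤ 1.4 := by
    rw [show (4 : ℝ) = 2 ^ 2 by norm_num, Real.log_pow]
    have := Real.log_two_lt_d9
    push_cast
    linarith
  have hs : 0 < √y := Real.sqrt_pos.mpr (by linarith)
  have h5 : Real.log y ≤ 2 * √y := by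
    have := Real.log_le_sub_one_of_pos hs
    linarith
  have h6 : √y ≤ 2 * y / Real.log y := by
    rw [le_div_iff₀ h0]
    calc √y * Real.log y ≤ √y * (2 * √y) := by gcongr
      _ = 2 * y := by rw [mul_left_comm, Real.mul_self_sqrt (by linarith)]
  calc (S.card : ℝ) ≤ _ := by exact_mod_cast hcount
    _ ≤ _ := h1
    _ ≤ 1.4 * y / (Real.log y / 2) + 2 * y / Real.log y := by
        rw [hlog]
        gcongr
    _ = 4.8 * y / Real.log y := by field_simp; norm_num
    _ ≤ 5 * y / Real.log y := by gcongr; norm_num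

/-- The reciprocals of the primes in a short multiplicative block have a small sum. -/
lemma sum_inv_primes_le {r W : ℝ} (hr : 1 < r) (hW : 1 ≤ W) (T : Finset ℕ)
    (hT : ∀ p ∈ T, p.Prime ∧ r ≤ p) (hTW : ∀ p ∈ T, ∀ q ∈ T, (q : ℝ) ≤ W * p) :
    ∑ p ∈ T, (p : ℝ)⁻¹ ≤ 20 * (1 + Real.log W) / Real.log r := by
  have hlr : 0 < Real.log r := Real.log_pos hr
  have hlW : 0 ≤ Real.log W := Real.log_nonneg hW
  rcases T.eq_empty_or_nonempty with rfl | hne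
  · simp only [sum_empty]
    positivity
  set a := T.min' hne
  set b := T.max' hne
  have haT := min'_mem T hne
  have hbT := max'_mem T hne
  have ha0 : a ≠ 0 := (hT a haT).1.ne_zero
  have hb0 : b ≠ 0 := (hT b hbT).1.ne_zero
  have hsub : T ⊆ (Icc (Nat.log 2 a) (Nat.log 2 b)).biUnion
      fun i => T.filter fun p => Nat.log 2 p = i := by
    intro p hp
    simp only [mem_biUnion, mem_filter, mem_Icc]
    exact ⟨_, ⟨Nat.log_mono_right (min'_le _ _ hp), Nat.log_mono_right (le_max' _ _ hp)⟩, hp, rfl⟩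
  have hblock : ∀ i ∈ Icc (Nat.log 2 a) (Nat.log 2 b),
      ∑ p ∈ T.filter (fun p => Nat.log 2 p = i), (p : ℝ)⁻¹ ≤ 10 / Real.log r := by
    intro i hi
    rw [mem_Icc] at hi
    have hr2 : r ≤ (2 : ℝ) ^ (i + 1) := by
      have h1 : a < 2 ^ (i + 1) :=
        (Nat.lt_pow_succ_log_self (by norm_num) a).trans_le (Nat.pow_le_pow_right (by norm_num) (by omega))
      exact (hT a haT).2.trans (by exact_mod_cast h1.le)
    have hbound : ∀ p ∈ T.filter (fun p => Nat.log 2 p = i),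
        (2 : ℝ) ^ i ≤ p ∧ (p : ℝ) ≤ 2 ^ (i + 1) := by
      intro p hp
      rw [mem_filter] at hp
      have hp0 : p ≠ 0 := (hT p hp.1).1.ne_zero
      have h1 := Nat.pow_log_le_self 2 hp0
      have h2 := Nat.lt_pow_succ_log_self (b := 2) (by norm_num) p
      rw [hp.2] at h1 h2
      exact ⟨by exact_mod_cast h1, by exact_mod_cast h2.le⟩
    have hcard := card_primes_le (y := 2 ^ (i + 1)) (by linarith)
      (T.filter fun p => Nat.log 2 p = i)
      fun p hp => ⟨(hT p (mem_filter.mp hp).1).1, (hbound p hp).2⟩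
    calc _ ≤ ∑ p ∈ T.filter (fun p => Nat.log 2 p = i), ((2 : ℝ) ^ i)⁻¹ := by
          refine sum_le_sum fun p hp => ?_
          have := (hbound p hp).1
          gcongr
      _ ≤ (5 * 2 ^ (i + 1) / Real.log (2 ^ (i + 1))) * ((2 : ℝ) ^ i)⁻¹ := by
          rw [sum_const, nsmul_eq_mul]
          gcongr
      _ ≤ (5 * 2 ^ (i + 1) / Real.log r) * ((2 : ℝ) ^ i)⁻¹ := by
          gcongr
      _ = 10 / Real.log r := by
          rw [pow_succ]
          field_simp
          norm_num
  have hnum : ((Icc (Nat.log 2 a) (Nat.log 2 b)).card : ℝ) ≤ 2 * (1 + Real.log W) := by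
    rw [Nat.card_Icc]
    have h1 := Nat.log_mono_right (b := 2) (min'_le _ _ hbT)
    have h1 : Nat.log 2 a ≤ Nat.log 2 b := h1
    have h2 : (2 : ℝ) ^ (Nat.log 2 b) ≤ W * 2 ^ (Nat.log 2 a + 1) := by
      calc (2 : ℝ) ^ (Nat.log 2 b) ≤ b := by exact_mod_cast Nat.pow_log_le_self 2 hb0
        _ ≤ W * a := hTW a haT b hbT
        _ ≤ W * 2 ^ (Nat.log 2 a + 1) := by
          gcongr
          exact_mod_cast (Nat.lt_pow_succ_log_self (b := 2) (by norm_num) a).le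
    have h3 := Real.log_le_log (by positivity) h2
    rw [Real.log_mul (by positivity) (by positivity), Real.log_pow, Real.log_pow] at h3
    push_cast at h3
    have h4 := Real.log_two_gt_d9
    rw [Nat.cast_sub (by omega)]
    push_cast
    have h5 : ((Nat.log 2 b : ℝ) - Nat.log 2 a - 1) * Real.log 2 ≤ Real.log W := by linarith
    by_contra hcon
    push Not at hcon
    nlinarith
  calc ∑ p ∈ T, (p : ℝ)⁻¹ ≤ _ :=
        sum_le_sum_of_subset_of_nonneg hsub fun _ _ _ => by positivity
    _ ≤ _ := sum_biUnion_le_sum _ _ (fun p => (p : ℝ)⁻¹) fun n => by positivity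
    _ ≤ ∑ i ∈ Icc (Nat.log 2 a) (Nat.log 2 b), 10 / Real.log r := sum_le_sum hblock
    _ ≤ 2 * (1 + Real.log W) * (10 / Real.log r) := by
        rw [sum_const, nsmul_eq_mul]
        gcongr
    _ = _ := by ring

lemma card_le_of_square_dvd {N M : ℕ} (hM : 1 ≤ M) (S : Finset ℕ)
    (hS : ∀ n ∈ S, 1 ≤ n ∧ n ≤ N ∧ ∃ m, M ≤ m ∧ m ^ 2 ∣ n) : (S.card : ℝ) ≤ 2 * N / M := by
  have hsub : S ⊆ (Ioo (M - 1) (N + 1)).biUnion fun m => (Ioc 0 N).filter fun n => m ^ 2 ∣ n := by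
    intro n hn
    obtain ⟨h1, h2, m, h3, h4⟩ := hS n hn
    have h5 := Nat.le_of_dvd (by omega) h4
    have h6 : m ≤ m ^ 2 := Nat.le_self_pow two_ne_zero m
    simp only [mem_biUnion, mem_filter, mem_Ioo, mem_Ioc]
    exact ⟨m, by omega, by omega, h4⟩
  have h1 : S.card ≤ ∑ m ∈ Ioo (M - 1) (N + 1), N / m ^ 2 := by
    refine (card_le_card hsub).trans (card_biUnion_le.trans (sum_le_sum fun m _ => ?_))
    rw [Nat.Ioc_filter_dvd_card_eq_div]
  calc (S.card : ℝ) ≤ ∑ m ∈ Ioo (M - 1) (N + 1), ((N / m ^ 2 : ℕ) : ℝ) := by exact_mod_cast h1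
    _ ≤ ∑ m ∈ Ioo (M - 1) (N + 1), N * ((m : ℝ) ^ 2)⁻¹ := by
        refine sum_le_sum fun m _ => ?_
        refine Nat.cast_div_le.trans_eq ?_
        push_cast
        rw [div_eq_mul_inv]
    _ ≤ N * (2 / ((M - 1 : ℕ) + 1 : ℝ)) := by
        rw [← mul_sum]
        gcongr
        exact sum_Ioo_inv_sq_le _ _
    _ = 2 * N / M := by
        rw [Nat.cast_sub hM]
        push_cast
        rw [sub_add_cancel]
        ring

lemma card_le_of_many_divisors {N : ℕ} {T : ℝ} (hT : 0 < T) (S : Finset ℕ)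
    (hS : ∀ n ∈ S, 1 ≤ n ∧ n ≤ N ∧ T ≤ n.divisors.card) :
    (S.card : ℝ) ≤ N * (1 + Real.log N) / T := by
  rw [le_div_iff₀ hT]
  calc (S.card : ℝ) * T = ∑ n ∈ S, T := by rw [sum_const, nsmul_eq_mul]
    _ ≤ ∑ n ∈ S, (n.divisors.card : ℝ) := sum_le_sum fun n hn => (hS n hn).2.2
    _ ≤ ∑ n ∈ Ioc 0 N, (n.divisors.card : ℝ) := by
        refine sum_le_sum_of_subset_of_nonneg (fun n hn => ?_) fun _ _ _ => by positivity
        have := hS n hn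
        exact mem_Ioc.mpr ⟨by omega, this.2.1⟩
    _ = ((∑ n ∈ Ioc 0 N, N / n : ℕ) : ℝ) := by
        rw [← ArithmeticFunction.sum_Ioc_sigma0_eq_sum_div]
        push_cast
        refine sum_congr rfl fun n _ => ?_
        rw [ArithmeticFunction.sigma_zero_apply]
    _ ≤ ∑ n ∈ Icc 1 N, N * (n : ℝ)⁻¹ := by
        push_cast
        refine sum_le_sum fun m _ => ?_
        exact Nat.cast_div_le.trans_eq (div_eq_mul_inv _ _)
    _ ≤ N * (1 + Real.log N) := by
        rw [← mul_sum]
        gcongr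
        exact sum_inv_Icc_le N

end

section

open Finset

lemma cast_sigma_eq {n : ℕ} (hn : n ≠ 0) :
    (ArithmeticFunction.sigma 1 n : ℝ) = n * (abund n : ℝ) := by
  rw [abund]
  push_cast
  field_simp

lemma one_le_abund {n : ℕ} (hn : n ≠ 0) : (1 : ℝ) ≤ (abund n : ℝ) := by
  have h1 : n ≤ ArithmeticFunction.sigma 1 n := by
    rw [ArithmeticFunction.sigma_one_apply]
    exact single_le_sum (f := fun i => i) (fun _ _ => Nat.zero_le _) (Nat.mem_divisors_self n hn)
  have h2 : (0 : ℝ) < n := by exact_mod_cast Nat.pos_of_ne_zero hn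
  rw [abund]
  push_cast
  rw [le_div_iff₀ h2, one_mul]
  exact_mod_cast h1

lemma abund_prime {p : ℕ} (hp : p.Prime) : (abund p : ℝ) = 1 + 1 / (p : ℝ) := by
  have : (p : ℝ) ≠ 0 := by exact_mod_cast hp.ne_zero
  have h := ArithmeticFunction.sigma_one_apply_prime_pow (i := 1) hp
  rw [pow_one] at h
  rw [abund, h]
  simp [sum_range_succ]
  field_simp
  ring

/-- `n = e * p * s` is a factorization into coprime parts, where `p` is a prime exceeding `z` and
`s` is a number much larger than `p` whose abundancy index is very close to one. -/
def IsGapFactorization (z G : ℝ) (n e p s : ℕ) : Prop :=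
  n = e * p * s ∧ p.Prime ∧ z ≤ p ∧ e.Coprime (p * s) ∧ p.Coprime s ∧ p * G < s ∧
    (abund s : ℝ) ≤ 1 + 4 / (p * G)

lemma IsGapFactorization.abund_eq {z G : ℝ} {n e p s : ℕ} (h : IsGapFactorization z G n e p s) :
    (abund n : ℝ) = abund e * ((1 + 1 / (p : ℝ)) * abund s) := by
  obtain ⟨rfl, hp, -, h1, h2, -⟩ := h
  rw [mul_assoc, abund_mul h1, abund_mul h2, ← abund_prime hp]
  push_cast
  rfl

/-- Two gap factorizations in a short window with equal first parts have close primes. -/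
lemma prime_le_of_gap {z G L : ℝ} {n n' e p p' s s' P : ℕ} (hP : 0 < P) (hn0 : n ≠ 0)
    (hL : 1 ≤ L) (hG : 4 * L ≤ G) (h : IsGapFactorization z G n e p s)
    (h' : IsGapFactorization z G n' e p' s') (hp : P ≤ p ∧ p < 2 * P) (hp' : P ≤ p' ∧ p' < 2 * P)
    (hnn : (n' : ℝ) ≤ n + n / (P * L)) (hn' : n' ≠ 0)
    (hσ : ArithmeticFunction.sigma 1 n ≤ ArithmeticFunction.sigma 1 n') :
    (p' : ℝ) ≤ p + 24 * P / L := by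
  have hP' : (1 : ℝ) ≤ P := by exact_mod_cast hP
  have hPp : (P : ℝ) ≤ p := by exact_mod_cast hp.1
  have hPp' : (P : ℝ) ≤ p' := by exact_mod_cast hp'.1
  have hpP : (p : ℝ) ≤ 2 * P := by exact_mod_cast hp.2.le
  have hpP' : (p' : ℝ) ≤ 2 * P := by exact_mod_cast hp'.2.le
  have hp0 : (0 : ℝ) < p := by linarith
  have hp0' : (0 : ℝ) < p' := by linarith
  have hG0 : 0 < G := by linarith
  have hnpos : (0 : ℝ) < n := by exact_mod_cast Nat.pos_of_ne_zero hn0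
  have he0 : e ≠ 0 := by
    rintro rfl
    exact hn0 (by simpa using h.1)
  have hs0 : s ≠ 0 := by
    rintro rfl
    exact hn0 (by simpa using h.1)
  have hσ' : (ArithmeticFunction.sigma 1 n : ℝ) ≤ ArithmeticFunction.sigma 1 n' := by
    exact_mod_cast hσ
  rw [cast_sigma_eq hn0, cast_sigma_eq hn', h.abund_eq, h'.abund_eq] at hσ'
  have he := one_le_abund he0
  have hs := one_le_abund hs0
  have hs' := h'.2.2.2.2.2.2
  set ε : ℝ := 1 / (P * L) with hε
  have hε0 : 0 < ε := by positivity
  have hε1 : ε ≤ 1 := by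
    rw [hε, div_le_one (by positivity)]
    nlinarith
  have hs'' : (abund s' : ℝ) ≤ 1 + ε := by
    refine hs'.trans ?_
    have : 4 / ((p' : ℝ) * G) ≤ ε := by
      rw [hε, div_le_div_iff₀ (by positivity) (by positivity)]
      nlinarith [mul_le_mul hPp' hG (by positivity) (by positivity)]
    linarith
  have hn'' : (n' : ℝ) ≤ n * (1 + ε) := by
    rw [hε, mul_add, mul_one, mul_one_div]
    exact hnn
  have h1 : (n : ℝ) * (abund e * (1 + 1 / (p : ℝ))) ≤
      n * (1 + ε) * (abund e * ((1 + 1 / (p' : ℝ)) * (1 + ε))) := by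
    calc (n : ℝ) * (abund e * (1 + 1 / (p : ℝ))) = n * (abund e * ((1 + 1 / (p : ℝ)) * 1)) := by ring
      _ ≤ n * (abund e * ((1 + 1 / (p : ℝ)) * abund s)) := by gcongr
      _ ≤ _ := hσ'
      _ ≤ n' * (abund e * ((1 + 1 / (p' : ℝ)) * (1 + ε))) := by gcongr
      _ ≤ _ := by gcongr
  have h2 : 1 + 1 / (p : ℝ) ≤ (1 + ε) * (1 + 1 / (p' : ℝ)) * (1 + ε) := by
    have h3 : (0 : ℝ) < n * abund e := by positivity
    refine le_of_mul_le_mul_left ?_ h3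
    linarith
  have h4 : 1 / (p' : ℝ) ≤ 1 := by
    rw [div_le_one hp0']
    linarith
  have h5 : 1 / (p : ℝ) ≤ 1 / (p' : ℝ) + 6 * ε := by
    have h6 : 0 < 1 / (p' : ℝ) := by positivity
    nlinarith [mul_le_mul hε1 h4 h6.le zero_le_one, mul_nonneg hε0.le (sub_nonneg.mpr hε1),
      mul_nonneg hε0.le (sub_nonneg.mpr h4), mul_nonneg (mul_nonneg hε0.le hε0.le) (sub_nonneg.mpr h4)]
  have h7 : (p' : ℝ) ≤ p + 6 * ε * (p * p') := by
    have := mul_le_mul_of_nonneg_right h5 (by positivity : 0 ≤ (p : ℝ) * p')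
    have e1 : 1 / (p : ℝ) * (p * p') = p' := by field_simp
    have e2 : (1 / (p' : ℝ) + 6 * ε) * (p * p') = p + 6 * ε * (p * p') := by field_simp
    linarith
  have h8 : (p : ℝ) * p' ≤ 2 * P * (2 * P) := by gcongr
  calc (p' : ℝ) ≤ p + 6 * ε * (2 * P * (2 * P)) := h7.trans (by gcongr)
    _ = p + 24 * P / L := by
      rw [hε]
      field_simp
      ring

/-- Numbers with a gap factorization whose first part is `e` and whose prime is in `[P, 2P)`. -/
lemma card_le_of_gap_block {x z G L K : ℝ} {e P : ℕ} (hx : 0 < x) (hP : 0 < P)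
    (hL : 1 ≤ L) (hG : 4 * L ≤ G) (hK : 1 ≤ K) (hz : L ≤ z) (S : Finset ℕ)
    (hS : ∀ n ∈ S, x / K < n ∧ (n : ℝ) ≤ x)
    (hgap : ∀ n ∈ S, ∃ p s, IsGapFactorization z G n e p s ∧ P ≤ p ∧ p < 2 * P)
    (hmono : ∀ m ∈ S, ∀ n ∈ S, m ≤ n →
      ArithmeticFunction.sigma 1 m ≤ ArithmeticFunction.sigma 1 n) :
    (S.card : ℝ) ≤ (52 / L + 54 * L * K / G) * x * (e : ℝ)⁻¹ := by
  rcases S.eq_empty_or_nonempty with rfl | ⟨n₀, hn₀⟩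
  · simp only [card_empty, Nat.cast_zero]
    have : 0 ≤ G := by linarith
    positivity
  have hpos : ∀ n ∈ S, n ≠ 0 := by
    intro n hn
    have : (0 : ℝ) < n := (by positivity : 0 < x / K).trans (hS n hn).1
    exact_mod_cast this.ne'
  have he : 0 < e := by
    obtain ⟨p, s, h, -⟩ := hgap n₀ hn₀
    refine Nat.pos_of_ne_zero ?_
    rintro rfl
    exact hpos n₀ hn₀ (by simpa using h.1)
  have hPR : (1 : ℝ) ≤ P := by exact_mod_cast hP
  have heR : (1 : ℝ) ≤ e := by exact_mod_cast he
  have hG0 : 0 < G := by linarith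
  have hP2 : (P : ℝ) ^ 2 ≤ x / (e * G) := by
    obtain ⟨p, s, h, hp1, hp2⟩ := hgap n₀ hn₀
    rw [le_div_iff₀ (by positivity)]
    have h1 : (P : ℝ) ≤ p := by exact_mod_cast hp1
    calc (P : ℝ) ^ 2 * (e * G) = e * P * (P * G) := by ring
      _ ≤ e * p * (p * G) := by gcongr
      _ ≤ e * p * s := by
        gcongr
        exact h.2.2.2.2.2.1.le
      _ = n₀ := by rw [h.1]; push_cast; ring
      _ ≤ x := (hS n₀ hn₀).2
  have hLP : L ≤ 2 * P := by
    obtain ⟨p, s, h, hp1, hp2⟩ := hgap n₀ hn₀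
    have h1 : (p : ℝ) ≤ 2 * P := by exact_mod_cast hp2.le
    linarith [h.2.2.1]
  choose! p s hps using hgap
  set h : ℕ := ⌊x / (P * L * K)⌋₊ with hh
  have hhle : (h : ℝ) ≤ x / (P * L * K) := Nat.floor_le (by positivity)
  have hhlt : x / (P * L * K) < h + 1 := Nat.lt_floor_add_one _
  set Δ : ℕ := ⌊24 * P / L⌋₊ with hΔ
  have hΔle : (Δ : ℝ) ≤ 24 * P / L := Nat.floor_le (by positivity)
  set J : ℕ := ⌊P * L * K⌋₊ with hJ
  have hJle : (J : ℝ) ≤ P * L * K := Nat.floor_le (by positivity)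
  have hwin : S.card ≤ ((Δ + 1) * (h / (e * P) + 1) + P) * (range (J + 1)).card := by
    refine card_le_mul_card_image_of_maps_to (f := fun n => n / (h + 1)) ?_ _ ?_
    · intro n hn
      rw [mem_range, Nat.lt_succ_iff, hJ]
      refine Nat.le_floor (Nat.cast_div_le.trans ?_)
      rw [div_le_iff₀ (by positivity)]
      push_cast
      have := mul_lt_mul_of_pos_left hhlt (by positivity : 0 < P * L * K)
      rw [mul_div_cancel₀ _ (by positivity)] at this
      linarith [(hS n hn).2]
    · intro j _
      refine card_le_of_nearly_antitone he hP p (u := j * (h + 1)) _ ?_ ?_ ?_ ?_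
      · intro n hn
        rw [mem_filter] at hn
        have h1 := Nat.div_add_mod n (h + 1)
        have h2 := Nat.mod_lt n (Nat.add_pos_right h one_pos)
        rw [hn.2, mul_comm] at h1
        omega
      · exact fun n hn => (hps n (mem_filter.mp hn).1).2
      · intro n hn
        exact Dvd.intro _ (hps n (mem_filter.mp hn).1).1.1.symm
      · intro m hm n hn hmn
        rw [mem_filter] at hm hn
        have h3 : (p n : ℝ) ≤ p m + 24 * P / L := by
          refine prime_le_of_gap hP (hpos m hm.1) hL hG (hps m hm.1).1 (hps n hn.1).1
            (hps m hm.1).2 (hps n hn.1).2 ?_ (hpos n hn.1) (hmono m hm.1 n hn.1 hmn.le)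
          have h1 := Nat.div_add_mod n (h + 1)
          have h2 := Nat.mod_lt n (Nat.add_pos_right h one_pos)
          have h1' := Nat.div_add_mod m (h + 1)
          have h4 : n ≤ m + h := by
            rw [hn.2] at h1
            rw [hm.2] at h1'
            omega
          have h5 : (n : ℝ) ≤ m + h := by exact_mod_cast h4
          have h6 : x / (P * L * K) ≤ m / (P * L) := by
            rw [div_le_div_iff₀ (by positivity) (by positivity)]
            have := (hS m hm.1).1.le
            rw [div_le_iff₀ (by positivity)] at this
            calc x * (P * L) ≤ m * K * (P * L) := by gcongr
              _ = m * (P * L * K) := by ring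
          linarith
        have h4 : p n - p m ≤ Δ := by
          refine Nat.le_floor ?_
          rcases le_total (p n) (p m) with h5 | h5
          · rw [Nat.sub_eq_zero_of_le h5, Nat.cast_zero]
            positivity
          · rw [Nat.cast_sub h5]
            linarith
        omega
  rw [card_range] at hwin
  have hwinR : (S.card : ℝ) ≤ ((Δ + 1) * (((h / (e * P) : ℕ) : ℝ) + 1) + P) * (J + 1) := by
    exact_mod_cast hwin
  have hΔ1 : (Δ : ℝ) + 1 ≤ 26 * P / L := by
    have : 1 ≤ 2 * P / L := by rwa [le_div_iff₀ (by positivity), one_mul]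
    have e1 : 26 * P / L = 24 * P / L + 2 * P / L := by ring
    linarith
  have hJ1 : (J : ℝ) + 1 ≤ 2 * (P * L * K) := by
    have : 1 ≤ P * L * K := by
      have := mul_le_mul hPR hL (by norm_num) (by positivity)
      nlinarith
    linarith
  have hdiv : ((h / (e * P) : ℕ) : ℝ) ≤ x / (P * L * K) / (e * P) := by
    refine Nat.cast_div_le.trans ?_
    push_cast
    gcongr
  calc (S.card : ℝ) ≤ _ := hwinR
    _ ≤ (26 * P / L * (x / (P * L * K) / (e * P) + 1) + P) * (2 * (P * L * K)) := by gcongr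
    _ = 52 / L * x * (e : ℝ)⁻¹ + (52 * K + 2 * L * K) * P ^ 2 := by
      field_simp
      ring
    _ ≤ 52 / L * x * (e : ℝ)⁻¹ + (52 * (L * K) + 2 * L * K) * (x / (e * G)) := by
      gcongr
      nlinarith
    _ = _ := by
      field_simp
      ring

/-- Monotone sets contain few numbers with a gap factorization. -/
lemma card_le_of_gap {x z G L K : ℝ} (hx : 3 ≤ x)
    (hL : 1 ≤ L) (hG : 4 * L ≤ G) (hK : 1 ≤ K) (hz : L ≤ z) (S : Finset ℕ)
    (hS : ∀ n ∈ S, x / K < n ∧ (n : ℝ) ≤ x)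
    (hgap : ∀ n ∈ S, ∃ e p s, IsGapFactorization z G n e p s)
    (hmono : ∀ m ∈ S, ∀ n ∈ S, m ≤ n →
      ArithmeticFunction.sigma 1 m ≤ ArithmeticFunction.sigma 1 n) :
    (S.card : ℝ) ≤ (52 / L + 54 * L * K / G) * x * (2 * Real.log x * (3 * Real.log x)) := by
  classical
  have hG0 : 0 < G := by linarith
  set N := ⌊x⌋₊ with hN
  have hNx : (N : ℝ) ≤ x := Nat.floor_le (by linarith)
  have hN3 : 3 ≤ N := Nat.le_floor (by exact_mod_cast hx)
  have hlogx := one_le_log_of_three_le hx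
  have hlogN : Real.log N ≤ Real.log x := Real.log_le_log (by positivity) hNx
  have hsub : S ⊆ (Icc 1 N).biUnion fun e => (range (Nat.log 2 N + 1)).biUnion fun i =>
      S.filter fun n => ∃ p s, IsGapFactorization z G n e p s ∧ 2 ^ i ≤ p ∧ p < 2 * 2 ^ i := by
    intro n hn
    obtain ⟨e, p, s, h⟩ := hgap n hn
    have hn0 : n ≠ 0 := by
      have : (0 : ℝ) < n := (by positivity : 0 < x / K).trans (hS n hn).1
      exact_mod_cast this.ne'
    have hnN : n ≤ N := Nat.le_floor (hS n hn).2
    have hen : e ∣ n := ⟨p * s, by rw [h.1]; ring⟩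
    have hpn : p ∣ n := ⟨e * s, by rw [h.1]; ring⟩
    have h1 := Nat.le_of_dvd (by omega) hen
    have h2 := Nat.le_of_dvd (by omega) hpn
    have h3 := Nat.pos_of_dvd_of_pos hen (by omega)
    simp only [mem_biUnion, mem_filter, mem_Icc, mem_range]
    refine ⟨e, ⟨h3, by omega⟩, Nat.log 2 p, ?_, hn, p, s, h, Nat.pow_log_le_self 2 h.2.1.ne_zero, ?_⟩
    · exact Nat.lt_succ_of_le (Nat.log_mono_right (by omega))
    · have := Nat.lt_pow_succ_log_self (b := 2) (by norm_num) p
      rwa [pow_succ, mul_comm] at this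
  have h1 : S.card ≤ ∑ e ∈ Icc 1 N, ∑ i ∈ range (Nat.log 2 N + 1), (S.filter fun n =>
      ∃ p s, IsGapFactorization z G n e p s ∧ 2 ^ i ≤ p ∧ p < 2 * 2 ^ i).card :=
    (card_le_card hsub).trans (card_biUnion_le.trans (sum_le_sum fun e _ => card_biUnion_le))
  have hcount : ((Nat.log 2 N : ℕ) : ℝ) + 1 ≤ 3 * Real.log x := by
    have h2 : (2 : ℝ) ^ (Nat.log 2 N) ≤ N := by
      exact_mod_cast Nat.pow_log_le_self 2 (by omega : N ≠ 0)
    have h3 := Real.log_le_log (by positivity) h2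
    rw [Real.log_pow] at h3
    have := Real.log_two_gt_d9
    nlinarith
  calc (S.card : ℝ) ≤ ∑ e ∈ Icc 1 N, ∑ i ∈ range (Nat.log 2 N + 1), ((S.filter fun n =>
      ∃ p s, IsGapFactorization z G n e p s ∧ 2 ^ i ≤ p ∧ p < 2 * 2 ^ i).card : ℝ) := by
        exact_mod_cast h1
    _ ≤ ∑ e ∈ Icc 1 N, ∑ i ∈ range (Nat.log 2 N + 1),
        (52 / L + 54 * L * K / G) * x * (e : ℝ)⁻¹ := by
      refine sum_le_sum fun e _ => sum_le_sum fun i _ => ?_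
      refine card_le_of_gap_block (by linarith) (by positivity) hL hG hK hz _
        (fun n hn => hS n (mem_filter.mp hn).1) (fun n hn => (mem_filter.mp hn).2)
        fun m hm n hn => hmono m (mem_filter.mp hm).1 n (mem_filter.mp hn).1
    _ = (52 / L + 54 * L * K / G) * x * ((∑ e ∈ Icc 1 N, (e : ℝ)⁻¹) * (Nat.log 2 N + 1)) := by
      simp only [sum_const, card_range, nsmul_eq_mul]
      rw [← mul_sum, ← mul_sum]
      push_cast
      ring
    _ ≤ _ := by
      have := sum_inv_Icc_le N
      gcongr
      linarith

end

section

open Finset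

lemma card_primes_mul_le {x R : ℝ} {k : ℕ} (hx : 0 < x) (hk : 0 < k) (hR : 1 < R) (N : ℕ) :
    (((Icc 1 N).filter fun p : ℕ => p.Prime ∧ R ≤ p ∧ (k * p : ℝ) ≤ x).card : ℝ) ≤
      5 * x / Real.log R * (k : ℝ)⁻¹ := by
  have hlR : 0 < Real.log R := Real.log_pos hR
  have hk' : (0 : ℝ) < k := by exact_mod_cast hk
  set V := (Icc 1 N).filter fun p : ℕ => p.Prime ∧ R ≤ p ∧ (k * p : ℝ) ≤ x with hV
  rcases V.eq_empty_or_nonempty with h | ⟨p, hp⟩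
  · rw [h, card_empty, Nat.cast_zero]
    positivity
  have hmem : ∀ p ∈ V, p.Prime ∧ R ≤ p ∧ (p : ℝ) ≤ x / k := by
    intro p hp
    obtain ⟨-, h1, h2, h3⟩ := mem_filter.mp hp
    refine ⟨h1, h2, ?_⟩
    rw [le_div_iff₀ hk', mul_comm]
    exact h3
  have hy : R ≤ x / k := (hmem p hp).2.1.trans (hmem p hp).2.2
  calc (V.card : ℝ) ≤ 5 * (x / k) / Real.log (x / k) :=
        card_primes_le (by linarith) V fun p hp => ⟨(hmem p hp).1, (hmem p hp).2.2⟩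
    _ ≤ 5 * (x / k) / Real.log R := by
        have := Real.log_le_log (by linarith) hy
        gcongr
    _ = _ := by field_simp

lemma card_le_of_two_primes {x G K R Y : ℝ} (hx : 1 ≤ x) (hG : 1 ≤ G) (hK : 1 ≤ K)
    (hR : G < R) (hY : 1 ≤ Y) (S : Finset ℕ)
    (hS : ∀ n ∈ S, x / K < n ∧ (n : ℝ) ≤ x ∧ ∃ m p₁ p₂ : ℕ, n = m * p₁ * p₂ ∧ (m : ℝ) ≤ Y ∧
      p₁.Prime ∧ p₂.Prime ∧ R ≤ p₁ ∧ p₂ ≤ p₁ ∧ (p₁ : ℝ) ≤ G * p₂) :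
    (S.card : ℝ) ≤ 5 * x / Real.log R * (20 * (1 + Real.log (K * G)) / Real.log (R / G)) *
      (1 + Real.log Y) := by
  classical
  have hG0 : 0 < G := by linarith
  have hr : 1 < R / G := by rwa [one_lt_div hG0]
  have hlR : 0 < Real.log R := Real.log_pos (by linarith)
  have hlr : 0 < Real.log (R / G) := Real.log_pos hr
  have hlW : 0 ≤ Real.log (K * G) := Real.log_nonneg (by nlinarith)
  set N := ⌊x⌋₊ with hN
  set T : ℕ → Finset ℕ := fun m => (Icc 1 N).filter fun p : ℕ => p.Prime ∧ R / G ≤ p ∧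
    m * (p : ℝ) ^ 2 ≤ x ∧ x < K * G * m * p ^ 2 with hT
  set V : ℕ → Finset ℕ := fun k => (Icc 1 N).filter fun p : ℕ => p.Prime ∧ R ≤ p ∧ (k * p : ℝ) ≤ x
    with hV
  have hsub : S ⊆ (Icc 1 ⌊Y⌋₊).biUnion fun m => (T m).biUnion fun p₂ =>
      (V (m * p₂)).image fun p₁ => m * p₁ * p₂ := by
    intro n hn
    obtain ⟨h1, h2, m, p₁, p₂, h3, h4, h5, h6, h7, h8, h9⟩ := hS n hn
    have hnpos : (0 : ℝ) < n := (by positivity : 0 < x / K).trans h1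
    have hn0 : n ≠ 0 := by exact_mod_cast hnpos.ne'
    have hnN : n ≤ N := Nat.le_floor h2
    have hm0 : m ≠ 0 := by rintro rfl; exact hn0 (by simpa using h3)
    have hp1N : p₁ ≤ N := (Nat.le_of_dvd (by omega) ⟨m * p₂, by rw [h3]; ring⟩ : p₁ ≤ n).trans hnN
    have hp2N : p₂ ≤ N := h8.trans hp1N
    have h3' : (n : ℝ) = m * p₁ * p₂ := by rw [h3]; push_cast; ring
    have h8' : (p₂ : ℝ) ≤ p₁ := by exact_mod_cast h8
    simp only [mem_biUnion, mem_image, hT, hV, mem_filter, mem_Icc]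
    refine ⟨m, ⟨by omega, Nat.le_floor h4⟩, p₂, ⟨⟨h6.pos, hp2N⟩, h6, ?_, ?_, ?_⟩, p₁,
      ⟨⟨h5.pos, hp1N⟩, h5, h7, ?_⟩, h3.symm⟩
    · rw [div_le_iff₀ hG0]
      linarith
    · calc (m : ℝ) * p₂ ^ 2 = m * p₂ * p₂ := by ring
        _ ≤ m * p₁ * p₂ := by gcongr
        _ ≤ x := by rw [← h3']; exact h2
    · rw [div_lt_iff₀ (by linarith)] at h1
      calc x < n * K := h1
        _ = m * p₁ * p₂ * K := by rw [h3']
        _ ≤ m * (G * p₂) * p₂ * K := by gcongr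
        _ = K * G * m * p₂ ^ 2 := by ring
    · push_cast
      linarith
  have hcard : S.card ≤ ∑ m ∈ Icc 1 ⌊Y⌋₊, ∑ p₂ ∈ T m, (V (m * p₂)).card :=
    (card_le_card hsub).trans (card_biUnion_le.trans (sum_le_sum fun m _ =>
      card_biUnion_le.trans (sum_le_sum fun p₂ _ => card_image_le)))
  calc (S.card : ℝ) ≤ ∑ m ∈ Icc 1 ⌊Y⌋₊, ∑ p₂ ∈ T m, ((V (m * p₂)).card : ℝ) := by
        exact_mod_cast hcard
    _ ≤ ∑ m ∈ Icc 1 ⌊Y⌋₊, ∑ p₂ ∈ T m, 5 * x / Real.log R * (m : ℝ)⁻¹ * (p₂ : ℝ)⁻¹ := by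
        refine sum_le_sum fun m hm => sum_le_sum fun p₂ hp => ?_
        have h1 := (mem_filter.mp hp).2.1.pos
        have h2 := (mem_Icc.mp hm).1
        refine (card_primes_mul_le (by linarith) (by positivity) (by linarith) N).trans_eq ?_
        push_cast
        rw [mul_inv, mul_assoc]
    _ ≤ ∑ m ∈ Icc 1 ⌊Y⌋₊, 5 * x / Real.log R * (m : ℝ)⁻¹ *
        (20 * (1 + Real.log (K * G)) / Real.log (R / G)) := by
        refine sum_le_sum fun m hm => ?_
        rw [← mul_sum]
        gcongr
        refine sum_inv_primes_le hr (by nlinarith) _ (fun p hp => ?_) fun p hp q hq => ?_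
        · have := (mem_filter.mp hp).2
          exact ⟨this.1, this.2.1⟩
        · obtain ⟨-, -, -, -, h1⟩ := mem_filter.mp hp
          obtain ⟨-, -, -, h2, -⟩ := mem_filter.mp hq
          have hm0 : (0 : ℝ) < m := by exact_mod_cast (mem_Icc.mp hm).1
          have h3 : (m : ℝ) * q ^ 2 ≤ m * (K * G * p) ^ 2 := by
            calc (m : ℝ) * q ^ 2 ≤ K * G * m * p ^ 2 := (h2.trans_lt h1).le
              _ ≤ (K * G) ^ 2 * (m * p ^ 2) := by
                rw [mul_assoc (K * G)]
                gcongr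
                exact le_self_pow₀ (by nlinarith) two_ne_zero
              _ = _ := by ring
          exact le_of_pow_le_pow_left₀ two_ne_zero (by positivity) (le_of_mul_le_mul_left h3 hm0)
    _ = 5 * x / Real.log R * (20 * (1 + Real.log (K * G)) / Real.log (R / G)) *
        ∑ m ∈ Icc 1 ⌊Y⌋₊, (m : ℝ)⁻¹ := by
        rw [mul_sum]
        exact sum_congr rfl fun m _ => by ring
    _ ≤ _ := by
        gcongr
        refine (sum_inv_Icc_le _).trans ?_
        gcongr
        · exact_mod_cast Nat.floor_pos.mpr hY
        · exact Nat.floor_le (by linarith)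

lemma card_le_of_three_primes {x G K R : ℝ} (hx : 1 ≤ x) (hG : 1 ≤ G) (hK : 1 ≤ K)
    (hR : G ^ 2 < R) (S : Finset ℕ)
    (hS : ∀ n ∈ S, x / K < n ∧ (n : ℝ) ≤ x ∧ ∃ m p₁ p₂ p₃ : ℕ, n = m * p₁ * p₂ * p₃ ∧
      p₁.Prime ∧ p₂.Prime ∧ p₃.Prime ∧ R ≤ p₁ ∧ p₂ ≤ p₁ ∧ (p₁ : ℝ) ≤ G * p₂ ∧ p₃ ≤ p₂ ∧
      (p₂ : ℝ) ≤ G * p₃) :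
    (S.card : ℝ) ≤ 5 * x / Real.log R * (20 * (1 + Real.log (K * G ^ 2)) / Real.log (R / G ^ 2)) *
      (20 * (1 + Real.log G) / Real.log (R / G ^ 2)) * (1 + Real.log x) := by
  classical
  have hG0 : 0 < G := by linarith
  have hr : 1 < R / G ^ 2 := by rwa [one_lt_div (by positivity)]
  have hG1 : G ≤ G ^ 2 := le_self_pow₀ hG two_ne_zero
  have hW : 1 ≤ K * G ^ 2 := by nlinarith
  have hlR : 0 < Real.log R := Real.log_pos (by linarith)
  have hlr : 0 < Real.log (R / G ^ 2) := Real.log_pos hr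
  have hlW : 0 ≤ Real.log (K * G ^ 2) := Real.log_nonneg hW
  have hlG : 0 ≤ Real.log G := Real.log_nonneg hG
  set N := ⌊x⌋₊ with hN
  set T : ℕ → Finset ℕ := fun m => (Icc 1 N).filter fun p : ℕ => p.Prime ∧ R / G ^ 2 ≤ p ∧
    m * (p : ℝ) ^ 3 ≤ x * G ∧ x < K * G * m * p ^ 3 with hT
  set U : ℕ → Finset ℕ := fun p => (Icc 1 N).filter fun q : ℕ => q.Prime ∧ R / G ^ 2 ≤ q ∧
    q ≤ p ∧ (p : ℝ) ≤ G * q with hU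
  set V : ℕ → Finset ℕ := fun k => (Icc 1 N).filter fun p : ℕ => p.Prime ∧ R ≤ p ∧ (k * p : ℝ) ≤ x
    with hV
  have hsub : S ⊆ (Icc 1 N).biUnion fun m => (T m).biUnion fun p₂ => (U p₂).biUnion fun p₃ =>
      (V (m * p₂ * p₃)).image fun p₁ => m * p₁ * p₂ * p₃ := by
    intro n hn
    obtain ⟨h1, h2, m, p₁, p₂, p₃, h3, h4, h5, h6, h7, h8, h9, h10, h11⟩ := hS n hn
    have hnpos : (0 : ℝ) < n := (by positivity : 0 < x / K).trans h1
    have hn0 : n ≠ 0 := by exact_mod_cast hnpos.ne'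
    have hnN : n ≤ N := Nat.le_floor h2
    have hm0 : m ≠ 0 := by rintro rfl; exact hn0 (by simpa using h3)
    have hmN : m ≤ N := (Nat.le_of_dvd (by omega) ⟨p₁ * p₂ * p₃, by rw [h3]; ring⟩ : m ≤ n).trans hnN
    have hp1N : p₁ ≤ N :=
      (Nat.le_of_dvd (by omega) ⟨m * p₂ * p₃, by rw [h3]; ring⟩ : p₁ ≤ n).trans hnN
    have h3' : (n : ℝ) = m * p₁ * p₂ * p₃ := by rw [h3]; push_cast; ring
    have h8' : (p₂ : ℝ) ≤ p₁ := by exact_mod_cast h8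
    have h10' : (p₃ : ℝ) ≤ p₂ := by exact_mod_cast h10
    have hrp : R / G ^ 2 ≤ p₃ := by
      rw [div_le_iff₀ (by positivity)]
      nlinarith
    simp only [mem_biUnion, mem_image, hT, hU, hV, mem_filter, mem_Icc]
    refine ⟨m, ⟨by omega, hmN⟩, p₂, ⟨⟨h5.pos, by omega⟩, h5, hrp.trans h10', ?_, ?_⟩,
      p₃, ⟨⟨h6.pos, by omega⟩, h6, hrp, h10, h11⟩, p₁, ⟨⟨h4.pos, hp1N⟩, h4, h7, ?_⟩, h3.symm⟩
    · calc (m : ℝ) * p₂ ^ 3 = m * p₂ * p₂ * p₂ := by ring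
        _ ≤ m * p₁ * p₂ * (G * p₃) := by gcongr
        _ = n * G := by rw [h3']; ring
        _ ≤ x * G := by gcongr
    · rw [div_lt_iff₀ (by linarith)] at h1
      calc x < n * K := h1
        _ = m * p₁ * p₂ * p₃ * K := by rw [h3']
        _ ≤ m * (G * p₂) * p₂ * p₂ * K := by gcongr
        _ = K * G * m * p₂ ^ 3 := by ring
    · push_cast
      linarith
  have hcard : S.card ≤ ∑ m ∈ Icc 1 N, ∑ p₂ ∈ T m, ∑ p₃ ∈ U p₂, (V (m * p₂ * p₃)).card :=
    (card_le_card hsub).trans (card_biUnion_le.trans (sum_le_sum fun m _ =>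
      card_biUnion_le.trans (sum_le_sum fun p₂ _ =>
        card_biUnion_le.trans (sum_le_sum fun p₃ _ => card_image_le))))
  calc (S.card : ℝ) ≤ ∑ m ∈ Icc 1 N, ∑ p₂ ∈ T m, ∑ p₃ ∈ U p₂, ((V (m * p₂ * p₃)).card : ℝ) := by
        exact_mod_cast hcard
    _ ≤ ∑ m ∈ Icc 1 N, ∑ p₂ ∈ T m, ∑ p₃ ∈ U p₂,
        5 * x / Real.log R * (m : ℝ)⁻¹ * (p₂ : ℝ)⁻¹ * (p₃ : ℝ)⁻¹ := by
        refine sum_le_sum fun m hm => sum_le_sum fun p₂ hp => sum_le_sum fun p₃ hp3 => ?_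
        have h1 := (mem_filter.mp hp).2.1.pos
        have h3 := (mem_filter.mp hp3).2.1.pos
        have h2 := (mem_Icc.mp hm).1
        refine (card_primes_mul_le (by linarith) (by positivity) (by linarith) N).trans_eq ?_
        push_cast
        rw [mul_inv, mul_inv]
        ring
    _ ≤ ∑ m ∈ Icc 1 N, ∑ p₂ ∈ T m, 5 * x / Real.log R * (m : ℝ)⁻¹ * (p₂ : ℝ)⁻¹ *
        (20 * (1 + Real.log G) / Real.log (R / G ^ 2)) := by
        refine sum_le_sum fun m hm => sum_le_sum fun p₂ hp => ?_
        rw [← mul_sum]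
        gcongr
        refine sum_inv_primes_le hr hG _ (fun p hp => ?_) fun p hp q hq => ?_
        · have := (mem_filter.mp hp).2
          exact ⟨this.1, this.2.1⟩
        · obtain ⟨-, -, -, -, h1⟩ := mem_filter.mp hp
          obtain ⟨-, -, -, h2, -⟩ := mem_filter.mp hq
          exact (by exact_mod_cast h2 : (q : ℝ) ≤ p₂).trans h1
    _ = ∑ m ∈ Icc 1 N, 5 * x / Real.log R * (m : ℝ)⁻¹ *
        (20 * (1 + Real.log G) / Real.log (R / G ^ 2)) * ∑ p₂ ∈ T m, (p₂ : ℝ)⁻¹ := by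
        refine sum_congr rfl fun m _ => ?_
        rw [mul_sum]
        exact sum_congr rfl fun p _ => by ring
    _ ≤ ∑ m ∈ Icc 1 N, 5 * x / Real.log R * (m : ℝ)⁻¹ *
        (20 * (1 + Real.log G) / Real.log (R / G ^ 2)) *
        (20 * (1 + Real.log (K * G ^ 2)) / Real.log (R / G ^ 2)) := by
        refine sum_le_sum fun m hm => ?_
        gcongr
        refine sum_inv_primes_le hr hW _ (fun p hp => ?_) fun p hp q hq => ?_
        · have := (mem_filter.mp hp).2
          exact ⟨this.1, this.2.1⟩
        · obtain ⟨-, -, -, -, h1⟩ := mem_filter.mp hp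
          obtain ⟨-, -, -, h2, -⟩ := mem_filter.mp hq
          have hm0 : (0 : ℝ) < m := by exact_mod_cast (mem_Icc.mp hm).1
          have h3 : (m : ℝ) * q ^ 3 ≤ m * (K * G ^ 2 * p) ^ 3 := by
            calc (m : ℝ) * q ^ 3 ≤ x * G := h2
              _ ≤ K * G * m * p ^ 3 * G := by gcongr
              _ = (K * G ^ 2) * (m * p ^ 3) := by ring
              _ ≤ (K * G ^ 2) ^ 3 * (m * p ^ 3) := by
                gcongr
                exact le_self_pow₀ hW (by norm_num)
              _ = _ := by ring
          exact le_of_pow_le_pow_left₀ (by norm_num) (by positivity) (le_of_mul_le_mul_left h3 hm0)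
    _ = 5 * x / Real.log R * (20 * (1 + Real.log (K * G ^ 2)) / Real.log (R / G ^ 2)) *
        (20 * (1 + Real.log G) / Real.log (R / G ^ 2)) * ∑ m ∈ Icc 1 N, (m : ℝ)⁻¹ := by
        rw [mul_sum]
        exact sum_congr rfl fun m _ => by ring
    _ ≤ _ := by
        gcongr
        refine (sum_inv_Icc_le _).trans ?_
        gcongr
        · exact_mod_cast Nat.floor_pos.mpr hx
        · exact Nat.floor_le (by linarith)

end

section

open Finset

lemma abund_le_self {n : ℕ} (hn : n ≠ 0) : (abund n : ℝ) ≤ n := by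
  have h1 : ArithmeticFunction.sigma 1 n ≤ n * n := by
    rw [ArithmeticFunction.sigma_one_apply]
    refine (sum_le_card_nsmul _ _ n fun d hd => Nat.divisor_le hd).trans ?_
    rw [smul_eq_mul]
    exact Nat.mul_le_mul_right _ (Nat.card_divisors_le_self n)
  have h2 : (0 : ℝ) < n := by exact_mod_cast Nat.pos_of_ne_zero hn
  rw [abund]
  push_cast
  rw [div_le_iff₀ h2]
  exact_mod_cast h1

/-- Distinct abundancy indices of small numbers are well separated. -/
lemma abund_add_le_of_lt {d e : ℕ} (hd : d ≠ 0) (he : e ≠ 0) (h : abund d < abund e) :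
    (abund d : ℝ) + 1 / (d * e) ≤ abund e := by
  have hd0 : (0 : ℝ) < d := by exact_mod_cast Nat.pos_of_ne_zero hd
  have he0 : (0 : ℝ) < e := by exact_mod_cast Nat.pos_of_ne_zero he
  have h1 : (abund d : ℝ) < abund e := by exact_mod_cast h
  simp only [abund] at h1 ⊢
  push_cast at h1 ⊢
  rw [div_lt_div_iff₀ hd0 he0] at h1
  have h2 : ArithmeticFunction.sigma 1 d * e + 1 ≤ ArithmeticFunction.sigma 1 e * d := by
    exact_mod_cast h1
  have h3 : (ArithmeticFunction.sigma 1 d * e + 1 : ℝ) ≤ ArithmeticFunction.sigma 1 e * d := by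
    exact_mod_cast h2
  rw [div_add_div _ _ hd0.ne' (by positivity), div_le_div_iff₀ (by positivity) he0]
  have := mul_le_mul_of_nonneg_right h3 (by positivity : (0 : ℝ) ≤ d * e)
  linarith

/-- `n = e * g * p` with pairwise coprime factors and `p` a large prime. -/
def IsPrimeFactorization (Q : ℕ) (R : ℝ) (n e g p : ℕ) : Prop :=
  n = e * g * p ∧ e.Coprime g ∧ (e * g).Coprime p ∧ p.Prime ∧ R ≤ p ∧ e ≤ Q

lemma IsPrimeFactorization.abund_eq {Q : ℕ} {R : ℝ} {n e g p : ℕ}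
    (h : IsPrimeFactorization Q R n e g p) :
    (abund n : ℝ) = abund e * abund g * (1 + 1 / (p : ℝ)) := by
  obtain ⟨rfl, h1, h2, hp, -⟩ := h
  rw [abund_mul h2, abund_mul h1, ← abund_prime hp]
  push_cast
  rfl

lemma IsPrimeFactorization.abund_le {Q : ℕ} {R δ : ℝ} {n n' e e' g p p' : ℕ}
    (h : IsPrimeFactorization Q R n e g p) (h' : IsPrimeFactorization Q R n' e' g p')
    (hn : n ≠ 0) (hn' : n' ≠ 0) (hδQ : 4 * Q ^ 3 * δ ≤ 1) (hQ : 1 ≤ Q)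
    (hR : 4 * Q ^ 3 ≤ R) (hnn : (n' : ℝ) ≤ n * (1 + δ))
    (hσ : ArithmeticFunction.sigma 1 n ≤ ArithmeticFunction.sigma 1 n') :
    abund e ≤ abund e' := by
  by_contra! hlt
  have he : e ≠ 0 := by
    rintro rfl
    exact hn (by simpa using h.1)
  have he' : e' ≠ 0 := by
    rintro rfl
    exact hn' (by simpa using h'.1)
  have hg : g ≠ 0 := by
    rintro rfl
    exact hn (by simpa using h.1)
  have hσ' : (ArithmeticFunction.sigma 1 n : ℝ) ≤ ArithmeticFunction.sigma 1 n' := by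
    exact_mod_cast hσ
  rw [cast_sigma_eq hn, cast_sigma_eq hn', h.abund_eq, h'.abund_eq] at hσ'
  have hn0 : (0 : ℝ) < n := by exact_mod_cast Nat.pos_of_ne_zero hn
  have hQ1 : (1 : ℝ) ≤ Q := by exact_mod_cast hQ
  have hQ3 : (1 : ℝ) ≤ (Q : ℝ) ^ 3 := one_le_pow₀ hQ1
  have hp' : 4 * (Q : ℝ) ^ 3 ≤ p' := hR.trans h'.2.2.2.2.1
  have hp0 : (0 : ℝ) < p' := by linarith
  have hfe := one_le_abund he
  have hfe' := one_le_abund he'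
  have hfg := one_le_abund hg
  set η : ℝ := 1 / (4 * (Q : ℝ) ^ 3) with hη
  have hη0 : 0 < η := by positivity
  have hη1 : η ≤ 1 / 4 := by
    rw [hη]
    refine one_div_le_one_div_of_le (by norm_num) (by linarith)
  have hδη : δ ≤ η := by
    rw [hη, le_div_iff₀ (by positivity)]
    linarith
  have hpη : 1 / (p' : ℝ) ≤ η := one_div_le_one_div_of_le (by positivity) hp'
  have h1 : (abund e : ℝ) ≤ abund e' * ((1 + η) * (1 + η)) := by
    have h3 : (0 : ℝ) < n * abund g := by positivity
    refine le_of_mul_le_mul_left ?_ h3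
    calc (n : ℝ) * abund g * abund e ≤ n * abund g * abund e * (1 + 1 / (p : ℝ)) :=
          le_mul_of_one_le_right (by positivity) (le_add_of_nonneg_right (by positivity))
      _ = n * (abund e * abund g * (1 + 1 / (p : ℝ))) := by ring
      _ ≤ _ := hσ'
      _ ≤ n * (1 + η) * (abund e' * abund g * (1 + η)) := by
        gcongr
        exact hnn.trans (by gcongr)
      _ = _ := by ring
  have h2 := abund_add_le_of_lt he' he hlt
  have h3 := abund_le_self he'
  have heQ : (e : ℝ) ≤ Q := by exact_mod_cast h.2.2.2.2.2
  have heQ' : (e' : ℝ) ≤ Q := by exact_mod_cast h'.2.2.2.2.2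
  have he0 : (0 : ℝ) < e := by exact_mod_cast Nat.pos_of_ne_zero he
  have he0' : (0 : ℝ) < e' := by exact_mod_cast Nat.pos_of_ne_zero he'
  have h4 : 1 / ((Q : ℝ) * Q) ≤ 1 / (e' * e) :=
    one_div_le_one_div_of_le (by positivity) (by gcongr)
  have h5 : 1 / ((Q : ℝ) * Q) = Q * (4 * η) := by
    rw [hη]
    field_simp
  have h6 : (abund e' : ℝ) * ((1 + η) * (1 + η)) ≤ abund e' + Q * (9 / 4 * η) := by
    have : (1 + η) * (1 + η) ≤ 1 + 9 / 4 * η := by nlinarith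
    calc (abund e' : ℝ) * ((1 + η) * (1 + η)) ≤ abund e' * (1 + 9 / 4 * η) := by gcongr
      _ = abund e' + abund e' * (9 / 4 * η) := by ring
      _ ≤ _ := by gcongr; linarith
  nlinarith [mul_pos (by linarith : (0 : ℝ) < Q) hη0]

/-- Monotone sets of numbers `e * g * p` with `g` fixed are controlled by the fibers of the
abundancy index of `e`. -/
lemma card_le_of_fibers {x K R α β : ℝ} {Q h g : ℕ} (hx : 0 < x) (hK : 1 ≤ K) (hα : 0 ≤ α)
    (hβ : 0 ≤ β) (hQ : 1 ≤ Q) (hh : 4 * Q ^ 3 * (h * K) ≤ x) (hR : 4 * Q ^ 3 ≤ R)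
    (S : Finset ℕ) (hS : ∀ n ∈ S, x / K < n ∧ (n : ℝ) ≤ x) (e p : ℕ → ℕ)
    (hep : ∀ n ∈ S, IsPrimeFactorization Q R n (e n) g (p n))
    (hmono : ∀ m ∈ S, ∀ n ∈ S, m ≤ n →
      ArithmeticFunction.sigma 1 m ≤ ArithmeticFunction.sigma 1 n)
    (hfib : ∀ c, ∀ s ∈ S, ∀ t ∈ S, s ≤ t →
      ((S.filter fun n => s ≤ n ∧ n ≤ t ∧ abund (e n) = c).card : ℝ) ≤ α * ((t : ℝ) - s) + β) :
    (S.card : ℝ) ≤ α * (x + h) + (x / (h + 1) + 1) * (β * Q) := by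
  classical
  have hpos : ∀ n ∈ S, n ≠ 0 := by
    intro n hn
    have : (0 : ℝ) < n := (by positivity : 0 < x / K).trans (hS n hn).1
    exact_mod_cast this.ne'
  have hepos : ∀ n ∈ S, 1 ≤ e n := by
    intro n hn
    refine Nat.pos_of_ne_zero fun h0 => hpos n hn ?_
    rw [(hep n hn).1, h0, zero_mul, zero_mul]
  set J := ⌊x / (h + 1)⌋₊ with hJ
  have hJle : (J : ℝ) ≤ x / (h + 1) := Nat.floor_le (by positivity)
  have hwin : ∀ j, ((S.filter fun n => n / (h + 1) = j).card : ℝ) ≤ α * h + β * Q := by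
    intro j
    set T := S.filter fun n => n / (h + 1) = j with hT
    have hTS : ∀ n ∈ T, n ∈ S := fun n hn => (mem_filter.mp hn).1
    have hTI : ∀ n ∈ T, j * (h + 1) ≤ n ∧ n ≤ j * (h + 1) + h := by
      intro n hn
      have h1 := Nat.div_add_mod n (h + 1)
      have h2 := Nat.mod_lt n (Nat.add_pos_right h one_pos)
      rw [(mem_filter.mp hn).2, mul_comm] at h1
      omega
    have h1 := card_le_of_monotone_fibers (β := β) hα (fun n => abund (e n)) _ T (j * (h + 1))
      (j * (h + 1) + h) (Nat.le_add_right _ _) hTI ?_ ?_ rfl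
    · refine h1.trans ?_
      have h2 : (T.image fun n => abund (e n)).card ≤ Q := by
        calc (T.image fun n => abund (e n)).card ≤ ((Icc 1 Q).image abund).card := by
              refine card_le_card fun c hc => ?_
              obtain ⟨n, hn, rfl⟩ := mem_image.mp hc
              exact mem_image_of_mem _ (mem_Icc.mpr
                ⟨hepos n (hTS n hn), (hep n (hTS n hn)).2.2.2.2.2⟩)
          _ ≤ (Icc 1 Q).card := card_image_le
          _ = Q := by simp
      push_cast
      rw [add_sub_cancel_left]
      gcongr
    · intro m hm n hn hmn
      refine IsPrimeFactorization.abund_le (δ := h * K / x) (hep m (hTS m hm)) (hep n (hTS n hn))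
        (hpos m (hTS m hm)) (hpos n (hTS n hn)) ?_ hQ hR ?_
        (hmono m (hTS m hm) n (hTS n hn) hmn)
      · rw [← mul_div_assoc, div_le_one hx]
        exact hh
      · have h2 : n ≤ m + h := by
          have := hTI m hm
          have := hTI n hn
          omega
        have h3 : (n : ℝ) ≤ m + h := by exact_mod_cast h2
        have h4 := (hS m (hTS m hm)).1.le
        have h5 : (h : ℝ) ≤ m * (h * K / x) := by
          calc (h : ℝ) = x / K * (h * K / x) := by field_simp
            _ ≤ _ := by gcongr
        linarith
    · intro c s hs t ht hst
      refine le_trans ?_ (hfib c s (hTS s hs) t (hTS t ht) hst)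
      exact_mod_cast card_le_card (filter_subset_filter _ (filter_subset _ _))
  have hsum : S.card = ∑ j ∈ range (J + 1), (S.filter fun n => n / (h + 1) = j).card := by
    refine card_eq_sum_card_fiberwise fun n hn => ?_
    rw [mem_coe, mem_range, Nat.lt_succ_iff]
    refine Nat.le_floor (Nat.cast_div_le.trans ?_)
    push_cast
    have := (hS n hn).2
    gcongr
  calc (S.card : ℝ) = ∑ j ∈ range (J + 1), ((S.filter fun n => n / (h + 1) = j).card : ℝ) := by
        exact_mod_cast hsum
    _ ≤ ∑ j ∈ range (J + 1), (α * h + β * Q) := sum_le_sum fun j _ => hwin j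
    _ = (J + 1) * (α * h + β * Q) := by
      rw [sum_const, card_range, nsmul_eq_mul]
      push_cast
      rfl
    _ ≤ (x / (h + 1) + 1) * (α * h + β * Q) := by gcongr
    _ = α * (x * (h / (h + 1)) + h) + (x / (h + 1) + 1) * (β * Q) := by ring
    _ ≤ _ := by
      gcongr
      refine mul_le_of_le_one_right hx.le ?_
      rw [div_le_one (by positivity)]
      linarith

end

section

open Finset

lemma mem_fiber {N d : ℕ} {q : ℚ} : d ∈ fiber N q ↔ (1 ≤ d ∧ d ≤ N) ∧ abund d = q := by
  rw [fiber, mem_filter, mem_Icc]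

/-- Numbers `e * g * p` where `e` is a large divisor of bounded size. -/
lemma card_le_of_large_divisor_aux {x K R E : ℝ} {Q h g : ℕ} (hx : 0 < x) (hK : 1 ≤ K)
    (hE : 0 < E) (hg : 0 < g) (hQ : 1 ≤ Q) (hh : 4 * Q ^ 3 * (h * K) ≤ x) (hR : 4 * Q ^ 3 ≤ R)
    (S : Finset ℕ) (hS : ∀ n ∈ S, x / K < n ∧ (n : ℝ) ≤ x)
    (hep : ∀ n ∈ S, ∃ e p, IsPrimeFactorization Q R n e g p ∧ E ^ 4 ≤ e)
    (hmono : ∀ m ∈ S, ∀ n ∈ S, m ≤ n →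
      ArithmeticFunction.sigma 1 m ≤ ArithmeticFunction.sigma 1 n) :
    (S.card : ℝ) ≤ 5 / 2 / E * (x + h) * (g : ℝ)⁻¹ + (x / (h + 1) + 1) * (Q * Q) := by
  classical
  choose! e p hep using hep
  have hpos : ∀ n ∈ S, n ≠ 0 := by
    intro n hn
    have : (0 : ℝ) < n := (by positivity : 0 < x / K).trans (hS n hn).1
    exact_mod_cast this.ne'
  have hepos : ∀ n ∈ S, 1 ≤ e n := by
    intro n hn
    refine Nat.pos_of_ne_zero fun h0 => hpos n hn ?_
    rw [(hep n hn).1.1, h0, zero_mul, zero_mul]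
  have hgR : (0 : ℝ) < g := by exact_mod_cast hg
  have := card_le_of_fibers (α := 5 / 2 / E * (g : ℝ)⁻¹) (β := Q) hx hK (by positivity)
    (by positivity) hQ hh hR S hS e p (fun n hn => (hep n hn).1) hmono ?_
  · refine this.trans_eq ?_
    ring
  intro c s hs t ht hst
  have hstR : (s : ℝ) ≤ t := by exact_mod_cast hst
  set F := (fiber Q c).filter fun d : ℕ => E ^ 4 ≤ d with hF
  have hsub : (S.filter fun n => s ≤ n ∧ n ≤ t ∧ abund (e n) = c) ⊆
      F.biUnion fun d => (Icc s t).filter fun n => d * g ∣ n := by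
    intro n hn
    rw [mem_filter] at hn
    obtain ⟨hn, h1, h2, h3⟩ := hn
    rw [mem_biUnion]
    refine ⟨e n, ?_, ?_⟩
    · rw [hF, mem_filter, mem_fiber]
      exact ⟨⟨⟨hepos n hn, (hep n hn).1.2.2.2.2.2⟩, h3⟩, (hep n hn).2⟩
    · rw [mem_filter, mem_Icc]
      exact ⟨⟨h1, h2⟩, Dvd.intro _ (hep n hn).1.1.symm⟩
  have hcount : ∀ d ∈ F, (((Icc s t).filter fun n => d * g ∣ n).card : ℝ) ≤
      ((t : ℝ) - s) * (g : ℝ)⁻¹ * (d : ℝ)⁻¹ + 1 := by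
    intro d hd
    have hd1 := (mem_fiber.mp (mem_filter.mp hd).1).1.1
    have hdR : (0 : ℝ) < d := by exact_mod_cast hd1
    have hdg : 0 < d * g := Nat.mul_pos hd1 hg
    have h1 : (((Icc s t).filter fun n => d * g ∣ n).card) ≤ (t - s) / (d * g) + 1 := by
      have h2 : ((Icc s t).filter fun n => d * g ∣ n) ⊆
          ((range ((t - s) / (d * g) + 1)).image fun i => (i + (s + d * g - 1) / (d * g)) * (d * g)) := by
        intro n hn
        rw [mem_filter, mem_Icc] at hn
        obtain ⟨⟨h3, h4⟩, k, rfl⟩ := hn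
        rw [mem_image]
        set w := d * g with hw
        have h5 : (s + w - 1) / w ≤ k := by
          rw [Nat.div_le_iff_le_mul_add_pred hdg]
          omega
        refine ⟨k - (s + w - 1) / w, ?_, ?_⟩
        · rw [mem_range, Nat.lt_succ_iff, Nat.le_div_iff_mul_le hdg, Nat.sub_mul]
          have h6 : s ≤ (s + w - 1) / w * w := by
            have := Nat.div_add_mod (s + w - 1) w
            have := Nat.mod_lt (s + w - 1) hdg
            rw [mul_comm]
            omega
          rw [mul_comm k]
          omega
        · rw [Nat.sub_add_cancel h5, mul_comm]
      exact (card_le_card h2).trans (card_image_le.trans_eq (card_range _))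
    have h7 : (((Icc s t).filter fun n => d * g ∣ n).card : ℝ) ≤
        (((t - s) / (d * g) : ℕ) : ℝ) + 1 := by exact_mod_cast h1
    refine h7.trans ?_
    gcongr
    refine Nat.cast_div_le.trans_eq ?_
    rw [Nat.cast_sub hst]
    push_cast
    field_simp
  have hFcard : (F.card : ℝ) ≤ Q := by
    have : F.card ≤ (Icc 1 Q).card :=
      card_le_card ((filter_subset _ _).trans (filter_subset _ _))
    rw [Nat.card_Icc, Nat.add_sub_cancel] at this
    exact_mod_cast this
  calc ((S.filter fun n => s ≤ n ∧ n ≤ t ∧ abund (e n) = c).card : ℝ)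
      ≤ ∑ d ∈ F, (((Icc s t).filter fun n => d * g ∣ n).card : ℝ) := by
        exact_mod_cast (card_le_card hsub).trans card_biUnion_le
    _ ≤ ∑ d ∈ F, (((t : ℝ) - s) * (g : ℝ)⁻¹ * (d : ℝ)⁻¹ + 1) := sum_le_sum hcount
    _ = ((t : ℝ) - s) * (g : ℝ)⁻¹ * ∑ d ∈ F, (d : ℝ)⁻¹ + F.card := by
      rw [sum_add_distrib, ← mul_sum]
      simp
    _ ≤ ((t : ℝ) - s) * (g : ℝ)⁻¹ * (5 / 2 / E) + Q := by
      have := sub_nonneg.mpr hstR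
      gcongr
      exact sum_fiber_inv_tail_le hE Q c
    _ = _ := by ring

lemma card_le_of_large_divisor {x K R E Y : ℝ} {Q h : ℕ} (hx : 0 < x) (hK : 1 ≤ K)
    (hE : 0 < E) (hY : 1 ≤ Y) (hQ : 1 ≤ Q) (hh : 4 * Q ^ 3 * (h * K) ≤ x) (hR : 4 * Q ^ 3 ≤ R)
    (S : Finset ℕ) (hS : ∀ n ∈ S, x / K < n ∧ (n : ℝ) ≤ x)
    (hep : ∀ n ∈ S, ∃ e g p, IsPrimeFactorization Q R n e g p ∧ E ^ 4 ≤ e ∧ (g : ℝ) ≤ Y)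
    (hmono : ∀ m ∈ S, ∀ n ∈ S, m ≤ n →
      ArithmeticFunction.sigma 1 m ≤ ArithmeticFunction.sigma 1 n) :
    (S.card : ℝ) ≤ 5 / 2 / E * (x + h) * (1 + Real.log Y) +
      Y * ((x / (h + 1) + 1) * (Q * Q)) := by
  classical
  set M := ⌊Y⌋₊ with hM
  have hMY : (M : ℝ) ≤ Y := Nat.floor_le (by linarith)
  have hM1 : 1 ≤ M := Nat.le_floor (by exact_mod_cast hY)
  have hsub : S ⊆ (Icc 1 M).biUnion fun g =>
      S.filter fun n => ∃ e p, IsPrimeFactorization Q R n e g p ∧ E ^ 4 ≤ e := by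
    intro n hn
    obtain ⟨e, g, p, h1, h2, h3⟩ := hep n hn
    rw [mem_biUnion]
    refine ⟨g, mem_Icc.mpr ⟨Nat.pos_of_ne_zero ?_, Nat.le_floor h3⟩,
      mem_filter.mpr ⟨hn, e, p, h1, h2⟩⟩
    rintro rfl
    have : (0 : ℝ) < n := (by positivity : 0 < x / K).trans (hS n hn).1
    rw [h1.1] at this
    simp at this
  calc (S.card : ℝ) ≤ ∑ g ∈ Icc 1 M, ((S.filter fun n =>
        ∃ e p, IsPrimeFactorization Q R n e g p ∧ E ^ 4 ≤ e).card : ℝ) := by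
        exact_mod_cast (card_le_card hsub).trans card_biUnion_le
    _ ≤ ∑ g ∈ Icc 1 M, (5 / 2 / E * (x + h) * (g : ℝ)⁻¹ + (x / (h + 1) + 1) * (Q * Q)) := by
      refine sum_le_sum fun g hg => ?_
      exact card_le_of_large_divisor_aux hx hK hE (mem_Icc.mp hg).1 hQ hh hR _
        (fun n hn => hS n (mem_filter.mp hn).1) (fun n hn => (mem_filter.mp hn).2)
        fun m hm n hn => hmono m (mem_filter.mp hm).1 n (mem_filter.mp hn).1
    _ = 5 / 2 / E * (x + h) * ∑ g ∈ Icc 1 M, (g : ℝ)⁻¹ +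
        M * ((x / (h + 1) + 1) * (Q * Q)) := by
      rw [sum_add_distrib, ← mul_sum]
      simp
    _ ≤ _ := by
      gcongr
      refine (sum_inv_Icc_le M).trans ?_
      gcongr

/-- Numbers `e * p` where `e` is small. -/
lemma card_le_of_small_divisor {x K R θ η : ℝ} {Q h : ℕ} (hx : 0 < x) (hK : 1 ≤ K)
    (hθ : 0 ≤ θ) (hη : 0 ≤ η) (hQ : 1 ≤ Q) (hh : 4 * Q ^ 3 * (h * K) ≤ x) (hR : 4 * Q ^ 3 ≤ R)
    (hprime : ∀ s t : ℝ, x / (K * Q) ≤ s → s ≤ t → t ≤ x →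
      (((Icc ⌈s⌉₊ ⌊t⌋₊).filter Nat.Prime).card : ℝ) ≤ (t - s) * θ + η)
    (S : Finset ℕ) (hS : ∀ n ∈ S, x / K < n ∧ (n : ℝ) ≤ x)
    (hep : ∀ n ∈ S, ∃ e p, IsPrimeFactorization Q R n e 1 p)
    (hmono : ∀ m ∈ S, ∀ n ∈ S, m ≤ n →
      ArithmeticFunction.sigma 1 m ≤ ArithmeticFunction.sigma 1 n) :
    (S.card : ℝ) ≤ θ * (x + h) + (x / (h + 1) + 1) * (Q * η * Q) := by
  classical
  choose! e p hep using hep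
  have hpos : ∀ n ∈ S, n ≠ 0 := by
    intro n hn
    have : (0 : ℝ) < n := (by positivity : 0 < x / K).trans (hS n hn).1
    exact_mod_cast this.ne'
  have hepos : ∀ n ∈ S, 1 ≤ e n := by
    intro n hn
    refine Nat.pos_of_ne_zero fun h0 => hpos n hn ?_
    rw [(hep n hn).1, h0, zero_mul, zero_mul]
  refine card_le_of_fibers (α := θ) (β := Q * η) hx hK hθ
    (by positivity) hQ hh hR S hS e p hep hmono ?_
  intro c s hs t ht hst
  have hstR : (s : ℝ) ≤ t := by exact_mod_cast hst
  have hsub : (S.filter fun n => s ≤ n ∧ n ≤ t ∧ abund (e n) = c) ⊆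
      (fiber Q c).biUnion fun d =>
        ((Icc ⌈(s : ℝ) / d⌉₊ ⌊(t : ℝ) / d⌋₊).filter Nat.Prime).image fun p => d * p := by
    intro n hn
    rw [mem_filter] at hn
    obtain ⟨hn, h1, h2, h3⟩ := hn
    have he0 : (0 : ℝ) < e n := by exact_mod_cast hepos n hn
    have hn1 := (hep n hn).1
    rw [mul_one] at hn1
    have hnR : (n : ℝ) = e n * p n := by exact_mod_cast hn1
    rw [mem_biUnion]
    refine ⟨e n, ?_, ?_⟩
    · rw [mem_fiber]
      exact ⟨⟨hepos n hn, (hep n hn).2.2.2.2.2⟩, h3⟩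
    · rw [mem_image]
      refine ⟨p n, ?_, hn1.symm⟩
      rw [mem_filter, mem_Icc]
      refine ⟨⟨Nat.ceil_le.mpr ?_, Nat.le_floor ?_⟩, (hep n hn).2.2.2.1⟩
      · rw [div_le_iff₀ he0, mul_comm, ← hnR]
        exact_mod_cast h1
      · rw [le_div_iff₀ he0, mul_comm, ← hnR]
        exact_mod_cast h2
  have hcard : ((fiber Q c).card : ℝ) ≤ Q := by
    have : (fiber Q c).card ≤ (Icc 1 Q).card := card_le_card (filter_subset _ _)
    rw [Nat.card_Icc, Nat.add_sub_cancel] at this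
    exact_mod_cast this
  calc ((S.filter fun n => s ≤ n ∧ n ≤ t ∧ abund (e n) = c).card : ℝ)
      ≤ ∑ d ∈ fiber Q c,
          (((Icc ⌈(s : ℝ) / d⌉₊ ⌊(t : ℝ) / d⌋₊).filter Nat.Prime).card : ℝ) := by
        exact_mod_cast (card_le_card hsub).trans
          (card_biUnion_le.trans (sum_le_sum fun d _ => card_image_le))
    _ ≤ ∑ d ∈ fiber Q c, (((t : ℝ) - s) * θ * (d : ℝ)⁻¹ + η) := by
      refine sum_le_sum fun d hd => ?_
      have hd1 := (mem_fiber.mp hd).1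
      have hdR : (1 : ℝ) ≤ d := by exact_mod_cast hd1.1
      have hdQ : (d : ℝ) ≤ Q := by exact_mod_cast hd1.2
      refine (hprime _ _ ?_ (by gcongr) ?_).trans_eq ?_
      · rw [← div_div]
        have := (hS s hs).1.le
        gcongr
      · exact (div_le_self (by positivity) hdR).trans (hS t ht).2
      · rw [← sub_div]
        ring
    _ = ((t : ℝ) - s) * θ * ∑ d ∈ fiber Q c, (d : ℝ)⁻¹ + (fiber Q c).card * η := by
      rw [sum_add_distrib, ← mul_sum]
      simp
    _ ≤ ((t : ℝ) - s) * θ * 1 + Q * η := by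
      have := sub_nonneg.mpr hstR
      gcongr
      exact sum_fiber_inv_le Q c
    _ = _ := by ring

end

section

open Finset

lemma exists_max_prime_dvd {n : ℕ} (h0 : n ≠ 0) (h1 : n ≠ 1) :
    ∃ p k, n = p * k ∧ p.Prime ∧ ∀ q, q.Prime → q ∣ n → q ≤ p := by
  obtain ⟨p, hp, hmax⟩ := exists_max_image n.primeFactors id (Nat.nonempty_primeFactors.mpr (by omega))
  obtain ⟨k, hk⟩ := Nat.dvd_of_mem_primeFactors hp
  exact ⟨p, k, hk, Nat.prime_of_mem_primeFactors hp, fun q hq hqn =>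
    hmax q (Nat.mem_primeFactors.mpr ⟨hq, hqn, h0⟩)⟩

/-- If no large square divides `n`, then its higher prime powers are small. -/
lemma pow_le_of_no_square {n M v p : ℕ} (hn : ∀ m, M ≤ m → ¬ m ^ 2 ∣ n) (hv : 2 ≤ v)
    (h : p ^ v ∣ n) (hp : 0 < p) : p ^ v ≤ M ^ 3 := by
  have h1 : p ^ (v / 2) < M := by
    by_contra! h2
    refine hn _ h2 (dvd_trans ?_ h)
    rw [← pow_mul]
    exact pow_dvd_pow _ (Nat.div_mul_le_self v 2)
  calc p ^ v ≤ p ^ (v / 2 * 3) := Nat.pow_le_pow_right hp (by omega)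
    _ = (p ^ (v / 2)) ^ 3 := pow_mul _ _ _
    _ ≤ M ^ 3 := Nat.pow_le_pow_left h1.le 3

/-- The possible shapes of a number without large square divisors and with few prime factors. -/
lemma factorization_shape {n M D : ℕ} {z G R Y : ℝ} (hn : n ≠ 0) (hD : 0 < D)
    (hsq : ∀ m, M ≤ m → ¬ m ^ 2 ∣ n) (hMz : (M : ℝ) ≤ z) (hzM : z ≤ (M : ℝ) ^ 3)
    (hMR : (M : ℝ) ^ 3 ≤ R) (hG : 1 ≤ G) (hz : 1 ≤ z)
    (hY : ((M : ℝ) ^ 3) ^ n.primeFactors.card ≤ Y) (hR : R ^ n.primeFactors.card < n) :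
    (∃ e p s, IsGapFactorization z G n e p s) ∨
    (∃ m p₁ p₂ : ℕ, n = m * p₁ * p₂ ∧ (m : ℝ) ≤ Y ∧
      p₁.Prime ∧ p₂.Prime ∧ R ≤ p₁ ∧ p₂ ≤ p₁ ∧ (p₁ : ℝ) ≤ G * p₂) ∨
    (∃ m p₁ p₂ p₃ : ℕ, n = m * p₁ * p₂ * p₃ ∧
      p₁.Prime ∧ p₂.Prime ∧ p₃.Prime ∧ R ≤ p₁ ∧ p₂ ≤ p₁ ∧ (p₁ : ℝ) ≤ G * p₂ ∧ p₃ ≤ p₂ ∧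
      (p₂ : ℝ) ≤ G * p₃) ∨
    (∃ e p, IsPrimeFactorization D R n e 1 p) ∨
    (∃ e g p, IsPrimeFactorization (D * M ^ 3) R n e g p ∧ D < e ∧ (g : ℝ) ≤ Y) := by
  have hM1 : 1 ≤ M := by
    by_contra! h
    rw [Nat.lt_one_iff.mp h] at hzM
    norm_num at hzM
    linarith
  have hexact : ∀ q k : ℕ, q.Prime → z ≤ q → n = q * k → q.Coprime k := by
    intro q k hq hzq hnk
    rw [hq.coprime_iff_not_dvd]
    rintro ⟨l, rfl⟩
    refine hsq q (by exact_mod_cast hMz.trans hzq) ⟨l, ?_⟩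
    rw [hnk]
    ring
  obtain ⟨m, r, hmr, hm, hr⟩ := exists_mul_of_primes (fun q => (q : ℝ) < z) hn
  have hm0 : m ≠ 0 := by
    rintro rfl
    exact hn (by simpa using hmr)
  have hr0 : r ≠ 0 := by
    rintro rfl
    exact hn (by simpa using hmr)
  have hmn : m ∣ n := ⟨r, hmr⟩
  have hmW : ∀ p, p.Prime → p ∣ m → p ^ m.factorization p ≤ M ^ 3 := by
    intro p hp hpm
    have h1 : p ^ m.factorization p ∣ n := (Nat.ordProj_dvd m p).trans hmn
    rcases le_or_gt 2 (m.factorization p) with h2 | h2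
    · exact pow_le_of_no_square hsq h2 h1 hp.pos
    · have h3 : (p : ℝ) ≤ (M ^ 3 : ℕ) := by
        push_cast
        exact (hm p hp hpm).le.trans hzM
      refine le_trans ?_ (show p ≤ M ^ 3 by exact_mod_cast h3)
      exact (Nat.pow_le_pow_right hp.pos (Nat.lt_succ_iff.mp h2)).trans_eq (pow_one p)
  have hmY : (m : ℝ) ≤ Y := by
    refine le_trans ?_ hY
    have h1 := le_pow_card_primeFactors hm0 hmW
    have h2 : m.primeFactors.card ≤ n.primeFactors.card :=
      card_le_card (Nat.primeFactors_mono hmn hn)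
    have h3 : m ≤ (M ^ 3) ^ n.primeFactors.card :=
      h1.trans (Nat.pow_le_pow_right (by positivity) h2)
    exact_mod_cast h3
  obtain ⟨q, hq, hqn, hqR⟩ : ∃ q, q.Prime ∧ q ∣ n ∧ R ≤ q := by
    by_contra! hno
    have hR0 : 0 ≤ R := le_trans (by positivity) hMR
    have h1 : n ≤ ⌊R⌋₊ ^ n.primeFactors.card := by
      refine le_pow_card_primeFactors hn fun p hp hpn => Nat.le_floor ?_
      rcases le_or_gt 2 (n.factorization p) with h2 | h2
      · have := pow_le_of_no_square hsq h2 (Nat.ordProj_dvd n p) hp.pos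
        refine le_trans ?_ hMR
        exact_mod_cast this
      · refine le_trans ?_ (hno p hp hpn).le
        exact_mod_cast (Nat.pow_le_pow_right hp.pos (Nat.lt_succ_iff.mp h2)).trans_eq (pow_one p)
    have h2 : (n : ℝ) ≤ (⌊R⌋₊ : ℝ) ^ n.primeFactors.card := by exact_mod_cast h1
    have h3 : (⌊R⌋₊ : ℝ) ^ n.primeFactors.card ≤ R ^ n.primeFactors.card := by
      gcongr
      exact Nat.floor_le hR0
    linarith
  have hzR : z ≤ R := hzM.trans hMR
  have hqr : q ∣ r := by
    rw [hmr] at hqn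
    rcases hq.dvd_mul.mp hqn with h | h
    · exact absurd (hm q hq h) (not_lt.mpr (hzR.trans hqR))
    · exact h
  have hzr : ∀ q, q.Prime → q ∣ r → z ≤ q := fun q hq h => not_lt.mp (hr q hq h)
  obtain ⟨p₁, r₁, rfl, hp₁, hmax₁⟩ := exists_max_prime_dvd hr0 (by
    rintro rfl
    exact hq.one_lt.ne' (Nat.dvd_one.mp hqr))
  have hRp₁ : R ≤ p₁ := hqR.trans (by exact_mod_cast hmax₁ q hq hqr)
  have hc₁ : p₁.Coprime (m * r₁) :=
    hexact p₁ _ hp₁ (hzR.trans hRp₁) (by rw [hmr]; ring)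
  by_cases hr₁ : r₁ = 1
  · subst hr₁
    rw [mul_one] at hc₁
    right; right; right
    rcases le_or_gt m D with hmD | hmD
    · left
      exact ⟨m, p₁, by rw [hmr]; ring, Nat.coprime_one_right m, by simpa using hc₁.symm, hp₁, hRp₁,
        hmD⟩
    · right
      obtain ⟨e, g, rfl, heg, he1, he2⟩ := exists_unitary_divisor hD m hmD hmW
      refine ⟨e, g, p₁, ⟨by rw [hmr]; ring, heg, hc₁.symm, hp₁, hRp₁, he2⟩, he1, le_trans ?_ hmY⟩
      exact_mod_cast Nat.le_mul_of_pos_left g (by omega)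
  have hr₁0 : r₁ ≠ 0 := right_ne_zero_of_mul hr0
  obtain ⟨p₂, r₂, rfl, hp₂, hmax₂⟩ := exists_max_prime_dvd hr₁0 hr₁
  have hzp₂ : z ≤ p₂ := hzr p₂ hp₂ (Dvd.intro (p₁ * r₂) (by ring))
  have hp₂₁ : p₂ ≤ p₁ := hmax₁ p₂ hp₂ (Dvd.intro (p₁ * r₂) (by ring))
  have hc₂ : p₂.Coprime (m * r₂ * p₁) := hexact p₂ _ hp₂ hzp₂ (by rw [hmr]; ring)
  have hp₂R : (0 : ℝ) < p₂ := by exact_mod_cast hp₂.pos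
  have hp₂₁R : (p₂ : ℝ) ≤ p₁ := by exact_mod_cast hp₂₁
  rcases lt_or_ge ((p₂ : ℝ) * G) p₁ with hgap | hgap
  · left
    refine ⟨m * r₂, p₂, p₁, by rw [hmr]; ring, hp₂, hzp₂, ?_, ?_, hgap, ?_⟩
    · refine Nat.Coprime.mul_right ?_ ?_
      · exact (hc₂.coprime_dvd_right (Dvd.intro _ rfl)).symm
      · exact (hc₁.coprime_dvd_right ⟨p₂, by ring⟩).symm
    · exact hc₂.coprime_dvd_right (Dvd.intro_left _ rfl)
    · rw [abund_prime hp₁]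
      have : 1 / (p₁ : ℝ) ≤ 4 / (p₂ * G) := by
        gcongr
        norm_num
      linarith
  by_cases hr₂ : r₂ = 1
  · subst hr₂
    right; left
    exact ⟨m, p₁, p₂, by rw [hmr]; ring, hmY, hp₁, hp₂, hRp₁, hp₂₁, by linarith⟩
  have hr₂0 : r₂ ≠ 0 := right_ne_zero_of_mul hr₁0
  obtain ⟨p₃, r₃, rfl, hp₃, hmax₃⟩ := exists_max_prime_dvd hr₂0 hr₂
  have hzp₃ : z ≤ p₃ := hzr p₃ hp₃ (Dvd.intro (p₁ * p₂ * r₃) (by ring))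
  have hp₃₂ : p₃ ≤ p₂ := hmax₂ p₃ hp₃ (Dvd.intro (p₂ * r₃) (by ring))
  have hc₃ : p₃.Coprime (m * r₃ * (p₁ * p₂)) := hexact p₃ _ hp₃ hzp₃ (by rw [hmr]; ring)
  have hp₃R : (1 : ℝ) ≤ p₃ := by exact_mod_cast hp₃.one_le
  rcases lt_or_ge ((p₃ : ℝ) * G) p₂ with hgap' | hgap'
  · left
    have h1 : (1 : ℝ) ≤ p₃ * G := one_le_mul_of_one_le_of_one_le hp₃R hG
    have hc₁₂ : p₁.Coprime p₂ := (hc₁.coprime_dvd_right ⟨m * r₃ * p₃, by ring⟩)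
    refine ⟨m * r₃, p₃, p₁ * p₂, by rw [hmr]; ring, hp₃, hzp₃, ?_, ?_, ?_, ?_⟩
    · refine Nat.Coprime.mul_right ?_ (Nat.Coprime.mul_right ?_ ?_)
      · exact (hc₃.coprime_dvd_right (Dvd.intro _ rfl)).symm
      · exact (hc₁.coprime_dvd_right ⟨p₂ * p₃, by ring⟩).symm
      · exact (hc₂.coprime_dvd_right ⟨p₃ * p₁, by ring⟩).symm
    · exact hc₃.coprime_dvd_right (Dvd.intro_left _ rfl)
    · push_cast
      nlinarith
    · rw [abund_mul hc₁₂]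
      push_cast
      rw [abund_prime hp₁, abund_prime hp₂]
      set ε : ℝ := 1 / (p₃ * G) with hε
      have hε0 : 0 < ε := by positivity
      have hε1 : ε ≤ 1 := by
        rw [hε, div_le_one (by linarith)]
        exact h1
      have h2 : 1 / (p₂ : ℝ) ≤ ε := one_div_le_one_div_of_le (by linarith) hgap'.le
      have h3 : 1 / (p₁ : ℝ) ≤ ε := one_div_le_one_div_of_le (by linarith) (by linarith)
      have h4 : 4 / (p₃ * G) = 4 * ε := by rw [hε]; ring
      rw [h4]
      calc (1 + 1 / (p₁ : ℝ)) * (1 + 1 / (p₂ : ℝ)) ≤ (1 + ε) * (1 + ε) := by gcongr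
        _ ≤ 1 + 4 * ε := by nlinarith
  · right; right; left
    exact ⟨m * r₃, p₁, p₂, p₃, by rw [hmr]; ring, hp₁, hp₂, hp₃, hRp₁, hp₂₁, by linarith, hp₃₂,
      by linarith⟩

end

section

open Finset

lemma two_pow_card_primeFactors_le {n : ℕ} (hn : n ≠ 0) :
    2 ^ n.primeFactors.card ≤ n.divisors.card := by
  rw [Nat.card_divisors hn, ← prod_const]
  refine prod_le_prod' fun p hp => ?_
  have := (Nat.prime_of_mem_primeFactors hp).factorization_pos_of_dvd hn
    (Nat.dvd_of_mem_primeFactors hp)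
  omega

/-- A monotone set is covered by exceptional numbers and numbers with a large prime factor. -/
lemma card_le_of_parameters {x K T L z G R Y E θ η : ℝ} {M D h : ℕ} (hx : 3 ≤ x) (hK : 1 ≤ K)
    (hT : 0 < T) (hM : 1 ≤ M) (hL : 1 ≤ L) (hLz : L ≤ z) (hMz : (M : ℝ) ≤ z)
    (hzM : z ≤ (M : ℝ) ^ 3) (hMR : (M : ℝ) ^ 3 ≤ R) (hG : 4 * L ≤ G) (hGR : G ^ 2 < R)
    (hω : ∀ j : ℕ, (2 : ℝ) ^ j < T → ((M : ℝ) ^ 3) ^ j ≤ Y ∧ R ^ j ≤ x / K) (hY : 1 ≤ Y)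
    (hE : 0 < E) (hED : E ^ 4 ≤ D) (hD : 0 < D)
    (hh : 4 * ((D * M ^ 3 : ℕ) : ℝ) ^ 3 * (h * K) ≤ x)
    (hR : 4 * ((D * M ^ 3 : ℕ) : ℝ) ^ 3 ≤ R) (hθ : 0 ≤ θ) (hη : 0 ≤ η)
    (hprime : ∀ s t : ℝ, x / (K * D) ≤ s → s ≤ t → t ≤ x →
      (((Icc ⌈s⌉₊ ⌊t⌋₊).filter Nat.Prime).card : ℝ) ≤ (t - s) * θ + η)
    (S : Finset ℕ) (hS : ∀ n ∈ S, 1 ≤ n ∧ (n : ℝ) ≤ x)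
    (hmono : ∀ m ∈ S, ∀ n ∈ S, m ≤ n →
      ArithmeticFunction.sigma 1 m ≤ ArithmeticFunction.sigma 1 n) :
    (S.card : ℝ) ≤ x / K + 2 * x / M + x * (1 + Real.log x) / T +
      (52 / L + 54 * L * K / G) * x * (2 * Real.log x * (3 * Real.log x)) +
      5 * x / Real.log R * (20 * (1 + Real.log (K * G)) / Real.log (R / G)) * (1 + Real.log Y) +
      5 * x / Real.log R * (20 * (1 + Real.log (K * G ^ 2)) / Real.log (R / G ^ 2)) *
        (20 * (1 + Real.log G) / Real.log (R / G ^ 2)) * (1 + Real.log x) +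
      (θ * (x + h) + (x / (h + 1) + 1) * (D * η * D)) +
      (5 / 2 / E * (x + h) * (1 + Real.log Y) +
        Y * ((x / (h + 1) + 1) * (((D * M ^ 3 : ℕ) : ℝ) * ((D * M ^ 3 : ℕ) : ℝ)))) := by
  classical
  have hx0 : 0 < x := by linarith
  have hG1 : 1 ≤ G := by linarith
  have hz1 : 1 ≤ z := hL.trans hLz
  set N := ⌊x⌋₊ with hN
  have hNx : (N : ℝ) ≤ x := Nat.floor_le hx0.le
  set S₁ := S.filter fun n : ℕ => (n : ℝ) ≤ x / K with hS₁
  set S₂ := S.filter fun n => ∃ m, M ≤ m ∧ m ^ 2 ∣ n with hS₂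
  set S₃ := S.filter fun n => T ≤ n.divisors.card with hS₃
  set B := S.filter fun n : ℕ => x / K < n with hB
  set S₄ := B.filter fun n => ∃ e p s, IsGapFactorization z G n e p s with hS₄
  set S₅ := B.filter fun n => ∃ m p₁ p₂ : ℕ, n = m * p₁ * p₂ ∧ (m : ℝ) ≤ Y ∧
      p₁.Prime ∧ p₂.Prime ∧ R ≤ p₁ ∧ p₂ ≤ p₁ ∧ (p₁ : ℝ) ≤ G * p₂ with hS₅
  set S₆ := B.filter fun n => ∃ m p₁ p₂ p₃ : ℕ, n = m * p₁ * p₂ * p₃ ∧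
      p₁.Prime ∧ p₂.Prime ∧ p₃.Prime ∧ R ≤ p₁ ∧ p₂ ≤ p₁ ∧ (p₁ : ℝ) ≤ G * p₂ ∧ p₃ ≤ p₂ ∧
      (p₂ : ℝ) ≤ G * p₃ with hS₆
  set S₇ := B.filter fun n => ∃ e p, IsPrimeFactorization D R n e 1 p with hS₇
  set S₈ := B.filter fun n => ∃ e g p, IsPrimeFactorization (D * M ^ 3) R n e g p ∧ D < e ∧
      (g : ℝ) ≤ Y with hS₈
  have hBS : ∀ n ∈ B, x / K < n ∧ (n : ℝ) ≤ x := fun n hn =>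
    ⟨(mem_filter.mp hn).2, (hS n (mem_filter.mp hn).1).2⟩
  have hBmono : ∀ m ∈ B, ∀ n ∈ B, m ≤ n →
      ArithmeticFunction.sigma 1 m ≤ ArithmeticFunction.sigma 1 n := fun m hm n hn =>
    hmono m (mem_filter.mp hm).1 n (mem_filter.mp hn).1
  have hcover : S ⊆ S₁ ∪ S₂ ∪ S₃ ∪ S₄ ∪ S₅ ∪ S₆ ∪ S₇ ∪ S₈ := by
    intro n hn
    have hn0 : n ≠ 0 := by have := (hS n hn).1; omega
    simp only [mem_union]
    by_cases h1 : (n : ℝ) ≤ x / K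
    · exact Or.inl (Or.inl (Or.inl (Or.inl (Or.inl (Or.inl (Or.inl (mem_filter.mpr ⟨hn, h1⟩)))))))
    by_cases h2 : ∃ m, M ≤ m ∧ m ^ 2 ∣ n
    · exact Or.inl (Or.inl (Or.inl (Or.inl (Or.inl (Or.inl (Or.inr (mem_filter.mpr ⟨hn, h2⟩)))))))
    by_cases h3 : T ≤ n.divisors.card
    · exact Or.inl (Or.inl (Or.inl (Or.inl (Or.inl (Or.inr (mem_filter.mpr ⟨hn, h3⟩))))))
    push Not at h1 h2 h3
    have hnB : n ∈ B := mem_filter.mpr ⟨hn, h1⟩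
    have h4 : (2 : ℝ) ^ n.primeFactors.card < T := by
      refine lt_of_le_of_lt ?_ h3
      exact_mod_cast two_pow_card_primeFactors_le hn0
    have h5 := hω _ h4
    rcases factorization_shape hn0 hD h2 hMz hzM hMR hG1 hz1 h5.1 (h5.2.trans_lt h1) with
      h | h | h | h | h
    · exact Or.inl (Or.inl (Or.inl (Or.inl (Or.inr (mem_filter.mpr ⟨hnB, h⟩)))))
    · exact Or.inl (Or.inl (Or.inl (Or.inr (mem_filter.mpr ⟨hnB, h⟩))))
    · exact Or.inl (Or.inl (Or.inr (mem_filter.mpr ⟨hnB, h⟩)))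
    · exact Or.inl (Or.inr (mem_filter.mpr ⟨hnB, h⟩))
    · exact Or.inr (mem_filter.mpr ⟨hnB, h⟩)
  have hcard : S.card ≤ S₁.card + S₂.card + S₃.card + S₄.card + S₅.card + S₆.card + S₇.card +
      S₈.card := by
    refine (card_le_card hcover).trans ?_
    iterate 6 refine (card_union_le _ _).trans (Nat.add_le_add_right ?_ _)
    exact card_union_le _ _
  have hcardR : (S.card : ℝ) ≤ S₁.card + S₂.card + S₃.card + S₄.card + S₅.card + S₆.card +
      S₇.card + S₈.card := by exact_mod_cast hcard
  have hSN : ∀ n ∈ S, 1 ≤ n ∧ n ≤ N := fun n hn => ⟨(hS n hn).1, Nat.le_floor (hS n hn).2⟩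
  have b₁ : (S₁.card : ℝ) ≤ x / K := by
    have h1 : S₁ ⊆ Icc 1 ⌊x / K⌋₊ := fun n hn =>
      mem_Icc.mpr ⟨(hS n (mem_filter.mp hn).1).1, Nat.le_floor (mem_filter.mp hn).2⟩
    have h2 := card_le_card h1
    rw [Nat.card_Icc, Nat.add_sub_cancel] at h2
    exact (Nat.cast_le.mpr h2).trans (Nat.floor_le (by positivity))
  have b₂ : (S₂.card : ℝ) ≤ 2 * x / M := by
    refine (card_le_of_square_dvd (N := N) hM S₂ fun n hn => ?_).trans (by gcongr)
    exact ⟨(hSN n (mem_filter.mp hn).1).1, (hSN n (mem_filter.mp hn).1).2, (mem_filter.mp hn).2⟩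
  have b₃ : (S₃.card : ℝ) ≤ x * (1 + Real.log x) / T := by
    have hN1 : 1 ≤ N := Nat.le_floor (by push_cast; linarith)
    have hN1R : (1 : ℝ) ≤ N := by exact_mod_cast hN1
    have := Real.log_nonneg hN1R
    refine (card_le_of_many_divisors (N := N) hT S₃ fun n hn => ?_).trans (by gcongr)
    exact ⟨(hSN n (mem_filter.mp hn).1).1, (hSN n (mem_filter.mp hn).1).2, (mem_filter.mp hn).2⟩
  have b₄ := card_le_of_gap hx hL hG hK hLz S₄ (fun n hn => hBS n (mem_filter.mp hn).1)
    (fun n hn => (mem_filter.mp hn).2)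
    fun m hm n hn => hBmono m (mem_filter.mp hm).1 n (mem_filter.mp hn).1
  have hGR' : G < R := by nlinarith
  have b₅ := card_le_of_two_primes (x := x) (K := K) (by linarith) hG1 hK hGR' hY S₅ fun n hn =>
    ⟨(hBS n (mem_filter.mp hn).1).1, (hBS n (mem_filter.mp hn).1).2, (mem_filter.mp hn).2⟩
  have b₆ := card_le_of_three_primes (x := x) (K := K) (by linarith) hG1 hK hGR S₆ fun n hn =>
    ⟨(hBS n (mem_filter.mp hn).1).1, (hBS n (mem_filter.mp hn).1).2, (mem_filter.mp hn).2⟩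
  have hDQ : (D : ℝ) ≤ ((D * M ^ 3 : ℕ) : ℝ) := by
    exact_mod_cast Nat.le_mul_of_pos_right D (by positivity)
  have b₇ := card_le_of_small_divisor (h := h) hx0 hK hθ hη hD
    (le_trans (by gcongr) hh) (le_trans (by gcongr) hR) hprime S₇
    (fun n hn => hBS n (mem_filter.mp hn).1) (fun n hn => (mem_filter.mp hn).2)
    fun m hm n hn => hBmono m (mem_filter.mp hm).1 n (mem_filter.mp hn).1
  have b₈ := card_le_of_large_divisor (h := h) hx0 hK hE hY
    (Nat.mul_pos hD (by positivity)) hh hR S₈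
    (fun n hn => hBS n (mem_filter.mp hn).1) (fun n hn => by
      obtain ⟨e, g, p, h1, h2, h3⟩ := (mem_filter.mp hn).2
      refine ⟨e, g, p, h1, hED.trans ?_, h3⟩
      exact_mod_cast h2.le)
    fun m hm n hn => hBmono m (mem_filter.mp hm).1 n (mem_filter.mp hn).1
  linarith

end

section

open Finset Filter

set_option maxHeartbeats 2000000 in
/-- Upper bound for the size of sets on which the divisor sum is monotone. -/
lemma eventually_card_le : ∃ C : ℝ, 0 ≤ C ∧ ∀ᶠ x : ℝ in atTop, ∀ S : Finset ℕ,
    (∀ n ∈ S, 1 ≤ n ∧ (n : ℝ) ≤ x) →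
    (∀ m ∈ S, ∀ n ∈ S, m ≤ n →
      ArithmeticFunction.sigma 1 m ≤ ArithmeticFunction.sigma 1 n) →
    (S.card : ℝ) ≤ x / Real.log x +
      C * (x * Real.log (Real.log x) ^ 5 / Real.log x ^ 2) := by
  obtain ⟨C, hC, hprime⟩ := prime_interval_upper 71 11
  refine ⟨1 + 2 + 2 + 636 + 16099200 + 6994944000 + (4 * C + 1) + 216, by positivity, ?_⟩
  filter_upwards [hprime, eventually_le_log 100, eventually_le_loglog 1,
    eventually_loglog_pow_le 2 (ε := 1 / 1000) (by norm_num), eventually_ge_atTop 3]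
    with x hprime hl hu hul hx S hS hmono
  set l := Real.log x with hldef
  set u := Real.log l with hudef
  have hx0 : 0 < x := by linarith
  have hl0 : 0 < l := by linarith
  have hl1 : 1 ≤ l := by linarith
  have hu0 : 0 < u := by linarith
  have hul' : 1000 * u ^ 2 ≤ l := by linarith
  have huu : u ≤ u ^ 2 := le_self_pow₀ hu two_ne_zero
  have hll : l ≤ l ^ 2 := le_self_pow₀ hl1 two_ne_zero
  have hxe : Real.exp l = x := Real.exp_log hx0
  have hle : Real.exp u = l := Real.exp_log hl0
  have hpow : ∀ k : ℕ, l ^ k = Real.exp (k * u) := fun k => by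
    rw [Real.exp_nat_mul, hle]
  have hlpos : ∀ k : ℕ, 1 ≤ l ^ k := fun k => one_le_pow₀ hl1
  have hlmono : ∀ {i j : ℕ}, i ≤ j → l ^ i ≤ l ^ j := fun hij => pow_le_pow_right₀ hl1 hij
  set R := Real.exp (l / (12 * u)) with hRdef
  set Y := Real.exp (42 * u ^ 2) with hYdef
  set M := ⌈l ^ 2⌉₊ with hMdef
  set D := ⌈l ^ 8⌉₊ with hDdef
  set h := ⌊x / l ^ 51⌋₊ with hhdef
  have hMge : l ^ 2 ≤ M := Nat.le_ceil _
  have hDge : l ^ 8 ≤ D := Nat.le_ceil _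
  have hMle : (M : ℝ) ≤ 2 * l ^ 2 := by
    have := (Nat.ceil_lt_add_one (by positivity : 0 ≤ l ^ 2)).le
    linarith [hlpos 2]
  have hMz : (M : ℝ) ≤ l ^ 4 := by
    calc (M : ℝ) ≤ 2 * l ^ 2 := hMle
      _ ≤ l * l ^ 2 := by gcongr; linarith
      _ = l ^ 3 := by ring
      _ ≤ l ^ 4 := hlmono (by norm_num)
  have hDle : (D : ℝ) ≤ l ^ 9 := by
    have := (Nat.ceil_lt_add_one (by positivity : 0 ≤ l ^ 8)).le
    calc (D : ℝ) ≤ 2 * l ^ 8 := by linarith [hlpos 8]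
      _ ≤ l * l ^ 8 := by gcongr; linarith
      _ = l ^ 9 := by ring
  have hhle : (h : ℝ) ≤ x / l ^ 51 := Nat.floor_le (by positivity)
  have hhlt : x / l ^ 51 < h + 1 := Nat.lt_floor_add_one _
  have hM1 : 1 ≤ M := Nat.ceil_pos.mpr (by positivity)
  have hD1 : 0 < D := Nat.ceil_pos.mpr (by positivity)
  have hM3 : (M : ℝ) ^ 3 ≤ l ^ 7 := by
    calc (M : ℝ) ^ 3 ≤ (2 * l ^ 2) ^ 3 := by gcongr
      _ = 8 * l ^ 6 := by ring
      _ ≤ l * l ^ 6 := by gcongr; linarith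
      _ = l ^ 7 := by ring
  have hQ : ((D * M ^ 3 : ℕ) : ℝ) ≤ l ^ 16 := by
    push_cast
    calc (D : ℝ) * M ^ 3 ≤ l ^ 9 * l ^ 7 := by gcongr
      _ = l ^ 16 := by ring
  have hQ3 : 4 * ((D * M ^ 3 : ℕ) : ℝ) ^ 3 ≤ l ^ 49 := by
    calc 4 * ((D * M ^ 3 : ℕ) : ℝ) ^ 3 ≤ l * (l ^ 16) ^ 3 := by gcongr; linarith
      _ = l ^ 49 := by ring
  have hdiv : (49 : ℝ) * u ≤ l / (12 * u) := by
    rw [le_div_iff₀ (by positivity), show 49 * u * (12 * u) = 588 * u ^ 2 by ring]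
    linarith
  have hlR : l ^ 49 ≤ R := by
    rw [hpow]
    exact Real.exp_le_exp.mpr (by exact_mod_cast hdiv)
  have hlogR : Real.log R = l / (12 * u) := Real.log_exp _
  have hlogl : ∀ k : ℕ, Real.log (l ^ k) = k * u := fun k => by
    rw [Real.log_pow]
  have hlogRG : ∀ k : ℕ, k ≤ 20 → l / (24 * u) ≤ Real.log (R / l ^ k) := by
    intro k hk
    rw [Real.log_div (by positivity) (by positivity), hlogR, hlogl]
    have h1 : l / (12 * u) = l / (24 * u) + l / (24 * u) := by
      field_simp
      norm_num
    have h2 : (20 : ℝ) * u ≤ l / (24 * u) := by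
      rw [le_div_iff₀ (by positivity), show 20 * u * (24 * u) = 480 * u ^ 2 by ring]
      linarith
    have h3 : (k : ℝ) * u ≤ 20 * u := by
      gcongr
      exact_mod_cast hk
    linarith
  have hlogY : Real.log Y = 42 * u ^ 2 := Real.log_exp _
  have hwin : x / (h + 1) + 1 ≤ 2 * l ^ 51 := by
    have : x / (h + 1) ≤ l ^ 51 := by
      rw [div_le_iff₀ (by positivity)]
      rw [div_lt_iff₀ (by positivity)] at hhlt
      linarith
    linarith [hlpos 51]
  have hYx : Y * (2 * l ^ 51 * (l ^ 16 * l ^ 16)) ≤ x / l ^ 2 := by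
    rw [le_div_iff₀ (by positivity)]
    calc Y * (2 * l ^ 51 * (l ^ 16 * l ^ 16)) * l ^ 2 ≤ Y * (l * l ^ 51 * (l ^ 16 * l ^ 16)) * l ^ 2 := by
          gcongr
          linarith
      _ = Y * l ^ 86 := by ring
      _ = Real.exp (42 * u ^ 2 + 86 * u) := by
        rw [hpow, Real.exp_add, hYdef]
        norm_num
      _ ≤ Real.exp l := Real.exp_le_exp.mpr (by linarith)
      _ = x := hxe
  have huul : u ≤ l := by linarith
  have hω : ∀ j : ℕ, (2 : ℝ) ^ j < l ^ 4 → ((M : ℝ) ^ 3) ^ j ≤ Y ∧ R ^ j ≤ x / l ^ 2 := by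
    intro j hj
    have hj6 : (j : ℝ) ≤ 6 * u := by
      have h1 := Real.log_le_log (by positivity) hj.le
      rw [Real.log_pow, hlogl] at h1
      have := Real.log_two_gt_d9
      push_cast at h1
      have h2 : (j : ℝ) * (2 / 3) ≤ j * Real.log 2 := by
        gcongr
        linarith
      linarith
    constructor
    · calc ((M : ℝ) ^ 3) ^ j ≤ (l ^ 7) ^ j := by gcongr
        _ = Real.exp (j * (7 * u)) := by
          rw [hpow, ← Real.exp_nat_mul]
          norm_num
        _ ≤ Y := by
          refine Real.exp_le_exp.mpr ?_
          calc (j : ℝ) * (7 * u) ≤ 6 * u * (7 * u) := by gcongr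
            _ = 42 * u ^ 2 := by ring
    · rw [le_div_iff₀ (by positivity)]
      calc R ^ j * l ^ 2 = Real.exp (j * (l / (12 * u)) + 2 * u) := by
            rw [hpow, hRdef, ← Real.exp_nat_mul, Real.exp_add]
            norm_num
        _ ≤ Real.exp l := by
          refine Real.exp_le_exp.mpr ?_
          have h1 : (j : ℝ) * (l / (12 * u)) ≤ 6 * u * (l / (12 * u)) := by gcongr
          have h2 : 6 * u * (l / (12 * u)) = l / 2 := by
            field_simp
            norm_num
          linarith
        _ = x := hxe
  have hKD : x / l ^ 11 ≤ x / (l ^ 2 * D) := by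
    gcongr
    calc l ^ 2 * (D : ℝ) ≤ l ^ 2 * l ^ 9 := by gcongr
      _ = l ^ 11 := by ring
  set θ := 1 / l * (1 + C * u / l) with hθ
  set η := C * x / l ^ 71 with hη
  have key := card_le_of_parameters (x := x) (K := l ^ 2) (T := l ^ 4) (L := l ^ 4) (z := l ^ 4)
    (G := l ^ 10) (R := R) (Y := Y) (E := l ^ 2) (θ := θ) (η := η) (M := M) (D := D) (h := h)
    hx (hlpos 2) (by positivity) hM1 (hlpos 4) le_rfl hMz ?_
    (hM3.trans ((hlmono (by norm_num)).trans hlR)) ?_ ?_ hω (Real.one_le_exp (by positivity))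
    (by positivity) (by rw [← pow_mul]; exact hDge) hD1 ?_ (hQ3.trans hlR) (by positivity)
    (by positivity) ?_ S hS hmono
  · have hw : 0 ≤ x / l ^ 2 := by positivity
    have hu5 : ∀ k : ℕ, k ≤ 5 → x / l ^ 2 * u ^ k ≤ x / l ^ 2 * u ^ 5 := fun k hk => by
      gcongr
    have hw5 : x / l ^ 2 ≤ x / l ^ 2 * u ^ 5 := le_mul_of_one_le_right hw (one_le_pow₀ hu)
    have t₂ : 2 * x / M ≤ 2 * (x / l ^ 2) := by
      rw [← mul_div_assoc]
      gcongr
    have t₃ : x * (1 + l) / l ^ 4 ≤ 2 * (x / l ^ 2) := by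
      calc x * (1 + l) / l ^ 4 ≤ x * (2 * l ^ 2) / l ^ 4 := by
            gcongr
            linarith
        _ = _ := by field_simp
    have t₄ : (52 / l ^ 4 + 54 * l ^ 4 * l ^ 2 / l ^ 10) * x * (2 * l * (3 * l)) =
        636 * (x / l ^ 2) := by
      field_simp
      norm_num
    have hp : ∀ a b : ℝ, ∀ k : ℕ, k ≤ 20 → 0 ≤ a → a ≤ b →
        a / Real.log (R / l ^ k) ≤ b * (24 * u) / l := fun a b k hk ha hab => by
      calc a / Real.log (R / l ^ k) ≤ b / (l / (24 * u)) := by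
            have := hlogRG k hk
            have := ha.trans hab
            have h1 : 0 < l / (24 * u) := by positivity
            gcongr
        _ = _ := by field_simp
    have t₅ : 5 * x / Real.log R * (20 * (1 + Real.log (l ^ 2 * l ^ 10)) / Real.log (R / l ^ 10)) *
        (1 + Real.log Y) ≤ 16099200 * (x / l ^ 2 * u ^ 5) := by
      rw [hlogR, hlogY, ← pow_add, hlogl]
      have h1 := hp (20 * (1 + (12 : ℕ) * u)) (260 * u) 10 (by norm_num) (by positivity)
        (by push_cast; linarith)
      calc _ ≤ 5 * x / (l / (12 * u)) * (260 * u * (24 * u) / l) * (43 * u ^ 2) := by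
            gcongr
            linarith
        _ = _ := by
          field_simp
          norm_num
    have t₆ : 5 * x / Real.log R * (20 * (1 + Real.log (l ^ 2 * (l ^ 10) ^ 2)) /
        Real.log (R / (l ^ 10) ^ 2)) * (20 * (1 + Real.log (l ^ 10)) / Real.log (R / (l ^ 10) ^ 2)) *
        (1 + l) ≤ 6994944000 * (x / l ^ 2 * u ^ 5) := by
      rw [hlogR, ← pow_mul, ← pow_add, hlogl, hlogl]
      have h1 := hp (20 * (1 + (22 : ℕ) * u)) (460 * u) 20 (by norm_num) (by positivity)
        (by push_cast; linarith)
      have h2 := hp (20 * (1 + (10 : ℕ) * u)) (220 * u) 20 (by norm_num) (by positivity)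
        (by push_cast; linarith)
      have h3 : 0 < Real.log (R / l ^ 20) :=
        lt_of_lt_of_le (by positivity) (hlogRG 20 (by norm_num))
      calc _ ≤ 5 * x / (l / (12 * u)) * (460 * u * (24 * u) / l) * (220 * u * (24 * u) / l) *
            (2 * l) := by
            norm_num at h1 h2 ⊢
            gcongr
            linarith
        _ = _ := by
          field_simp
          norm_num
    have hCu : 1 + C * u / l ≤ 1 + C := by
      have : C * u / l ≤ C := by
        rw [div_le_iff₀ hl0]
        gcongr
      linarith
    have t₇ : θ * (x + h) + (x / (h + 1) + 1) * (D * η * D) ≤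
        x / l + C * (x / l ^ 2 * u) + (1 + C) * (x / l ^ 2) + 2 * C * (x / l ^ 2) := by
      have h1 : θ * x = x / l + C * (x / l ^ 2 * u) := by
        rw [hθ]
        field_simp
      have h2 : θ * h ≤ (1 + C) * (x / l ^ 2) := by
        calc θ * h ≤ 1 / l * (1 + C) * (x / l ^ 51) := by
              rw [hθ]
              gcongr
          _ ≤ 1 / l * (1 + C) * (x / l ^ 1) := by
            gcongr
            norm_num
          _ = _ := by field_simp
      have h3 : (x / (h + 1) + 1) * (D * η * D) ≤ 2 * C * (x / l ^ 2) := by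
        calc (x / (h + 1) + 1) * (D * η * D) ≤ 2 * l ^ 51 * (l ^ 9 * η * l ^ 9) := by
              have : 0 ≤ η := by positivity
              gcongr
          _ = 2 * C * (x / l ^ 2) := by
            rw [hη]
            field_simp
      rw [mul_add]
      linarith
    have t₈ : 5 / 2 / l ^ 2 * (x + h) * (1 + Real.log Y) +
        Y * ((x / (h + 1) + 1) * (((D * M ^ 3 : ℕ) : ℝ) * ((D * M ^ 3 : ℕ) : ℝ))) ≤
        215 * (x / l ^ 2 * u ^ 2) + x / l ^ 2 := by
      have h1 : (h : ℝ) ≤ x := hhle.trans (div_le_self hx0.le (hlpos 51))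
      refine add_le_add ?_ (le_trans ?_ hYx)
      · rw [hlogY]
        calc 5 / 2 / l ^ 2 * (x + h) * (1 + 42 * u ^ 2) ≤ 5 / 2 / l ^ 2 * (x + x) * (43 * u ^ 2) := by
              gcongr
              linarith
          _ = _ := by
            field_simp
            norm_num
      · have : 0 ≤ Y := (Real.exp_pos _).le
        gcongr
    have e1 := hu5 1 (by norm_num)
    have e2 := hu5 2 (by norm_num)
    rw [pow_one] at e1
    have e3 : x * u ^ 5 / l ^ 2 = x / l ^ 2 * u ^ 5 := by ring
    rw [e3]
    have e4 := mul_le_mul_of_nonneg_left e1 hC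
    have e5 := mul_le_mul_of_nonneg_left hw5 hC
    linarith
  · calc l ^ 4 ≤ (l ^ 2) ^ 3 := by rw [← pow_mul]; exact hlmono (by norm_num)
      _ ≤ (M : ℝ) ^ 3 := by gcongr
  · calc 4 * l ^ 4 ≤ l * l ^ 4 := by gcongr; linarith
      _ = l ^ 5 := by ring
      _ ≤ l ^ 10 := hlmono (by norm_num)
  · refine lt_of_lt_of_le ?_ hlR
    rw [← pow_mul]
    exact pow_lt_pow_right₀ (by linarith) (by norm_num)
  · calc 4 * ((D * M ^ 3 : ℕ) : ℝ) ^ 3 * (h * l ^ 2) ≤ l ^ 49 * (x / l ^ 51 * l ^ 2) := by gcongr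
      _ = x := by field_simp
  · intro s t hs hst ht
    refine (hprime s t (hKD.trans hs) hst ht).trans_eq ?_
    rw [hθ, hη]
    ring

end

section
open Finset Filter

lemma sigma1_eq (n : ℕ) : sigma1 n = ArithmeticFunction.sigma 1 n :=
  (ArithmeticFunction.sigma_one_apply n).symm

lemma card_le_floor_of_subset {x : ℝ} {B : Finset ℕ}
    (hB : (B : Set ℕ) ⊆ {n : ℕ | 1 ≤ n ∧ (n : ℝ) ≤ x}) : B.card ≤ ⌊x⌋₊ := by
  have h : B ⊆ Icc 1 ⌊x⌋₊ := fun n hn => mem_Icc.mpr ⟨(hB hn).1, Nat.le_floor (hB hn).2⟩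
  simpa using card_le_card h

lemma bddAbove_card_of_subset (x : ℝ) (P : Finset ℕ → Prop) :
    BddAbove {k : ℕ | ∃ B : Finset ℕ, ↑B ⊆ {n : ℕ | 1 ≤ n ∧ (n : ℝ) ≤ x} ∧ P B ∧ B.card = k} :=
  ⟨⌊x⌋₊, by
    rintro _ ⟨B, hB, -, rfl⟩
    exact card_le_floor_of_subset hB⟩

lemma exists_card_eq_MsigmaX (x : ℝ) : ∃ B : Finset ℕ, (∀ n ∈ B, 1 ≤ n ∧ (n : ℝ) ≤ x) ∧
    (∀ m ∈ B, ∀ n ∈ B, m ≤ n → sigma1 m ≤ sigma1 n) ∧ B.card = MsigmaX x := by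
  have hne : {k : ℕ | ∃ B : Finset ℕ, ↑B ⊆ {n : ℕ | 1 ≤ n ∧ (n : ℝ) ≤ x} ∧
      (∀ m ∈ B, ∀ n ∈ B, m ≤ n → sigma1 m ≤ sigma1 n) ∧ B.card = k}.Nonempty := ⟨0, ∅, by simp⟩
  obtain ⟨B, h1, h2, h3⟩ := Nat.sSup_mem hne (bddAbove_card_of_subset x fun B =>
    ∀ m ∈ B, ∀ n ∈ B, m ≤ n → sigma1 m ≤ sigma1 n)
  exact ⟨B, fun n hn => h1 hn, h2, h3⟩

lemma primePi_eq_card {x : ℝ} (hx : 0 ≤ x) :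
    primePi x = ((Icc 1 ⌊x⌋₊).filter Nat.Prime).card := by
  rw [primePi, ← Set.ncard_coe_finset]
  congr 1
  ext p
  simp only [Set.mem_ofPred_eq, coe_filter, mem_Icc, Nat.le_floor_iff hx]
  exact ⟨fun h => ⟨⟨h.1.one_le, h.2⟩, h.1⟩, fun h => ⟨h.2, h.1.2⟩⟩

lemma primePi_eq_primeCounting {x : ℝ} (hx : 0 ≤ x) : primePi x = Nat.primeCounting ⌊x⌋₊ := by
  rw [primePi_eq_card hx, Nat.primeCounting, Nat.primeCounting', Nat.count_eq_card_filter_range]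
  congr 1
  ext p
  simp only [mem_filter, mem_Icc, mem_range, Nat.lt_succ_iff]
  exact ⟨fun h => ⟨h.1.2, h.2⟩, fun h => ⟨⟨h.2.one_le, h.1⟩, h.2⟩⟩

lemma primePi_le_MsigmaX {x : ℝ} (hx : 0 ≤ x) : primePi x ≤ MsigmaX x := by
  rw [primePi_eq_card hx]
  refine le_csSup (bddAbove_card_of_subset x fun B =>
    ∀ m ∈ B, ∀ n ∈ B, m ≤ n → sigma1 m ≤ sigma1 n) ⟨_, ?_, ?_, rfl⟩
  · intro n hn
    rw [mem_coe, mem_filter, mem_Icc] at hn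
    exact ⟨hn.1.1, (Nat.le_floor_iff hx).mp hn.1.2⟩
  · intro m hm n hn hmn
    have hm' := (mem_filter.mp hm).2
    have hn' := (mem_filter.mp hn).2
    rw [sigma1, sigma1, hm'.divisors, hn'.divisors, sum_pair hm'.one_lt.ne, sum_pair hn'.one_lt.ne]
    omega

lemma MsigmaX_le {x : ℝ} (hx : 0 ≤ x) : (MsigmaX x : ℝ) ≤ x := by
  obtain ⟨B, hB, -, h⟩ := exists_card_eq_MsigmaX x
  rw [← h]
  exact (Nat.cast_le.mpr (card_le_floor_of_subset fun n hn => hB n hn)).trans (Nat.floor_le hx)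

lemma eventually_MsigmaX_le : ∃ C : ℝ, 0 ≤ C ∧ ∀ᶠ x : ℝ in atTop,
    (MsigmaX x : ℝ) ≤ (1 + C * Real.log (Real.log x) ^ 5 / Real.log x) * primePi x := by
  obtain ⟨C₀, hC₀, h₀⟩ := eventually_card_le
  obtain ⟨C₁, hC₁, h₁⟩ := primeCounting_lower
  refine ⟨2 * (C₀ + C₁), by positivity, ?_⟩
  have hε : (0 : ℝ) < 1 / (2 * (C₁ + 1)) := by positivity
  filter_upwards [h₀, h₁, eventually_le_log 1, eventually_le_loglog 1,
    eventually_loglog_pow_le 1 hε, eventually_ge_atTop 0] with x h₀ h₁ hl hu hul hx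
  obtain ⟨B, hB, hmono, hcard⟩ := exists_card_eq_MsigmaX x
  have key := h₀ B hB fun m hm n hn hmn => by
    simpa only [sigma1_eq] using hmono m hm n hn hmn
  rw [hcard] at key
  rw [← primePi_eq_primeCounting hx] at h₁
  set l := Real.log x
  set u := Real.log l
  set π : ℝ := ((primePi x : ℕ) : ℝ)
  have hl0 : 0 < l := by linarith
  have hw : 0 ≤ x / l ^ 2 := by positivity
  have hu5 : x / l ^ 2 * u ≤ x * u ^ 5 / l ^ 2 := by
    calc x / l ^ 2 * u ≤ x / l ^ 2 * u ^ 5 := by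
          gcongr
          exact le_self_pow₀ hu (by norm_num)
      _ = _ := by ring
  have h₂ : x / l ≤ π + C₁ * (x / l ^ 2 * u) := by
    have : x / l * (1 - C₁ * u / l) = x / l - C₁ * (x / l ^ 2 * u) := by
      field_simp
    linarith
  have h₃ : C₁ * u / l ≤ 1 / 2 := by
    rw [pow_one, one_div_mul_eq_div, le_div_iff₀ (by positivity)] at hul
    rw [div_le_iff₀ hl0]
    nlinarith
  have h₄ : x / l ≤ 2 * π := by
    have : x / l * (1 / 2) ≤ x / l * (1 - C₁ * u / l) := by
      gcongr
      linarith
    linarith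
  have h₅ : (MsigmaX x : ℝ) ≤ π + (C₀ + C₁) * (x * u ^ 5 / l ^ 2) := by
    have := mul_le_mul_of_nonneg_left hu5 hC₁
    linarith
  calc (MsigmaX x : ℝ) ≤ π + (C₀ + C₁) * (x * u ^ 5 / l ^ 2) := h₅
    _ = π + (C₀ + C₁) * (u ^ 5 / l) * (x / l) := by
      field_simp
    _ ≤ π + (C₀ + C₁) * (u ^ 5 / l) * (2 * π) := by gcongr
    _ = _ := by ring

end

theorem stmt18 : ∃ C : ℝ, 0 < C ∧ ∀ x : ℝ, 10 ≤ x →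
    primePi x ≤ MsigmaX x ∧
    (MsigmaX x : ℝ) ≤ (1 + C * (Real.log (Real.log x)) ^ 5 / Real.log x) * primePi x := by
  obtain ⟨C, hC, h⟩ := eventually_MsigmaX_le
  obtain ⟨x₁, hx₁⟩ := Filter.eventually_atTop.mp h
  set x₀ := max x₁ 10 with hx₀
  have h10 : 10 ≤ x₀ := le_max_right _ _
  have hlx₀ : 0 < Real.log x₀ := Real.log_pos (by linarith)
  refine ⟨C + 32 * x₀ * Real.log x₀, by positivity, fun x hx => ?_⟩
  refine ⟨primePi_le_MsigmaX (by linarith), ?_⟩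
  have hlog2 := Real.log_two_gt_d9
  have hl : 2 ≤ Real.log x := by
    have h1 := Real.log_le_log (by norm_num) (show (2 : ℝ) ^ 3 ≤ x by linarith)
    rw [Real.log_pow] at h1
    push_cast at h1
    linarith
  have hu : 1 / 2 ≤ Real.log (Real.log x) := by
    have h1 := Real.log_le_log (by norm_num) hl
    linarith
  rcases le_or_gt x₁ x with hxx | hxx
  · refine (hx₁ x hxx).trans ?_
    gcongr
    exact le_add_of_nonneg_right (by positivity)
  · have hxx₀ : x ≤ x₀ := hxx.le.trans (le_max_left _ _)
    have hπ : (1 : ℝ) ≤ primePi x := by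
      rw [primePi_eq_card (by linarith)]
      have h1 : 0 < ((Finset.Icc 1 ⌊x⌋₊).filter Nat.Prime).card := Finset.card_pos.mpr
        ⟨2, Finset.mem_filter.mpr ⟨Finset.mem_Icc.mpr ⟨by norm_num, Nat.le_floor
          (by push_cast; linarith)⟩, Nat.prime_two⟩⟩
      exact_mod_cast h1
    have hlxx : Real.log x ≤ Real.log x₀ := Real.log_le_log (by linarith) hxx₀
    have h1 : x₀ ≤ 32 * x₀ * Real.log x₀ * Real.log (Real.log x) ^ 5 / Real.log x := by
      rw [le_div_iff₀ (by linarith)]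
      calc x₀ * Real.log x ≤ x₀ * Real.log x₀ := by gcongr
        _ = 32 * x₀ * Real.log x₀ * (1 / 2) ^ 5 := by ring
        _ ≤ _ := by gcongr
    have h2 : 0 ≤ C * Real.log (Real.log x) ^ 5 / Real.log x := by positivity
    calc (MsigmaX x : ℝ) ≤ x := MsigmaX_le (by linarith)
      _ ≤ (1 + (C * Real.log (Real.log x) ^ 5 / Real.log x +
          32 * x₀ * Real.log x₀ * Real.log (Real.log x) ^ 5 / Real.log x)) * 1 := by linarith
      _ ≤ (1 + (C * Real.log (Real.log x) ^ 5 / Real.log x +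
          32 * x₀ * Real.log x₀ * Real.log (Real.log x) ^ 5 / Real.log x)) * primePi x := by
        gcongr
      _ = _ := by ring
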